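/- Let (u,Π) be a classical axisymmetric solution of the 3D Navier–Stokes equations on Q(1). Let β∈(0,1/8), K>0, and let z₀=(0,x_{0,3},t₀)∈Q(1/8) be a point on the symmetry axis such that A(z₀,R)·ω(R)^β ≤ K for all 0<R≤1/4. Then for every τ∈(0,1) there exists a constant c>0 depending only on K, β, τ such that for all 0<ρ<R≤1/4 one has osc_{Q(z₀,ρ)} Γ ≤ exp(−c((ln(100/ρ))^τ − (ln(100/R))^τ − 2)) · osc_{Q(z₀,R)} Γ, where osc_{Q} Γ = sup_{Q} Γ − inf_{Q} Γ. -/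

import Mathlib

open Real MeasureTheory Set
open scoped ENNReal
noncomputable section

abbrev E3 := EuclideanSpace ℝ (Fin 3)

/-- `i`-th standard basis vector of `ℝ³`. -/
def ee (i : Fin 3) : E3 := EuclideanSpace.single i 1

/-- partial derivative of a scalar function in the direction `eᵢ`. -/
def pd (f : E3 → ℝ) (i : Fin 3) (x : E3) : ℝ := fderiv ℝ f x (ee i)

/-- Laplacian of a scalar function. -/
def lap (f : E3 → ℝ) (x : E3) : ℝ := ∑ i, pd (fun y => pd f i y) i x

/-- parabolic cylinder `Q(z₀,R) = B(x₀,R) × (t₀ - R², t₀)`. -/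
def Qyl (z₀ : E3 × ℝ) (R : ℝ) : Set (E3 × ℝ) :=
  (Metric.ball z₀.1 R) ×ˢ (Ioo (z₀.2 - R ^ 2) z₀.2)

/-- `(u, P)` is a classical solution of the 3D Navier–Stokes equations on the open set `U`,
which contains the closure of `Q(1)`. -/
structure IsNSQ1 (u : E3 → ℝ → E3) (P : E3 → ℝ → ℝ) (U : Set (E3 × ℝ)) : Prop where
  open_U : IsOpen U
  subset_U : closure (Qyl (0, 0) 1) ⊆ U
  smooth_u : ContDiffOn ℝ (⊤ : ℕ∞) (fun z : E3 × ℝ => u z.1 z.2) U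
  smooth_P : ContDiffOn ℝ (⊤ : ℕ∞) (fun z : E3 × ℝ => P z.1 z.2) U
  momentum : ∀ x : E3, ∀ t : ℝ, (x, t) ∈ U → ∀ j : Fin 3,
    deriv (fun s => u x s j) t
      + (∑ i, u x t i * pd (fun y => u y t j) i x)
      - lap (fun y => u y t j) x
      + pd (fun y => P y t) j x = 0
  divfree : ∀ x : E3, ∀ t : ℝ, (x, t) ∈ U → ∑ i, pd (fun y => u y t i) i x = 0

/-- `(u, P)` is axially symmetric on `U`: in cylindrical coordinates
`u = uʳ eᵣ + uᶿ e_θ + u³ e₃` and `P = p(r, x₃, t)`. -/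
def IsAxisym (u : E3 → ℝ → E3) (P : E3 → ℝ → ℝ) (U : Set (E3 × ℝ)) : Prop :=
  ∃ ur uθ u3 pp : ℝ → ℝ → ℝ → ℝ,
    ∀ x : E3, ∀ t : ℝ, (x, t) ∈ U → x 0 ^ 2 + x 1 ^ 2 ≠ 0 →
      u x t 0 = ur (Real.sqrt (x 0 ^ 2 + x 1 ^ 2)) (x 2) t
                  * (x 0 / Real.sqrt (x 0 ^ 2 + x 1 ^ 2))
                - uθ (Real.sqrt (x 0 ^ 2 + x 1 ^ 2)) (x 2) t
                  * (x 1 / Real.sqrt (x 0 ^ 2 + x 1 ^ 2)) ∧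
      u x t 1 = ur (Real.sqrt (x 0 ^ 2 + x 1 ^ 2)) (x 2) t
                  * (x 1 / Real.sqrt (x 0 ^ 2 + x 1 ^ 2))
                + uθ (Real.sqrt (x 0 ^ 2 + x 1 ^ 2)) (x 2) t
                  * (x 0 / Real.sqrt (x 0 ^ 2 + x 1 ^ 2)) ∧
      u x t 2 = u3 (Real.sqrt (x 0 ^ 2 + x 1 ^ 2)) (x 2) t ∧
      P x t = pp (Real.sqrt (x 0 ^ 2 + x 1 ^ 2)) (x 2) t

/-- `Γ = r uᶿ = x₁ u₂ - x₂ u₁`. -/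
def Gam (u : E3 → ℝ → E3) (x : E3) (t : ℝ) : ℝ := x 0 * u x t 1 - x 1 * u x t 0

/-- Cartesian components of `b = uʳ eᵣ + u³ e₃ = u - uᶿ e_θ`. -/
def bcomp (u : E3 → ℝ → E3) (x : E3) (t : ℝ) : Fin 3 → ℝ :=
  ![u x t 0 + x 1 * Gam u x t / (x 0 ^ 2 + x 1 ^ 2),
    u x t 1 - x 0 * Gam u x t / (x 0 ^ 2 + x 1 ^ 2),
    u x t 2]

/-- Euclidean norm of `b`. -/
def bnorm (u : E3 → ℝ → E3) (x : E3) (t : ℝ) : ℝ :=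
  Real.sqrt (∑ i, (bcomp u x t i) ^ 2)

/-- `A(z₀,R)`. -/
def AA (u : E3 → ℝ → E3) (z₀ : E3 × ℝ) (R : ℝ) : ℝ :=
  ⨆ t ∈ Ioo (z₀.2 - R ^ 2) z₀.2, R⁻¹ * ∫ x in Metric.ball z₀.1 R, ‖u x t‖ ^ 2

/-- `E(z₀,R)`. -/
def EE (u : E3 → ℝ → E3) (z₀ : E3 × ℝ) (R : ℝ) : ℝ :=
  R⁻¹ * ∫ t in Ioo (z₀.2 - R ^ 2) z₀.2, ∫ x in Metric.ball z₀.1 R,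
    ∑ j, ∑ i, (pd (fun y => u y t j) i x) ^ 2

/-- `C(z₀,R)`. -/
def CC (u : E3 → ℝ → E3) (z₀ : E3 × ℝ) (R : ℝ) : ℝ :=
  (R ^ 2)⁻¹ * ∫ t in Ioo (z₀.2 - R ^ 2) z₀.2, ∫ x in Metric.ball z₀.1 R, ‖u x t‖ ^ 3

/-- `D(z₀,R)`. -/
def DD (P : E3 → ℝ → ℝ) (z₀ : E3 × ℝ) (R : ℝ) : ℝ :=
  (R ^ 2)⁻¹ * ∫ t in Ioo (z₀.2 - R ^ 2) z₀.2, ∫ x in Metric.ball z₀.1 R, |P x t| ^ (3/2 : ℝ)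

/-- `𝓔(z₀,R) = A + E + D`. -/
def EEE (u : E3 → ℝ → E3) (P : E3 → ℝ → ℝ) (z₀ : E3 × ℝ) (R : ℝ) : ℝ :=
  AA u z₀ R + EE u z₀ R + DD P z₀ R

/-- the weight `ω(R) = (ln ln (100/R))⁻¹`. -/
def omg (R : ℝ) : ℝ := (Real.log (Real.log (100 / R)))⁻¹

/-- `G(z₀,R) = R^{1-3/p-2/q} ‖b‖_{L^{p,q}(Q(z₀,R))}` (space norm `Lᵖ`, time norm `L^q`). -/
def Gfun (u : E3 → ℝ → E3) (p q : ℝ≥0∞) (z₀ : E3 × ℝ) (R : ℝ) : ℝ :=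
  R ^ (1 - 3 / p.toReal - 2 / q.toReal) *
    (eLpNorm (fun t =>
        (eLpNorm (fun x => bnorm u x t) p (volume.restrict (Metric.ball z₀.1 R))).toReal)
      q (volume.restrict (Ioo (z₀.2 - R ^ 2) z₀.2))).toReal

/-- `m_R = inf_{Q(R)} Γ`. -/
def mR (u : E3 → ℝ → E3) (R : ℝ) : ℝ :=
  sInf ((fun z : E3 × ℝ => Gam u z.1 z.2) '' Qyl (0, 0) R)

/-- `M_R = sup_{Q(R)} Γ`. -/
def MMR (u : E3 → ℝ → E3) (R : ℝ) : ℝ :=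
  sSup ((fun z : E3 × ℝ => Gam u z.1 z.2) '' Qyl (0, 0) R)

/-- `J_R = M_R - m_R`. -/
def JR (u : E3 → ℝ → E3) (R : ℝ) : ℝ := MMR u R - mR u R

/-- the normalized function `h`. -/
def hfun (u : E3 → ℝ → E3) (R : ℝ) (x : E3) (t : ℝ) : ℝ :=
  if -(mR u R) < MMR u R then 2 * (MMR u R - Gam u x t) / JR u R
  else 2 * (Gam u x t - mR u R) / JR u R

/-- oscillation of `Γ` over `Q(z₀,R)`. -/
def oscΓ (u : E3 → ℝ → E3) (z₀ : E3 × ℝ) (R : ℝ) : ℝ :=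
  sSup ((fun z : E3 × ℝ => Gam u z.1 z.2) '' Qyl z₀ R) -
    sInf ((fun z : E3 × ℝ => Gam u z.1 z.2) '' Qyl z₀ R)

open Filter Topology

/-- closed unit ball of `ℝ³`. -/
abbrev cB : Set E3 := Metric.closedBall (0 : E3) 1

/-- Lebesgue measure restricted to the open unit ball. -/
abbrev μB : Measure E3 := volume.restrict (Metric.ball (0 : E3) 1)

/-- the cutoff `(1 - |x|²)₊`. -/
def psi (x : E3) : ℝ := max (1 - ‖x‖ ^ 2) 0

lemma psi_nonneg (x : E3) : 0 ≤ psi x := le_max_right _ _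

lemma psi_le_one (x : E3) : psi x ≤ 1 := max_le (by nlinarith [sq_nonneg ‖x‖]) zero_le_one

lemma psi_continuous : Continuous psi := by unfold psi; fun_prop

lemma psi_eq_zero {x : E3} (hx : 1 ≤ ‖x‖) : psi x = 0 :=
  max_eq_right (by nlinarith)

lemma psi_eq {x : E3} (hx : x ∈ cB) : psi x = 1 - ‖x‖ ^ 2 := by
  have : ‖x‖ ≤ 1 := by simpa using hx
  exact max_eq_left (by nlinarith [norm_nonneg x])

lemma psi_pos {x : E3} (hx : x ∈ Metric.ball (0 : E3) 1) : 0 < psi x := by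
  have : ‖x‖ < 1 := by simpa using hx
  exact lt_max_of_lt_left (by nlinarith [norm_nonneg x])

lemma hasDerivAt_max_zero_pow {n : ℕ} (hn : 2 ≤ n) (y : ℝ) :
    HasDerivAt (fun y : ℝ => max y 0 ^ n) (n * max y 0 ^ (n - 1)) y := by
  rcases lt_trichotomy y 0 with h | h | h
  · have : (fun y : ℝ => max y 0 ^ n) =ᶠ[𝓝 y] fun _ => 0 := by
      filter_upwards [Iio_mem_nhds h] with z hz
      rw [max_eq_right (le_of_lt hz), zero_pow (by omega)]
    rw [max_eq_right h.le, zero_pow (by omega), mul_zero]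
    exact (hasDerivAt_const y (0 : ℝ)).congr_of_eventuallyEq this
  · subst h
    rw [max_self, zero_pow (by omega), mul_zero]
    have h0 : HasDerivAt (fun y : ℝ => y ^ n) 0 0 := by
      have := hasDerivAt_pow n (0 : ℝ)
      rwa [zero_pow (by omega : n - 1 ≠ 0), mul_zero] at this
    rw [hasDerivAt_iff_isLittleO_nhds_zero] at h0 ⊢
    refine (Asymptotics.IsBigO.of_bound 1 ?_).trans_isLittleO h0
    refine Eventually.of_forall fun z => ?_
    simp only [zero_add, max_self, smul_zero, sub_zero, one_mul, norm_pow,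
      zero_pow (by omega : n ≠ 0), Real.norm_eq_abs]
    refine pow_le_pow_left₀ (abs_nonneg _) ?_ _
    rcases le_total z 0 with hz | hz
    · simp [max_eq_right hz]
    · simp [max_eq_left hz]
  · have : (fun y : ℝ => max y 0 ^ n) =ᶠ[𝓝 y] fun y => y ^ n := by
      filter_upwards [Ioi_mem_nhds h] with z hz
      rw [max_eq_left (le_of_lt hz)]
    rw [max_eq_left h.le]
    exact (hasDerivAt_pow n y).congr_of_eventuallyEq this

lemma norm_sq_add_smul_ee (x : E3) (i : Fin 3) (s : ℝ) :
    ‖x + s • ee i‖ ^ 2 = ‖x‖ ^ 2 + 2 * s * x i + s ^ 2 := by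
  simp only [EuclideanSpace.norm_sq_eq, Fin.sum_univ_three, ee, Real.norm_eq_abs, sq_abs]
  fin_cases i <;> simp <;> ring

lemma hasLineDerivAt_psi_pow {n : ℕ} (hn : 2 ≤ n) (x : E3) (i : Fin 3) :
    HasLineDerivAt ℝ (fun y => psi y ^ n) (-(2 * n * x i * psi x ^ (n - 1))) x (ee i) := by
  unfold HasLineDerivAt psi
  have h1 : HasDerivAt (fun s : ℝ => 1 - ‖x + s • ee i‖ ^ 2) (-(2 * x i)) 0 := by
    simp only [norm_sq_add_smul_ee]
    have := (((hasDerivAt_id (0:ℝ)).const_mul (2 * x i)).add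
      ((hasDerivAt_id (0:ℝ)).pow 2)).const_sub (1 - ‖x‖ ^ 2)
    refine (this.congr_deriv (by simp)).congr_of_eventuallyEq (Eventually.of_forall fun s => ?_)
    simp; ring
  have h2 := (hasDerivAt_max_zero_pow hn (1 - ‖x + (0:ℝ) • ee i‖ ^ 2)).comp (0:ℝ) h1
  refine h2.congr_deriv ?_
  simp; ring

lemma integrable_muB {f : E3 → ℝ} (hf : ContinuousOn f cB) : Integrable f μB :=
  (hf.integrableOn_compact (isCompact_closedBall _ _)).mono_set Metric.ball_subset_closedBall

lemma integral_muB_mono {f g : E3 → ℝ} (hf : ContinuousOn f cB) (hg : ContinuousOn g cB)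
    (h : ∀ x ∈ cB, f x ≤ g x) : ∫ x, f x ∂μB ≤ ∫ x, g x ∂μB :=
  setIntegral_mono_on (integrable_muB hf) (integrable_muB hg) Metric.isOpen_ball.measurableSet
    fun x hx => h x (Metric.ball_subset_closedBall hx)

lemma integral_muB_congr {f g : E3 → ℝ} (h : ∀ x ∈ cB, f x = g x) :
    ∫ x, f x ∂μB = ∫ x, g x ∂μB :=
  setIntegral_congr_fun Metric.isOpen_ball.measurableSet
    fun x hx => h x (Metric.ball_subset_closedBall hx)

lemma integral_muB_nonneg {f : E3 → ℝ} (h : ∀ x ∈ cB, 0 ≤ f x) : 0 ≤ ∫ x, f x ∂μB :=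
  setIntegral_nonneg Metric.isOpen_ball.measurableSet
    fun x hx => h x (Metric.ball_subset_closedBall hx)

lemma integral_lineDeriv_eq_zero {P D : E3 → ℝ} {v : E3} (hP : Integrable P) (hD : Integrable D)
    (h : ∀ x, HasLineDerivAt ℝ P (D x) x v) : ∫ x, D x = 0 := by
  have := integral_bilinear_hasLineDerivAt_right_eq_neg_left_of_integrable
    (μ := (volume : Measure E3)) (f := fun _ => (1:ℝ)) (f' := fun _ => (0:ℝ)) (g := P) (g' := D)
    (v := v) (B := ContinuousLinearMap.mul ℝ ℝ) (by simp) (by simpa using hD) (by simpa using hP)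
    (fun x _ => by simpa [HasLineDerivAt] using hasDerivAt_const (0:ℝ) (1:ℝ)) (fun x _ => h x)
  simpa using this

/-- integration by parts against the weight `psi ^ n`. -/
lemma integral_psi_pow_mul_lineDeriv {n : ℕ} (hn : 2 ≤ n) {S S' : E3 → ℝ} {i : Fin 3}
    (hS : ContinuousOn S cB) (hS' : ContinuousOn S' cB)
    (hd : ∀ x ∈ cB, HasLineDerivAt ℝ S (S' x) x (ee i)) :
    ∫ x, psi x ^ n * S' x ∂μB = 2 * n * ∫ x, psi x ^ (n - 1) * (x i * S x) ∂μB := by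
  have hx : Continuous fun x : E3 => x i := by fun_prop
  have hpc := psi_continuous
  have key : ∀ {G : E3 → ℝ}, ContinuousOn G cB → (∀ x, 1 ≤ ‖x‖ → G x = 0) → Integrable G := by
    intro G hG h0
    have := (hG.integrableOn_compact (isCompact_closedBall _ _) (μ := volume))
    rwa [integrableOn_iff_integrable_of_support_subset] at this
    intro x hx
    by_contra hx'
    exact hx (h0 x (by simpa using (not_le.mp (by simpa using hx' : ¬ ‖x‖ ≤ 1)).le))
  set D : E3 → ℝ := fun x => -(2 * n * x i * psi x ^ (n - 1)) * S x + psi x ^ n * S' x with hDdef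
  have hD0 : ∀ x, 1 ≤ ‖x‖ → D x = 0 := fun x h => by
    simp [hDdef, psi_eq_zero h, zero_pow (by omega : n ≠ 0), zero_pow (by omega : n - 1 ≠ 0)]
  have hline : ∀ x, HasLineDerivAt ℝ (fun y => psi y ^ n * S y) (D x) x (ee i) := by
    intro x
    by_cases hxB : x ∈ cB
    · have h1 := hasLineDerivAt_psi_pow hn x i
      have h2 := hd x hxB
      unfold HasLineDerivAt at h1 h2 ⊢
      exact (h1.mul h2).congr_deriv (by simp [hDdef])
    · have hx1 : 1 < ‖x‖ := by simpa using hxB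
      rw [hD0 x hx1.le]
      have hc : Continuous fun s : ℝ => ‖x + s • ee i‖ := by fun_prop
      have : ∀ᶠ s in 𝓝 (0:ℝ), 1 < ‖x + s • ee i‖ :=
        hc.continuousAt.eventually_const_lt (by simpa using hx1)
      refine (hasDerivAt_const (0:ℝ) (0:ℝ)).congr_of_eventuallyEq ?_
      filter_upwards [this] with s hs
      simp [psi_eq_zero hs.le, zero_pow (by omega : n ≠ 0)]
  have hDc : ContinuousOn D cB := by fun_prop
  have h0 := integral_lineDeriv_eq_zero
    (key (by fun_prop) fun x h => by simp [psi_eq_zero h, zero_pow (by omega : n ≠ 0)])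
    (key hDc hD0) hline
  have h1 : ∫ x, D x ∂μB = 0 := by
    rw [setIntegral_eq_integral_of_forall_compl_eq_zero, h0]
    intro x hx
    exact hD0 x (by simpa using hx)
  have h2 : ∫ x, D x ∂μB = -(2 * n * ∫ x, psi x ^ (n - 1) * (x i * S x) ∂μB)
      + ∫ x, psi x ^ n * S' x ∂μB := by
    rw [← integral_const_mul, ← integral_neg, ← integral_add]
    · refine integral_muB_congr fun x _ => ?_
      simp only [hDdef]; ring
    · exact integrable_muB (by fun_prop)
    · exact integrable_muB (by fun_prop)
  linarith

lemma hasLineDerivAt_coord (x : E3) (i : Fin 3) :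
    HasLineDerivAt ℝ (fun y : E3 => y i) 1 x (ee i) := by
  unfold HasLineDerivAt ee
  have : HasDerivAt (fun s : ℝ => x i + s) 1 0 := (hasDerivAt_id (0:ℝ)).const_add _
  simpa using this

lemma hasLineDerivAt_coord_ne (x : E3) {i j : Fin 3} (hij : j ≠ i) :
    HasLineDerivAt ℝ (fun y : E3 => y j) 0 x (ee i) := by
  unfold HasLineDerivAt ee
  simpa [hij] using hasDerivAt_const (0:ℝ) (x j)

lemma sum_sq_eq (x : E3) : ‖x‖ ^ 2 = x 0 ^ 2 + x 1 ^ 2 + x 2 ^ 2 := by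
  simp [EuclideanSpace.norm_sq_eq, Fin.sum_univ_three]

lemma integral_psi_laplacian {n : ℕ} (hn : 3 ≤ n) {f : E3 → ℝ} {df ddf : Fin 3 → E3 → ℝ}
    (hf : ContinuousOn f cB) (hdf : ∀ i, ContinuousOn (df i) cB)
    (hddf : ∀ i, ContinuousOn (ddf i) cB)
    (h1 : ∀ i, ∀ x ∈ cB, HasLineDerivAt ℝ f (df i x) x (ee i))
    (h2 : ∀ i, ∀ x ∈ cB, HasLineDerivAt ℝ (df i) (ddf i x) x (ee i)) :
    ∫ x, psi x ^ n * ∑ i, ddf i x ∂μB =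
      ∫ x, f x * (4 * n * (n - 1) * ‖x‖ ^ 2 * psi x ^ (n - 2) - 6 * n * psi x ^ (n - 1)) ∂μB := by
  have hpc := psi_continuous
  have hx : ∀ i, Continuous fun x : E3 => x i := fun i => by fun_prop
  have a1 : ∀ i, ∫ x, psi x ^ n * ddf i x ∂μB =
      2 * n * ∫ x, psi x ^ (n - 1) * (x i * df i x) ∂μB := fun i =>
    integral_psi_pow_mul_lineDeriv (by omega) (hdf i) (hddf i) (h2 i)
  have a2 : ∀ i, ∫ x, psi x ^ (n - 1) * (f x + x i * df i x) ∂μB =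
      2 * (n - 1 : ℕ) * ∫ x, psi x ^ (n - 1 - 1) * (x i * (x i * f x)) ∂μB := fun i => by
    have := hdf i
    refine integral_psi_pow_mul_lineDeriv (n := n - 1) (by omega) (S := fun x => x i * f x)
      (by fun_prop) (by fun_prop) fun x hxB => ?_
    have b1 := hasLineDerivAt_coord x i
    have b2 := h1 i x hxB
    unfold HasLineDerivAt at *
    exact (b1.mul b2).congr_deriv (by simp)
  have a3 : ∀ i, ∫ x, psi x ^ (n - 1) * (f x + x i * df i x) ∂μB =
      ∫ x, psi x ^ (n - 1) * f x ∂μB + ∫ x, psi x ^ (n - 1) * (x i * df i x) ∂μB := fun i => by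
    have := hdf i
    rw [← integral_add (integrable_muB (by fun_prop)) (integrable_muB (by fun_prop))]
    exact integral_congr_ae (Eventually.of_forall fun x => by ring)
  have a4 : ∫ x, psi x ^ n * ∑ i, ddf i x ∂μB = ∑ i, ∫ x, psi x ^ n * ddf i x ∂μB := by
    rw [← integral_finsetSum]
    · simp [Finset.mul_sum]
    · intro i _
      have := hddf i
      exact integrable_muB (by fun_prop)
  have a5 : ∫ x, f x * (4 * n * (n - 1) * ‖x‖ ^ 2 * psi x ^ (n - 2)
        - 6 * n * psi x ^ (n - 1)) ∂μB =
      (∑ i : Fin 3, 2 * n * (2 * (n - 1 : ℕ) *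
        ∫ x, psi x ^ (n - 1 - 1) * (x i * (x i * f x)) ∂μB))
      - 6 * n * ∫ x, psi x ^ (n - 1) * f x ∂μB := by
    simp only [← integral_const_mul]
    rw [← integral_finsetSum, ← integral_sub]
    · refine integral_muB_congr fun x _ => ?_
      rw [sum_sq_eq, Fin.sum_univ_three, Nat.cast_sub (by omega : 1 ≤ n)]
      rw [show n - 1 - 1 = n - 2 by omega]
      push_cast
      ring
    · exact integrable_finsetSum _ fun i _ => integrable_muB (by fun_prop)
    · exact integrable_muB (by fun_prop)
    · exact fun i _ => integrable_muB (by fun_prop)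
  rw [a4, a5]
  simp only [a1, ← a2, a3, Fin.sum_univ_three]
  ring

lemma integral_psi_transport {n : ℕ} (hn : 2 ≤ n) {f : E3 → ℝ} {df u du : Fin 3 → E3 → ℝ}
    (hf : ContinuousOn f cB) (hdf : ∀ i, ContinuousOn (df i) cB)
    (hu : ∀ i, ContinuousOn (u i) cB) (hdu : ∀ i, ContinuousOn (du i) cB)
    (h1 : ∀ i, ∀ x ∈ cB, HasLineDerivAt ℝ f (df i x) x (ee i))
    (h2 : ∀ i, ∀ x ∈ cB, HasLineDerivAt ℝ (u i) (du i x) x (ee i))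
    (hdiv : ∀ x ∈ cB, ∑ i, du i x = 0) :
    ∫ x, psi x ^ n * ∑ i, u i x * df i x ∂μB =
      2 * n * ∫ x, f x * (psi x ^ (n - 1) * ∑ i, u i x * x i) ∂μB := by
  have hpc := psi_continuous
  have hx : ∀ i, Continuous fun x : E3 => x i := fun i => by fun_prop
  have a1 : ∀ i, ∫ x, psi x ^ n * (df i x * u i x + f x * du i x) ∂μB =
      2 * n * ∫ x, psi x ^ (n - 1) * (x i * (f x * u i x)) ∂μB := fun i => by
    have := hdf i; have := hu i; have := hdu i
    refine integral_psi_pow_mul_lineDeriv hn (S := fun x => f x * u i x)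
      (by fun_prop) (by fun_prop) fun x hxB => ?_
    have b1 := h1 i x hxB
    have b2 := h2 i x hxB
    unfold HasLineDerivAt at *
    exact (b1.mul b2).congr_deriv (by simp)
  have a2 : ∫ x, psi x ^ n * ∑ i, u i x * df i x ∂μB =
      ∑ i, ∫ x, psi x ^ n * (df i x * u i x + f x * du i x) ∂μB := by
    rw [← integral_finsetSum]
    · refine integral_muB_congr fun x hxB => ?_
      have := hdiv x hxB
      simp only [Fin.sum_univ_three] at this ⊢
      linear_combination -psi x ^ n * f x * this
    · intro i _
      have := hdf i; have := hu i; have := hdu i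
      exact integrable_muB (by fun_prop)
  rw [a2]
  simp only [a1]
  rw [← Finset.mul_sum, ← integral_finsetSum]
  · congr 1
    refine integral_muB_congr fun x hxB => ?_
    simp only [Fin.sum_univ_three]; ring
  · intro i _
    have := hdf i; have := hu i
    exact integrable_muB (by fun_prop)

/-- functions vanishing near the axis. -/
def VanAxis (a : E3 → ℝ) : Prop :=
  ∀ x ∈ cB, x 0 = 0 → x 1 = 0 → ∀ᶠ y in 𝓝 x, a y = 0

lemma VanAxis.div {a : E3 → ℝ} (h : VanAxis a) (b : E3 → ℝ) : VanAxis fun y => a y / b y :=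
  fun x hx h0 h1 => (h x hx h0 h1).mono fun y hy => by simp [hy]

lemma VanAxis.continuousOn_div {a : E3 → ℝ} (h : VanAxis a) (ha : ContinuousOn a cB) :
    ContinuousOn (fun y => a y / (y 0 ^ 2 + y 1 ^ 2)) cB := by
  intro x hx
  by_cases h0 : x 0 ^ 2 + x 1 ^ 2 = 0
  · have hx0 : x 0 = 0 := by nlinarith [sq_nonneg (x 0), sq_nonneg (x 1)]
    have hx1 : x 1 = 0 := by nlinarith [sq_nonneg (x 0), sq_nonneg (x 1)]
    refine ContinuousAt.continuousWithinAt ?_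
    have : (fun y => a y / (y 0 ^ 2 + y 1 ^ 2)) =ᶠ[𝓝 x] fun _ => 0 := (h.div _) x hx hx0 hx1
    exact continuousAt_const.congr this.symm
  · exact (ha x hx).div (by fun_prop) h0

lemma integral_psi_axis {n : ℕ} (hn : 2 ≤ n) {f G : E3 → ℝ} {df : Fin 3 → E3 → ℝ}
    (hf : ContinuousOn f cB) (hdf : ∀ i, ContinuousOn (df i) cB)
    (h1 : ∀ i, ∀ x ∈ cB, HasLineDerivAt ℝ f (df i x) x (ee i))
    (hvf : VanAxis f) (hvdf : ∀ i, VanAxis (df i)) (hvG : VanAxis G)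
    (h0G : ∀ x ∈ cB, df 0 x = x 0 * G x) (h1G : ∀ x ∈ cB, df 1 x = x 1 * G x) :
    ContinuousOn G cB ∧
    ∫ x, psi x ^ n * G x ∂μB = 2 * n * ∫ x, f x * psi x ^ (n - 1) ∂μB := by
  have hpc := psi_continuous
  have hx : ∀ i, Continuous fun x : E3 => x i := fun i => by fun_prop
  have c1 := hvf.continuousOn_div hf
  have c2 := fun i => (hvdf i).continuousOn_div (hdf i)
  have c3 := (hvf.div fun y => y 0 ^ 2 + y 1 ^ 2).continuousOn_div c1
  set κ : E3 → ℝ := fun y => f y / (y 0 ^ 2 + y 1 ^ 2)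
  set κ' : E3 → ℝ := fun y => κ y / (y 0 ^ 2 + y 1 ^ 2)
  set δ : Fin 3 → E3 → ℝ := fun i y => df i y / (y 0 ^ 2 + y 1 ^ 2)
  have hSd : ∀ i : Fin 3, i ≠ 2 → ∀ x ∈ cB, HasLineDerivAt ℝ (fun y => y i * κ y)
      (κ x + x i * (δ i x - 2 * x i * κ' x)) x (ee i) := by
    intro i hi x hxB
    by_cases h0 : x 0 ^ 2 + x 1 ^ 2 = 0
    · have hx0 : x 0 = 0 := by nlinarith [sq_nonneg (x 0), sq_nonneg (x 1)]
      have hx1 : x 1 = 0 := by nlinarith [sq_nonneg (x 0), sq_nonneg (x 1)]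
      have hl : Tendsto (fun s : ℝ => x + s • ee i) (𝓝 0) (𝓝 x) := by
        have : Continuous fun s : ℝ => x + s • ee i := by fun_prop
        simpa using this.tendsto 0
      have e1 := hl.eventually (hvf x hxB hx0 hx1)
      have e2 : κ x + x i * (δ i x - 2 * x i * κ' x) = 0 := by simp [κ, κ', δ, h0]
      rw [e2]
      refine (hasDerivAt_const (0:ℝ) (0:ℝ)).congr_of_eventuallyEq ?_
      filter_upwards [e1] with s hs
      simp only [κ, hs]; simp
    · have b1 := hasLineDerivAt_coord x i
      have b2 := h1 i x hxB
      have b3 : HasLineDerivAt ℝ (fun y : E3 => y 0 ^ 2 + y 1 ^ 2) (2 * x i) x (ee i) := by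
        have hi' : i = 0 ∨ i = 1 := by omega
        rcases hi' with rfl | rfl
        · have d1 := hasLineDerivAt_coord x 0
          have d2 := hasLineDerivAt_coord_ne x (i := 0) (j := 1) (by decide)
          unfold HasLineDerivAt at *
          exact ((d1.pow 2).add (d2.pow 2)).congr_deriv (by simp)
        · have d1 := hasLineDerivAt_coord x 1
          have d2 := hasLineDerivAt_coord_ne x (i := 1) (j := 0) (by decide)
          unfold HasLineDerivAt at *
          exact ((d2.pow 2).add (d1.pow 2)).congr_deriv (by simp)
      unfold HasLineDerivAt at *
      refine (b1.mul (b2.div b3 (by simpa using h0))).congr_deriv ?_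
      simp only [κ, κ', δ, zero_smul, add_zero]
      simp
      field_simp
      exact Or.inl trivial
  have a1 : ∀ i : Fin 3, i ≠ 2 →
      ∫ x, psi x ^ n * (κ x + x i * (δ i x - 2 * x i * κ' x)) ∂μB =
      2 * n * ∫ x, psi x ^ (n - 1) * (x i * (x i * κ x)) ∂μB := fun i hi => by
    have := c2 i
    exact integral_psi_pow_mul_lineDeriv hn (by fun_prop) (by fun_prop) (hSd i hi)
  have hG : ∀ x ∈ cB, G x = (κ x + x 0 * (δ 0 x - 2 * x 0 * κ' x))
      + (κ x + x 1 * (δ 1 x - 2 * x 1 * κ' x)) := by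
    intro x hxB
    by_cases h0 : x 0 ^ 2 + x 1 ^ 2 = 0
    · have hx0 : x 0 = 0 := by nlinarith [sq_nonneg (x 0), sq_nonneg (x 1)]
      have hx1 : x 1 = 0 := by nlinarith [sq_nonneg (x 0), sq_nonneg (x 1)]
      rw [(hvG x hxB hx0 hx1).self_of_nhds]
      simp [κ, hx0, hx1]
    · simp only [κ, κ', δ, h0G x hxB, h1G x hxB]
      field_simp
      ring
  have cA : ∀ i : Fin 3, ContinuousOn (fun x : E3 => κ x + x i * (δ i x - 2 * x i * κ' x)) cB :=
    fun i => by
      have := c2 i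
      fun_prop
  refine ⟨((cA 0).add (cA 1)).congr hG, ?_⟩
  have e1 : ∫ x, psi x ^ n * G x ∂μB =
      ∫ x, psi x ^ n * (κ x + x 0 * (δ 0 x - 2 * x 0 * κ' x)) ∂μB +
      ∫ x, psi x ^ n * (κ x + x 1 * (δ 1 x - 2 * x 1 * κ' x)) ∂μB := by
    have i0 := cA 0
    have i1 := cA 1
    rw [← integral_add (integrable_muB (by fun_prop)) (integrable_muB (by fun_prop))]
    refine integral_muB_congr fun x hxB => ?_
    rw [hG x hxB]; ring
  rw [e1, a1 0 (by decide), a1 1 (by decide), ← mul_add,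
    ← integral_add (integrable_muB (by fun_prop)) (integrable_muB (by fun_prop))]
  congr 1
  refine integral_muB_congr fun x hxB => ?_
  by_cases h0 : x 0 ^ 2 + x 1 ^ 2 = 0
  · have hx0 : x 0 = 0 := by nlinarith [sq_nonneg (x 0), sq_nonneg (x 1)]
    have hx1 : x 1 = 0 := by nlinarith [sq_nonneg (x 0), sq_nonneg (x 1)]
    rw [(hvf x hxB hx0 hx1).self_of_nhds]
    simp [hx0, hx1]
  · simp only [κ]
    field_simp

lemma integral_sub3 {μ : Measure E3} {a b c d : E3 → ℝ} (ha : Integrable a μ) (hb : Integrable b μ)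
    (hc : Integrable c μ) (hd : Integrable d μ) :
    ∫ x, a x ∂μ - ∫ x, b x ∂μ - ∫ x, c x ∂μ - ∫ x, d x ∂μ =
      ∫ x, (a x - b x - c x - d x) ∂μ := by
  have e1 := integral_sub (f := fun x => a x - b x - c x) ((ha.sub hb).sub hc) hd
  have e2 := integral_sub (f := fun x => a x - b x) (ha.sub hb) hc
  have e3 := integral_sub ha hb
  linarith

/-- spatial integration by parts for the composition `F ∘ h` at a fixed time; here `f = F ∘ h`,
`f₁ = F' ∘ h`, `f₂ = F'' ∘ h`. -/
lemma integral_energy {n : ℕ} (hn : 3 ≤ n) {f f₁ f₂ ht g : E3 → ℝ} {dh ddh u du : Fin 3 → E3 → ℝ}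
    (cf : ContinuousOn f cB) (cf₁ : ContinuousOn f₁ cB) (cf₂ : ContinuousOn f₂ cB)
    (cdh : ∀ i, ContinuousOn (dh i) cB) (cddh : ∀ i, ContinuousOn (ddh i) cB)
    (cu : ∀ i, ContinuousOn (u i) cB) (cdu : ∀ i, ContinuousOn (du i) cB)
    (h1 : ∀ i, ∀ x ∈ cB, HasLineDerivAt ℝ f (f₁ x * dh i x) x (ee i))
    (h2 : ∀ i, ∀ x ∈ cB, HasLineDerivAt ℝ (fun y => f₁ y * dh i y)
      (f₂ x * dh i x ^ 2 + f₁ x * ddh i x) x (ee i))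
    (h3 : ∀ i, ∀ x ∈ cB, HasLineDerivAt ℝ (u i) (du i x) x (ee i))
    (hdiv : ∀ x ∈ cB, ∑ i, du i x = 0)
    (hv : VanAxis f) (hv₁ : VanAxis f₁)
    (ax0 : ∀ x ∈ cB, dh 0 x = x 0 * g x) (ax1 : ∀ x ∈ cB, dh 1 x = x 1 * g x)
    (eqn : ∀ x ∈ cB, ht x + ∑ i, u i x * dh i x - ∑ i, ddh i x + 2 * g x = 0) :
    ∫ x, f₁ x * ht x * psi x ^ n ∂μB =
      ∫ x, (f x * (4 * n * (n - 1) * ‖x‖ ^ 2 * psi x ^ (n - 2) - 10 * n * psi x ^ (n - 1)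
          - 2 * n * psi x ^ (n - 1) * ∑ i, u i x * x i)
        - f₂ x * (∑ i, dh i x ^ 2) * psi x ^ n) ∂μB := by
  have hpc := psi_continuous
  have hxc : ∀ i, Continuous fun x : E3 => x i := fun i => by fun_prop
  have I1 := integral_psi_laplacian hn cf (fun i => cf₁.mul (cdh i))
    (ddf := fun i x => f₂ x * dh i x ^ 2 + f₁ x * ddh i x)
    (fun i => by have := cdh i; have := cddh i; fun_prop) h1 h2
  have I2 := integral_psi_transport (n := n) (by omega) cf (fun i => cf₁.mul (cdh i)) cu cdu
    h1 h3 hdiv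
  obtain ⟨cG, I3⟩ := integral_psi_axis (n := n) (by omega) cf (fun i => cf₁.mul (cdh i))
    (G := fun x => f₁ x * g x) h1 hv
    (fun i x hx h0 h1 => (hv₁ x hx h0 h1).mono fun y hy => by
      simp only [Pi.mul_apply]; rw [hy, zero_mul])
    (fun x hx h0 h1 => (hv₁ x hx h0 h1).mono fun y hy => by
      simp only; rw [hy, zero_mul])
    (fun x hx => by simp only [Pi.mul_apply, ax0 x hx]; ring)
    (fun x hx => by simp only [Pi.mul_apply, ax1 x hx]; ring)
  simp only [Pi.mul_apply, Fin.sum_univ_three] at I1 I2 I3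
  have q0 := cdh 0
  have q1 := cdh 1
  have q2 := cdh 2
  have r0 := cddh 0
  have r1 := cddh 1
  have r2 := cddh 2
  have s0 := cu 0
  have s1 := cu 1
  have s2 := cu 2
  have i1 : Integrable (fun x => psi x ^ n * (f₂ x * dh 0 x ^ 2 + f₁ x * ddh 0 x
      + (f₂ x * dh 1 x ^ 2 + f₁ x * ddh 1 x) + (f₂ x * dh 2 x ^ 2 + f₁ x * ddh 2 x))) μB :=
    integrable_muB (by fun_prop)
  have i2 : Integrable (fun x => f₂ x * (dh 0 x ^ 2 + dh 1 x ^ 2 + dh 2 x ^ 2) * psi x ^ n) μB :=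
    integrable_muB (by fun_prop)
  have i3 : Integrable (fun x => psi x ^ n * (u 0 x * (f₁ x * dh 0 x) + u 1 x * (f₁ x * dh 1 x)
      + u 2 x * (f₁ x * dh 2 x))) μB :=
    integrable_muB (by fun_prop)
  have i4 : Integrable (fun x => 2 * (psi x ^ n * (f₁ x * g x))) μB :=
    integrable_muB (by fun_prop)
  have i5 : Integrable (fun x => f x * (4 * n * (n - 1) * ‖x‖ ^ 2 * psi x ^ (n - 2)
      - 6 * n * psi x ^ (n - 1))) μB := integrable_muB (by fun_prop)
  have i6 : Integrable (fun x => 2 * n * (f x * (psi x ^ (n - 1) *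
      (u 0 x * x 0 + u 1 x * x 1 + u 2 x * x 2)))) μB := integrable_muB (by fun_prop)
  have i7 : Integrable (fun x => 2 * (2 * n * (f x * psi x ^ (n - 1)))) μB :=
    integrable_muB (by fun_prop)
  simp only [Fin.sum_univ_three] at eqn ⊢
  calc _ = ∫ x, (psi x ^ n * (f₂ x * dh 0 x ^ 2 + f₁ x * ddh 0 x
      + (f₂ x * dh 1 x ^ 2 + f₁ x * ddh 1 x) + (f₂ x * dh 2 x ^ 2 + f₁ x * ddh 2 x))) ∂μB
      - ∫ x, f₂ x * (dh 0 x ^ 2 + dh 1 x ^ 2 + dh 2 x ^ 2) * psi x ^ n ∂μB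
      - ∫ x, psi x ^ n * (u 0 x * (f₁ x * dh 0 x) + u 1 x * (f₁ x * dh 1 x)
      + u 2 x * (f₁ x * dh 2 x)) ∂μB
      - ∫ x, 2 * (psi x ^ n * (f₁ x * g x)) ∂μB := by
        rw [integral_sub3 i1 i2 i3 i4]
        refine integral_muB_congr fun x hx => ?_
        linear_combination f₁ x * psi x ^ n * eqn x hx
    _ = _ := by
        rw [integral_const_mul, I1, I2, I3, ← integral_const_mul, ← integral_const_mul,
          ← integral_const_mul, integral_sub3 i5 i2 i6 i7]
        refine integral_muB_congr fun x hx => ?_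
        ring

/-- A positive solution `h` of `hₜ + u·∇h - Δh + (2/r)∂ᵣh = 0` on the unit cylinder together with
its derivatives and a divergence free drift; `g = r⁻¹ ∂ᵣ h`. -/
structure Sys (A : ℝ) (h ht g : E3 → ℝ → ℝ) (dh ddh u du : Fin 3 → E3 → ℝ → ℝ) : Prop where
  one_le : 1 ≤ A
  der_t : ∀ x ∈ cB, ∀ t ∈ Ioo (-1:ℝ) 0, HasDerivAt (h x) (ht x t) t
  der_h : ∀ i, ∀ x ∈ cB, ∀ t ∈ Ioo (-1:ℝ) 0,
    HasLineDerivAt ℝ (fun y => h y t) (dh i x t) x (ee i)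
  der_dh : ∀ i, ∀ x ∈ cB, ∀ t ∈ Ioo (-1:ℝ) 0,
    HasLineDerivAt ℝ (fun y => dh i y t) (ddh i x t) x (ee i)
  der_u : ∀ i, ∀ x ∈ cB, ∀ t ∈ Ioo (-1:ℝ) 0,
    HasLineDerivAt ℝ (fun y => u i y t) (du i x t) x (ee i)
  smooth : ∀ x ∈ cB, ∀ t ∈ Ioo (-1:ℝ) 0, ContDiffAt ℝ 1 (fun y => h y t) x
  cont_h : ContinuousOn (fun z : E3 × ℝ => h z.1 z.2) (cB ×ˢ Ioo (-1:ℝ) 0)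
  cont_ht : ContinuousOn (fun z : E3 × ℝ => ht z.1 z.2) (cB ×ˢ Ioo (-1:ℝ) 0)
  cont_dh : ∀ i, ∀ t ∈ Ioo (-1:ℝ) 0, ContinuousOn (fun x => dh i x t) cB
  cont_ddh : ∀ i, ∀ t ∈ Ioo (-1:ℝ) 0, ContinuousOn (fun x => ddh i x t) cB
  cont_u : ∀ i, ∀ t ∈ Ioo (-1:ℝ) 0, ContinuousOn (fun x => u i x t) cB
  cont_du : ∀ i, ∀ t ∈ Ioo (-1:ℝ) 0, ContinuousOn (fun x => du i x t) cB
  eqn : ∀ x ∈ cB, ∀ t ∈ Ioo (-1:ℝ) 0,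
    ht x t + ∑ i, u i x t * dh i x t - ∑ i, ddh i x t + 2 * g x t = 0
  axis0 : ∀ x ∈ cB, ∀ t ∈ Ioo (-1:ℝ) 0, dh 0 x t = x 0 * g x t
  axis1 : ∀ x ∈ cB, ∀ t ∈ Ioo (-1:ℝ) 0, dh 1 x t = x 1 * g x t
  div : ∀ x ∈ cB, ∀ t ∈ Ioo (-1:ℝ) 0, ∑ i, du i x t = 0
  pos : ∀ x ∈ cB, ∀ t ∈ Ioo (-1:ℝ) 0, 0 < h x t
  axis : ∀ x ∈ cB, ∀ t ∈ Ioo (-1:ℝ) 0, x 0 = 0 → x 1 = 0 → 1 / 2 < h x t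
  energy : ∀ t ∈ Ioo (-1:ℝ) 0, ∫ x, ∑ i, u i x t ^ 2 ∂μB ≤ A

/-- `C²` profiles on `(0,∞)` vanishing beyond `1/2`. -/
structure Prof (F F' F'' : ℝ → ℝ) : Prop where
  d1 : ∀ y, 0 < y → HasDerivAt F (F' y) y
  d2 : ∀ y, 0 < y → HasDerivAt F' (F'' y) y
  c2 : ContinuousOn F'' (Ioi 0)
  van : ∀ y, 1 / 2 < y → F y = 0

namespace Prof
variable {F F' F'' : ℝ → ℝ}

lemma van1 (P : Prof F F' F'') (y : ℝ) (hy : 1 / 2 < y) : F' y = 0 := by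
  have h1 := P.d1 y (by linarith)
  have h2 : HasDerivAt F 0 y := (hasDerivAt_const y (0:ℝ)).congr_of_eventuallyEq <| by
    filter_upwards [Ioi_mem_nhds hy] with z hz using P.van z hz
  exact h1.unique h2

lemma c0 (P : Prof F F' F'') : ContinuousOn F (Ioi 0) :=
  fun y hy => (P.d1 y hy).continuousAt.continuousWithinAt

lemma c1 (P : Prof F F' F'') : ContinuousOn F' (Ioi 0) :=
  fun y hy => (P.d2 y hy).continuousAt.continuousWithinAt

lemma contDiffAt (P : Prof F F' F'') {y : ℝ} (hy : 0 < y) : ContDiffAt ℝ 1 F y := by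
  have h : ContDiffOn ℝ (0 + 1) F (Ioi 0) := by
    rw [contDiffOn_succ_iff_deriv_of_isOpen isOpen_Ioi]
    refine ⟨fun z hz => (P.d1 z hz).differentiableAt.differentiableWithinAt, by simp, ?_⟩
    rw [contDiffOn_zero]
    exact P.c1.congr fun z hz => (P.d1 z hz).deriv
  exact (h.contDiffAt (Ioi_mem_nhds hy)).of_le (by simp)

end Prof

namespace Sys
variable {A : ℝ} {h ht g : E3 → ℝ → ℝ} {dh ddh u du : Fin 3 → E3 → ℝ → ℝ}
variable {F F' F'' : ℝ → ℝ}

lemma cont_ht' (S : Sys A h ht g dh ddh u du) {t : ℝ} (t0 : t ∈ Ioo (-1:ℝ) 0) :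
    ContinuousOn (fun x => h x t) cB :=
  S.cont_h.comp (f := fun x : E3 => (x, t)) (by fun_prop) fun _ hx => ⟨hx, t0⟩

lemma cont_comp (S : Sys A h ht g dh ddh u du) {G : ℝ → ℝ} (hG : ContinuousOn G (Ioi 0))
    {t : ℝ} (t0 : t ∈ Ioo (-1:ℝ) 0) : ContinuousOn (fun x => G (h x t)) cB :=
  hG.comp (S.cont_ht' t0) fun x hx => S.pos x hx t t0

lemma near_axis (S : Sys A h ht g dh ddh u du) {t : ℝ} (t0 : t ∈ Ioo (-1:ℝ) 0) {G : ℝ → ℝ}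
    (hG : ∀ y, 1 / 2 < y → G y = 0) : VanAxis fun x => G (h x t) := by
  intro x hx h0 h1
  have := (S.smooth x hx t t0).continuousAt.eventually_const_lt (S.axis x hx t t0 h0 h1)
  exact this.mono fun y hy => hG _ hy

lemma der_comp (S : Sys A h ht g dh ddh u du) (P : Prof F F' F'') {t : ℝ}
    (t0 : t ∈ Ioo (-1:ℝ) 0) (i : Fin 3) (x : E3) (hx : x ∈ cB) :
    HasLineDerivAt ℝ (fun y => F (h y t)) (F' (h x t) * dh i x t) x (ee i) := by
  have a := S.der_h i x hx t t0
  unfold HasLineDerivAt at *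
  have b : HasDerivAt F (F' (h x t)) (h (x + (0:ℝ) • ee i) t) := by
    simpa using P.d1 _ (S.pos x hx t t0)
  exact b.comp (0:ℝ) a

lemma deriv_energy (S : Sys A h ht g dh ddh u du) (P : Prof F F' F'') {n : ℕ} (hn : 3 ≤ n)
    {t : ℝ} (t0 : t ∈ Ioo (-1:ℝ) 0) :
    HasDerivAt (fun t => ∫ x, F (h x t) * psi x ^ n ∂μB)
      (∫ x, (F (h x t) * (4 * n * (n - 1) * ‖x‖ ^ 2 * psi x ^ (n - 2) - 10 * n * psi x ^ (n - 1)
          - 2 * n * psi x ^ (n - 1) * ∑ i, u i x t * x i)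
        - F'' (h x t) * (∑ i, dh i x t ^ 2) * psi x ^ n) ∂μB) t := by
  have hpc := psi_continuous
  -- differentiation under the integral
  have hd : HasDerivAt (fun t => ∫ x, F (h x t) * psi x ^ n ∂μB)
      (∫ x, F' (h x t) * ht x t * psi x ^ n ∂μB) t := by
    obtain ⟨a, b, hta, hab⟩ : ∃ a b, t ∈ Ioo a b ∧ Icc a b ⊆ Ioo (-1:ℝ) 0 :=
      ⟨(t - 1) / 2, t / 2, ⟨by linarith [t0.1], by linarith [t0.2]⟩,
        fun s hs => ⟨by linarith [t0.1, hs.1], by linarith [t0.2, hs.2]⟩⟩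
    have hcF : ContinuousOn (fun z : E3 × ℝ => F' (h z.1 z.2) * ht z.1 z.2 * psi z.1 ^ n)
        (cB ×ˢ Icc a b) := by
      have e1 : ContinuousOn (fun z : E3 × ℝ => F' (h z.1 z.2)) (cB ×ˢ Icc a b) :=
        P.c1.comp (S.cont_h.mono (prod_mono_right hab)) fun z hz => S.pos _ hz.1 _ (hab hz.2)
      have e2 := S.cont_ht.mono (prod_mono_right (s := cB) hab)
      exact (e1.mul e2).mul (by fun_prop)
    obtain ⟨C, hC⟩ := ((isCompact_closedBall (0:E3) 1).prod isCompact_Icc).exists_bound_of_continuousOn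
      hcF
    refine (hasDerivAt_integral_of_dominated_loc_of_deriv_le (bound := fun _ => C)
      (F' := fun s x => F' (h x s) * ht x s * psi x ^ n)
      (s := Ioo a b) (Ioo_mem_nhds hta.1 hta.2) ?_ ?_ ?_ ?_ ?_ ?_).2
    · filter_upwards [Ioo_mem_nhds hta.1 hta.2] with s hs
      have := S.cont_comp P.c0 (hab (Ioo_subset_Icc_self hs))
      exact (integrable_muB (this.mul (by fun_prop))).aestronglyMeasurable
    · have := S.cont_comp P.c0 t0
      exact integrable_muB (this.mul (by fun_prop))
    · refine (integrable_muB ?_).aestronglyMeasurable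
      exact hcF.comp (f := fun x : E3 => (x, t)) (by fun_prop)
        fun x hx => ⟨hx, Ioo_subset_Icc_self hta⟩
    · refine (ae_restrict_mem Metric.isOpen_ball.measurableSet).mono fun x hx s hs => ?_
      exact hC (x, s) ⟨Metric.ball_subset_closedBall hx, Ioo_subset_Icc_self hs⟩
    · exact integrable_muB (by fun_prop)
    · refine (ae_restrict_mem Metric.isOpen_ball.measurableSet).mono fun x hx s hs => ?_
      have hs' := hab (Ioo_subset_Icc_self hs)
      have hx' := Metric.ball_subset_closedBall hx
      have q := P.d1 _ (S.pos x hx' s hs')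
      exact (q.comp s (S.der_t x hx' s hs')).mul_const _
  refine hd.congr_deriv ?_
  refine integral_energy hn (S.cont_comp P.c0 t0) (S.cont_comp P.c1 t0) (S.cont_comp P.c2 t0)
    (fun i => S.cont_dh i t t0) (fun i => S.cont_ddh i t t0) (fun i => S.cont_u i t t0)
    (fun i => S.cont_du i t t0) (S.der_comp P t0) ?_ (fun i x hx => S.der_u i x hx t t0)
    (fun x hx => S.div x hx t t0) (S.near_axis t0 P.van) (S.near_axis t0 P.van1)
    (fun x hx => S.axis0 x hx t t0) (fun x hx => S.axis1 x hx t t0) (fun x hx => S.eqn x hx t t0)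
  intro i x hx
  have a := S.der_h i x hx t t0
  have c := S.der_dh i x hx t t0
  unfold HasLineDerivAt at *
  have b : HasDerivAt F' (F'' (h x t)) (h (x + (0:ℝ) • ee i) t) := by
    simpa using P.d2 _ (S.pos x hx t t0)
  exact ((b.comp (0:ℝ) a).mul c).congr_deriv (by simp; ring)

/-- the weight appearing in `deriv_energy` has zero mean up to the axis contribution. -/
lemma weight_mean (S : Sys A h ht g dh ddh u du) {n : ℕ} (hn : 3 ≤ n)
    {t : ℝ} (t0 : t ∈ Ioo (-1:ℝ) 0) :
    ∫ x, (4 * n * (n - 1) * ‖x‖ ^ 2 * psi x ^ (n - 2) - 6 * n * psi x ^ (n - 1)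
          - 2 * n * psi x ^ (n - 1) * ∑ i, u i x t * x i) ∂μB = 0 := by
  have hpc := psi_continuous
  have hxc : ∀ i, Continuous fun x : E3 => x i := fun i => by fun_prop
  have cu := fun i => S.cont_u i t t0
  have cdu := fun i => S.cont_du i t t0
  have I1 := integral_psi_laplacian hn (f := fun _ => 1) (df := fun _ _ => 0) (ddf := fun _ _ => 0)
    (by fun_prop) (fun i => by fun_prop) (fun i => by fun_prop)
    (fun i x _ => by simpa [HasLineDerivAt] using hasDerivAt_const (0:ℝ) (1:ℝ))
    (fun i x _ => by simpa [HasLineDerivAt] using hasDerivAt_const (0:ℝ) (0:ℝ))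
  have I2 := integral_psi_transport (n := n) (by omega) (f := fun _ => 1) (df := fun _ _ => 0)
    (by fun_prop) (fun i => by fun_prop) cu cdu
    (fun i x _ => by simpa [HasLineDerivAt] using hasDerivAt_const (0:ℝ) (1:ℝ))
    (fun i x hx => S.der_u i x hx t t0) fun x hx => S.div x hx t t0
  simp only [Finset.sum_const_zero, mul_zero, integral_zero, one_mul] at I1 I2
  have I3 := congrArg₂ (· - ·) I1 I2
  simp only [sub_zero] at I3
  rw [I3, ← integral_const_mul, ← integral_sub]
  · refine integral_muB_congr fun x hx => ?_
    ring
  all_goals exact integrable_muB (by fun_prop)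

end Sys

/-- squared length of the gradient. -/
def grad2 (f : E3 → ℝ) (x : E3) : ℝ := ∑ i, pd f i x ^ 2

lemma grad2_nonneg (f : E3 → ℝ) (x : E3) : 0 ≤ grad2 f x :=
  Finset.sum_nonneg fun _ _ => sq_nonneg _

lemma eq_sum_ee (v : E3) : v = ∑ i, v i • ee i := by
  ext j
  fin_cases j <;> simp [Fin.sum_univ_three, ee]

lemma fderiv_eq_sum (f : E3 → ℝ) (x v : E3) : fderiv ℝ f x v = ∑ i, v i * pd f i x := by
  conv_lhs => rw [eq_sum_ee v]
  simp [map_sum, pd]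

lemma fderiv_sq_le (f : E3 → ℝ) (x v : E3) : (fderiv ℝ f x v) ^ 2 ≤ ‖v‖ ^ 2 * grad2 f x := by
  rw [fderiv_eq_sum, EuclideanSpace.norm_sq_eq]
  simp only [Real.norm_eq_abs, sq_abs]
  exact Finset.sum_mul_sq_le_sq_mul_sq _ _ _

lemma continuousOn_pd {f : E3 → ℝ} {s : Set E3} (hf : ∀ x ∈ s, ContDiffAt ℝ 1 f x) (i : Fin 3) :
    ContinuousOn (fun x => pd f i x) s := fun x hx =>
  (((hf x hx).fderiv_right (m := 0) (by simp)).continuousAt.clm_apply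
    continuousAt_const).continuousWithinAt

lemma continuousOn_grad2 {f : E3 → ℝ} {s : Set E3} (hf : ∀ x ∈ s, ContDiffAt ℝ 1 f x) :
    ContinuousOn (grad2 f) s := by
  have := fun i => continuousOn_pd hf i
  unfold grad2
  fun_prop

lemma sq_integral_le {φ : ℝ → ℝ} (hφ : ContinuousOn φ (Icc 0 1)) :
    (∫ s in (0:ℝ)..1, φ s) ^ 2 ≤ ∫ s in (0:ℝ)..1, φ s ^ 2 := by
  have hu : ContinuousOn φ (uIcc 0 1) := by rwa [uIcc_of_le zero_le_one]
  set c := ∫ s in (0:ℝ)..1, φ s with hc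
  have h0 : 0 ≤ ∫ s in (0:ℝ)..1, (φ s - c) ^ 2 :=
    intervalIntegral.integral_nonneg zero_le_one fun _ _ => sq_nonneg _
  have h1 : ∫ s in (0:ℝ)..1, (φ s - c) ^ 2 = (∫ s in (0:ℝ)..1, φ s ^ 2) - c ^ 2 := by
    have e : ∀ s, (φ s - c) ^ 2 = φ s ^ 2 - (2 * c * φ s - c ^ 2) := fun s => by ring
    simp only [e]
    have e1 := intervalIntegral.integral_sub (μ := volume) (a := 0) (b := 1)
      (f := fun s => φ s ^ 2) (g := fun s => 2 * c * φ s - c ^ 2)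
      (hu.pow 2).intervalIntegrable (ContinuousOn.intervalIntegrable (by fun_prop))
    have e2 := intervalIntegral.integral_sub (μ := volume) (a := 0) (b := 1)
      (f := fun s => 2 * c * φ s) (g := fun _ => c ^ 2)
      (ContinuousOn.intervalIntegrable (by fun_prop)) (by simp)
    rw [e1, e2, intervalIntegral.integral_const_mul, ← hc]
    simp; ring
  linarith

lemma psi_mul_le {x y : E3} (hx : x ∈ cB) (hy : y ∈ cB) {s : ℝ} (hs : s ∈ Icc (0:ℝ) 1) :
    psi x ^ 4 * psi y ^ 4 ≤ psi (y + s • (x - y)) ^ 4 := by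
  rw [← mul_pow]
  refine pow_le_pow_left₀ (mul_nonneg (psi_nonneg _) (psi_nonneg _)) ?_ 4
  have hc : ‖y + s • (x - y)‖ ^ 2 ≤ s * ‖x‖ ^ 2 + (1 - s) * ‖y‖ ^ 2 := by
    have e : y + s • (x - y) = s • x + (1 - s) • y := by module
    have h1 := norm_add_le (s • x) ((1 - s) • y)
    rw [norm_smul, norm_smul, Real.norm_of_nonneg hs.1, Real.norm_of_nonneg (sub_nonneg.2 hs.2),
      ← e] at h1
    have h2 := pow_le_pow_left₀ (norm_nonneg _) h1 2
    nlinarith [mul_nonneg hs.1 (sub_nonneg.2 hs.2), sq_nonneg (‖x‖ - ‖y‖),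
      mul_nonneg (mul_nonneg hs.1 (sub_nonneg.2 hs.2)) (sq_nonneg (‖x‖ - ‖y‖))]
  have h3 : 1 - ‖y + s • (x - y)‖ ^ 2 ≤ psi (y + s • (x - y)) := le_max_left _ _
  have a1 : psi x * psi y ≤ psi x := mul_le_of_le_one_right (psi_nonneg _) (psi_le_one _)
  have a2 : psi x * psi y ≤ psi y := mul_le_of_le_one_left (psi_nonneg _) (psi_le_one _)
  have b1 := psi_eq hx
  have b2 := psi_eq hy
  have c1 := mul_le_mul_of_nonneg_left a1 hs.1
  have c2 := mul_le_mul_of_nonneg_left a2 (sub_nonneg.2 hs.2)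
  have d1 : s * psi x = s * (1 - ‖x‖ ^ 2) := by rw [b1]
  have d2 : (1 - s) * psi y = (1 - s) * (1 - ‖y‖ ^ 2) := by rw [b2]
  linarith

/-- the weighted energy density extended by zero outside the unit ball. -/
def dens (f : E3 → ℝ) : E3 → ℝ≥0∞ :=
  (Metric.ball (0:E3) 1).indicator fun x => ENNReal.ofReal (grad2 f x * psi x ^ 4)

lemma measurable_dens {f : E3 → ℝ} (hf : ∀ x ∈ cB, ContDiffAt ℝ 1 f x) : Measurable (dens f) := by
  classical
  have h1 := (continuousOn_grad2 hf).mono (Metric.ball_subset_closedBall)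
  have hpc := psi_continuous
  rw [dens, ← piecewise_eq_indicator]
  refine ContinuousOn.measurable_piecewise ?_ continuousOn_const Metric.isOpen_ball.measurableSet
  exact ENNReal.continuous_ofReal.comp_continuousOn (by fun_prop)

lemma sub_sq_le_lintegral {f : E3 → ℝ} (hf : ∀ x ∈ cB, ContDiffAt ℝ 1 f x) {x y : E3}
    (hx : x ∈ Metric.ball (0:E3) 1) (hy : y ∈ Metric.ball (0:E3) 1) :
    ENNReal.ofReal ((f x - f y) ^ 2 * (psi x ^ 4 * psi y ^ 4)) ≤
      4 * ∫⁻ s in Icc (0:ℝ) 1, dens f (y + s • (x - y)) := by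
  have hpc := psi_continuous
  have hseg : ∀ s ∈ Icc (0:ℝ) 1, y + s • (x - y) ∈ Metric.ball (0:E3) 1 := fun s hs =>
    (convex_ball (0:E3) 1).add_smul_sub_mem hy hx hs
  have hcB := fun s hs => Metric.ball_subset_closedBall (hseg s hs)
  set φ' : ℝ → ℝ := fun s => fderiv ℝ f (y + s • (x - y)) (x - y) with hφ'
  have hder : ∀ s ∈ Icc (0:ℝ) 1, HasDerivAt (fun s : ℝ => f (y + s • (x - y))) (φ' s) s := by
    intro s hs
    have h1 : HasDerivAt (fun s : ℝ => y + s • (x - y)) (x - y) s := by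
      simpa using ((hasDerivAt_id s).smul_const (x - y)).const_add y
    exact ((hf _ (hcB s hs)).differentiableAt (by simp)).hasFDerivAt.comp_hasDerivAt s h1
  have hl : Continuous fun s : ℝ => y + s • (x - y) := by fun_prop
  have hcont : ContinuousOn φ' (Icc 0 1) := by
    intro s hs
    have : ContinuousAt (fderiv ℝ f) (y + s • (x - y)) :=
      ((hf _ (hcB s hs)).fderiv_right (m := 0) (by simp)).continuousAt
    have h2 : ContinuousAt (fun s : ℝ => fderiv ℝ f (y + s • (x - y))) s :=
      ContinuousAt.comp (f := fun s : ℝ => y + s • (x - y)) this hl.continuousAt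
    exact (h2.clm_apply continuousAt_const).continuousWithinAt
  have hq : ContinuousOn (fun s : ℝ => grad2 f (y + s • (x - y)) * psi (y + s • (x - y)) ^ 4)
      (Icc 0 1) :=
    (((continuousOn_grad2 hf).mul (by fun_prop : ContinuousOn (fun x => psi x ^ 4) cB))).comp
      hl.continuousOn hcB
  have hFTC : f x - f y = ∫ s in (0:ℝ)..1, φ' s := by
    rw [intervalIntegral.integral_eq_sub_of_hasDerivAt (f := fun s : ℝ => f (y + s • (x - y)))
      (by rw [uIcc_of_le zero_le_one]; exact hder)
      (by rw [← uIcc_of_le zero_le_one] at hcont; exact hcont.intervalIntegrable)]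
    simp
  have hn : ‖x - y‖ ^ 2 ≤ 4 := by
    have h1 : ‖x‖ < 1 := by simpa using hx
    have h2 : ‖y‖ < 1 := by simpa using hy
    have := norm_sub_le x y
    nlinarith [norm_nonneg (x - y)]
  have hw : 0 ≤ psi x ^ 4 * psi y ^ 4 :=
    mul_nonneg (pow_nonneg (psi_nonneg _) 4) (pow_nonneg (psi_nonneg _) 4)
  have hreal : (f x - f y) ^ 2 * (psi x ^ 4 * psi y ^ 4) ≤
      ∫ s in (0:ℝ)..1, 4 * (grad2 f (y + s • (x - y)) * psi (y + s • (x - y)) ^ 4) := by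
    rw [hFTC]
    calc _ ≤ (∫ s in (0:ℝ)..1, φ' s ^ 2) * (psi x ^ 4 * psi y ^ 4) :=
          mul_le_mul_of_nonneg_right (sq_integral_le hcont) hw
      _ = ∫ s in (0:ℝ)..1, φ' s ^ 2 * (psi x ^ 4 * psi y ^ 4) := by
          rw [intervalIntegral.integral_mul_const]
      _ ≤ _ := by
          refine intervalIntegral.integral_mono_on zero_le_one ?_ ?_ fun s hs => ?_
          · refine ContinuousOn.intervalIntegrable ?_
            rw [uIcc_of_le zero_le_one]; fun_prop
          · refine ContinuousOn.intervalIntegrable ?_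
            rw [uIcc_of_le zero_le_one]; exact hq.const_mul 4 |>.congr fun s _ => rfl
          · have a1 := fderiv_sq_le f (y + s • (x - y)) (x - y)
            have a2 := psi_mul_le (Metric.ball_subset_closedBall hx)
              (Metric.ball_subset_closedBall hy) hs
            have a3 := grad2_nonneg f (y + s • (x - y))
            calc φ' s ^ 2 * (psi x ^ 4 * psi y ^ 4)
                ≤ (4 * grad2 f (y + s • (x - y))) * psi (y + s • (x - y)) ^ 4 :=
                  mul_le_mul (a1.trans (mul_le_mul_of_nonneg_right hn a3)) a2 hw (by positivity)
              _ = _ := by ring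
  calc _ ≤ ENNReal.ofReal (∫ s in (0:ℝ)..1,
          4 * (grad2 f (y + s • (x - y)) * psi (y + s • (x - y)) ^ 4)) :=
        ENNReal.ofReal_le_ofReal hreal
    _ = 4 * ∫⁻ s in Icc (0:ℝ) 1, dens f (y + s • (x - y)) := by
        rw [intervalIntegral.integral_const_mul, ENNReal.ofReal_mul (by norm_num),
          intervalIntegral.integral_of_le zero_le_one, ← integral_Icc_eq_integral_Ioc,
          ofReal_integral_eq_lintegral_ofReal]
        · congr 1
          · norm_num
          · refine setLIntegral_congr_fun measurableSet_Icc fun s hs => ?_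
            simp only [dens]
            rw [indicator_of_mem (hseg s hs)]
        · exact hq.integrableOn_Icc
        · exact Eventually.of_forall fun s =>
            mul_nonneg (grad2_nonneg _ _) (pow_nonneg (psi_nonneg _) 4)

lemma lintegral_affine_le {G : E3 → ℝ≥0∞} (hG : Measurable G) (z : E3) {s : ℝ} (hs : 1 / 2 ≤ s) :
    ∫⁻ x, G (s • x + z) ≤ 8 * ∫⁻ x, G x := by
  have hs0 : s ≠ 0 := by linarith
  have hm := Measure.map_addHaar_smul (volume : Measure E3) hs0
  have h1 : ∫⁻ x, G (s • x + z) = ∫⁻ x, G (x + z) ∂(Measure.map (s • ·) (volume : Measure E3)) := by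
    rw [lintegral_map (by fun_prop) (by fun_prop)]
  rw [h1, hm, lintegral_smul_measure, lintegral_add_right_eq_self, smul_eq_mul]
  gcongr
  rw [← ENNReal.ofReal_ofNat 8]
  refine ENNReal.ofReal_le_ofReal ?_
  have hsp : 0 < s := by linarith
  rw [finrank_euclideanSpace_fin, abs_of_pos (by positivity)]
  rw [inv_le_comm₀ (by positivity) (by norm_num)]
  calc (8:ℝ)⁻¹ = (1 / 2) ^ 3 := by norm_num
    _ ≤ s ^ 3 := pow_le_pow_left₀ (by norm_num) hs 3

lemma lintegral_segment_le {G : E3 → ℝ≥0∞} (hG : Measurable G) {s : ℝ} :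
    ∫⁻ x, ∫⁻ y, G (y + s • (x - y)) ∂μB ∂μB ≤
      8 * volume (Metric.ball (0:E3) 1) * ∫⁻ x, G x := by
  have hle : ∀ f : E3 → ℝ≥0∞, ∫⁻ x, f x ∂μB ≤ ∫⁻ x, f x := fun f =>
    lintegral_mono' Measure.restrict_le_self le_rfl
  have key : ∀ s : ℝ, 1 / 2 ≤ s → ∀ y : E3, ∫⁻ x, G (y + s • (x - y)) ∂μB ≤ 8 * ∫⁻ x, G x := by
    intro s hs y
    refine (hle _).trans ?_
    have e : ∀ x, y + s • (x - y) = s • x + (1 - s) • y := fun x => by module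
    simp only [e]
    exact lintegral_affine_le hG ((1 - s) • y) hs
  have fin : ∫⁻ _ : E3, (8 * ∫⁻ x, G x) ∂μB = 8 * volume (Metric.ball (0:E3) 1) * ∫⁻ x, G x := by
    simp only [lintegral_const, Measure.restrict_apply MeasurableSet.univ, univ_inter]
    ring
  rcases le_total (1 / 2) s with hs | hs
  · rw [lintegral_lintegral_swap (by fun_prop), ← fin]
    exact lintegral_mono fun y => key s hs y
  · rw [← fin]
    refine lintegral_mono fun x => ?_
    have := key (1 - s) (by linarith) x
    have e : ∀ y, y + s • (x - y) = x + (1 - s) • (y - x) := fun y => by module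
    simp only [e]
    exact this

/-- the total mass of the weight `psi ^ 4`. -/
def m4 : ℝ := ∫ x, psi x ^ 4 ∂μB

lemma m4_pos : 0 < m4 := by
  have hpc := psi_continuous
  rw [m4, integral_pos_iff_support_of_nonneg (fun x => pow_nonneg (psi_nonneg x) 4)
    (integrable_muB (by fun_prop))]
  have : Metric.ball (0:E3) 1 ⊆ Function.support fun x => psi x ^ 4 := fun x hx =>
    (pow_pos (psi_pos hx) 4).ne'
  refine lt_of_lt_of_le ?_ (measure_mono this)
  simp only [Measure.restrict_apply_self]
  exact Metric.measure_ball_pos _ _ one_pos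

lemma double_integral_le {f : E3 → ℝ} (hf : ∀ x ∈ cB, ContDiffAt ℝ 1 f x) :
    ∫⁻ x, ∫⁻ y, ENNReal.ofReal ((f x - f y) ^ 2 * (psi x ^ 4 * psi y ^ 4)) ∂μB ∂μB ≤
      32 * volume (Metric.ball (0:E3) 1) *
        ENNReal.ofReal (∫ x, grad2 f x * psi x ^ 4 ∂μB) := by
  have hG := measurable_dens hf
  have hpc := psi_continuous
  have hg := continuousOn_grad2 hf
  have hmB := (Metric.isOpen_ball (x := (0:E3)) (ε := 1)).measurableSet
  have e : ENNReal.ofReal (∫ x, grad2 f x * psi x ^ 4 ∂μB) = ∫⁻ x, dens f x := by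
    rw [ofReal_integral_eq_lintegral_ofReal (integrable_muB (by fun_prop))
      (Eventually.of_forall fun s => mul_nonneg (grad2_nonneg _ _) (pow_nonneg (psi_nonneg _) 4)),
      dens, lintegral_indicator hmB]
  rw [e]
  calc _ ≤ ∫⁻ x, ∫⁻ y, (4 * ∫⁻ s in Icc (0:ℝ) 1, dens f (y + s • (x - y))) ∂μB ∂μB := by
        refine setLIntegral_mono' hmB fun x hx => setLIntegral_mono' hmB fun y hy => ?_
        exact sub_sq_le_lintegral hf hx hy
    _ = 4 * ∫⁻ x, ∫⁻ y, (∫⁻ s in Icc (0:ℝ) 1, dens f (y + s • (x - y))) ∂μB ∂μB := by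
        simp only [lintegral_const_mul' 4 _ (by norm_num : (4:ℝ≥0∞) ≠ ⊤)]
    _ = 4 * ∫⁻ s in Icc (0:ℝ) 1, ∫⁻ x, ∫⁻ y, dens f (y + s • (x - y)) ∂μB ∂μB := by
        congr 1
        have e1 : ∫⁻ x, ∫⁻ y, (∫⁻ s in Icc (0:ℝ) 1, dens f (y + s • (x - y))) ∂μB ∂μB =
            ∫⁻ x, (∫⁻ s in Icc (0:ℝ) 1, ∫⁻ y, dens f (y + s • (x - y)) ∂μB) ∂μB :=
          lintegral_congr fun x =>
            lintegral_lintegral_swap (Measurable.aemeasurable (by fun_prop))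
        rw [e1, lintegral_lintegral_swap]
        refine Measurable.aemeasurable ?_
        exact Measurable.lintegral_prod_right' (f := fun p : (E3 × ℝ) × E3 =>
          dens f (p.2 + p.1.2 • (p.1.1 - p.2))) (by fun_prop)
    _ ≤ 4 * ∫⁻ s in Icc (0:ℝ) 1, 8 * volume (Metric.ball (0:E3) 1) * ∫⁻ x, dens f x := by
        gcongr with s
        exact lintegral_segment_le hG
    _ = _ := by
        simp only [lintegral_const, Measure.restrict_apply MeasurableSet.univ, univ_inter,
          Real.volume_Icc]
        norm_num
        ring

/-- weighted Poincaré inequality on the unit ball. -/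
lemma poincare : ∃ CP : ℝ, 0 < CP ∧ ∀ f : E3 → ℝ, (∀ x ∈ cB, ContDiffAt ℝ 1 f x) →
    ∀ m : ℝ, m * m4 = ∫ x, f x * psi x ^ 4 ∂μB →
    ∫ x, (f x - m) ^ 2 * psi x ^ 4 ∂μB ≤ CP * ∫ x, grad2 f x * psi x ^ 4 ∂μB := by
  have hpc := psi_continuous
  set b := (volume (Metric.ball (0:E3) 1)).toReal with hb
  have hbt : volume (Metric.ball (0:E3) 1) = ENNReal.ofReal b :=
    (ENNReal.ofReal_toReal measure_ball_lt_top.ne).symm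
  have hbp : 0 < b := ENNReal.toReal_pos (Metric.measure_ball_pos _ _ one_pos).ne'
    measure_ball_lt_top.ne
  have hm := m4_pos
  refine ⟨16 * b / m4, by positivity, fun f hf m hmf => ?_⟩
  have hfc : ContinuousOn f cB := fun x hx => (hf x hx).continuousAt.continuousWithinAt
  set I2 := ∫ x, f x ^ 2 * psi x ^ 4 ∂μB with hI2
  have hin' : ∀ x, ∫ y, (f x - f y) ^ 2 * (psi x ^ 4 * psi y ^ 4) ∂μB =
      f x ^ 2 * psi x ^ 4 * m4 - 2 * (f x * psi x ^ 4) * (m * m4) + psi x ^ 4 * I2 := by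
    intro x
    rw [hmf, m4, hI2, ← integral_const_mul, ← integral_const_mul, ← integral_const_mul,
      ← integral_sub, ← integral_add]
    · refine integral_muB_congr fun y _ => ?_
      ring
    all_goals exact integrable_muB (by fun_prop)
  have hin : ∀ x, ∫⁻ y, ENNReal.ofReal ((f x - f y) ^ 2 * (psi x ^ 4 * psi y ^ 4)) ∂μB =
      ENNReal.ofReal (f x ^ 2 * psi x ^ 4 * m4 - 2 * (f x * psi x ^ 4) * (m * m4)
        + psi x ^ 4 * I2) := by
    intro x
    rw [← ofReal_integral_eq_lintegral_ofReal (integrable_muB (by fun_prop))]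
    · rw [hin']
    · exact Eventually.of_forall fun y => mul_nonneg (sq_nonneg _)
        (mul_nonneg (pow_nonneg (psi_nonneg _) 4) (pow_nonneg (psi_nonneg _) 4))
  have hout : ∫ x, (f x ^ 2 * psi x ^ 4 * m4 - 2 * (f x * psi x ^ 4) * (m * m4)
        + psi x ^ 4 * I2) ∂μB = 2 * m4 * ∫ x, (f x - m) ^ 2 * psi x ^ 4 ∂μB := by
    have e1 : ∫ x, (f x ^ 2 * psi x ^ 4 * m4 - 2 * (f x * psi x ^ 4) * (m * m4)
        + psi x ^ 4 * I2) ∂μB = I2 * m4 - 2 * (m * m4) * (m * m4) + m4 * I2 := by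
      rw [integral_add (integrable_muB (by fun_prop)) (integrable_muB (by fun_prop)),
        integral_sub (integrable_muB (by fun_prop)) (integrable_muB (by fun_prop)),
        integral_mul_const, integral_mul_const, integral_mul_const, integral_const_mul, ← hmf]
      simp only [m4, hI2]
    have e2 : ∫ x, (f x - m) ^ 2 * psi x ^ 4 ∂μB = I2 - 2 * m * (m * m4) + m ^ 2 * m4 := by
      have : ∀ x, (f x - m) ^ 2 * psi x ^ 4 =
          f x ^ 2 * psi x ^ 4 - 2 * m * (f x * psi x ^ 4) + m ^ 2 * psi x ^ 4 := fun x => by ring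
      simp only [this]
      rw [integral_add (integrable_muB (by fun_prop)) (integrable_muB (by fun_prop)),
        integral_sub (integrable_muB (by fun_prop)) (integrable_muB (by fun_prop)),
        integral_const_mul, integral_const_mul, ← hmf]
      simp only [m4, hI2]
    rw [e1, e2]; ring
  have hpos : 0 ≤ ∫ x, grad2 f x * psi x ^ 4 ∂μB := integral_muB_nonneg fun x _ =>
    mul_nonneg (grad2_nonneg _ _) (pow_nonneg (psi_nonneg _) 4)
  have hmain := double_integral_le hf
  simp only [hin] at hmain
  rw [hbt, ← ENNReal.ofReal_ofNat 32, ← ENNReal.ofReal_mul (by norm_num),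
    ← ENNReal.ofReal_mul (by positivity)] at hmain
  have h2 : ENNReal.ofReal (2 * m4 * ∫ x, (f x - m) ^ 2 * psi x ^ 4 ∂μB) ≤
      ENNReal.ofReal (32 * b * ∫ x, grad2 f x * psi x ^ 4 ∂μB) := by
    refine le_trans ?_ hmain
    rw [← hout]
    refine (ofReal_integral_eq_lintegral_ofReal (integrable_muB (by fun_prop)) ?_).le
    refine Eventually.of_forall fun x => ?_
    have : f x ^ 2 * psi x ^ 4 * m4 - 2 * (f x * psi x ^ 4) * (m * m4) + psi x ^ 4 * I2 =
        ∫ y, (f x - f y) ^ 2 * (psi x ^ 4 * psi y ^ 4) ∂μB := (hin' x).symm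
    simp only [Pi.zero_apply, this]
    exact integral_muB_nonneg fun y _ => mul_nonneg (sq_nonneg _)
      (mul_nonneg (pow_nonneg (psi_nonneg _) 4) (pow_nonneg (psi_nonneg _) 4))
  rw [ENNReal.ofReal_le_ofReal_iff (by positivity)] at h2
  rw [div_mul_eq_mul_div, le_div_iff₀ hm]
  linarith

lemma contDiff_psi_pow {n : ℕ} (hn : 2 ≤ n) : ContDiff ℝ 1 fun x => psi x ^ n := by
  have h : ContDiff ℝ 1 fun y : ℝ => max y 0 ^ n := by
    rw [contDiff_one_iff_deriv]
    refine ⟨fun y => (hasDerivAt_max_zero_pow hn y).differentiableAt, ?_⟩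
    rw [funext fun y => (hasDerivAt_max_zero_pow hn y).deriv]
    fun_prop
  unfold psi
  exact h.comp (contDiff_const.sub (contDiff_norm_sq ℝ))

lemma rpow_div_pow {a : ℝ} (ha : 0 ≤ a) (j : ℕ) {n : ℕ} (hn : n ≠ 0) :
    (a ^ ((j:ℝ) / n)) ^ n = a ^ j := by
  rw [← Real.rpow_natCast, ← Real.rpow_mul ha, div_mul_cancel₀ _ (by exact_mod_cast hn),
    Real.rpow_natCast]

/-- Hölder's inequality in polynomial form. -/
lemma holder_poly {j k n : ℕ} (hn : j + k = n) (hj : j ≠ 0) (hk : k ≠ 0) {P a b : E3 → ℝ}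
    (hP : ContinuousOn P cB) (ha : ContinuousOn a cB) (hb : ContinuousOn b cB)
    (P0 : ∀ x ∈ cB, 0 ≤ P x) (a0 : ∀ x ∈ cB, 0 ≤ a x) (b0 : ∀ x ∈ cB, 0 ≤ b x)
    (h : ∀ x ∈ cB, P x ^ n ≤ a x ^ j * b x ^ k) :
    (∫ x, P x ∂μB) ^ n ≤ (∫ x, a x ∂μB) ^ j * (∫ x, b x ∂μB) ^ k := by
  have hmB := (Metric.isOpen_ball (x := (0:E3)) (ε := 1)).measurableSet
  have hn0 : (n:ℝ) ≠ 0 := by norm_cast; omega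
  have hn0' : n ≠ 0 := by omega
  have conv : ∀ {q : E3 → ℝ}, ContinuousOn q cB → (∀ x ∈ cB, 0 ≤ q x) →
      ENNReal.ofReal (∫ x, q x ∂μB) = ∫⁻ x, ENNReal.ofReal (q x) ∂μB := fun hq q0 =>
    ofReal_integral_eq_lintegral_ofReal (integrable_muB hq)
      ((ae_restrict_mem hmB).mono fun x hx => q0 x (Metric.ball_subset_closedBall hx))
  have hpt : ∀ x ∈ cB, ENNReal.ofReal (P x) ≤
      ENNReal.ofReal (a x) ^ ((j:ℝ) / n) * ENNReal.ofReal (b x) ^ ((k:ℝ) / n) := by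
    intro x hx
    have A0 := a0 x hx
    have B0 := b0 x hx
    rw [ENNReal.ofReal_rpow_of_nonneg A0 (by positivity),
      ENNReal.ofReal_rpow_of_nonneg B0 (by positivity), ← ENNReal.ofReal_mul (by positivity)]
    refine ENNReal.ofReal_le_ofReal ?_
    rw [← pow_le_pow_iff_left₀ (P0 x hx) (by positivity) hn0', mul_pow,
      rpow_div_pow A0 _ hn0', rpow_div_pow B0 _ hn0']
    exact h x hx
  have main : ENNReal.ofReal (∫ x, P x ∂μB) ≤
      ENNReal.ofReal (∫ x, a x ∂μB) ^ ((j:ℝ) / n) * ENNReal.ofReal (∫ x, b x ∂μB) ^ ((k:ℝ) / n) := by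
    rw [conv hP P0, conv ha a0, conv hb b0]
    refine (setLIntegral_mono' hmB fun x hx => hpt x (Metric.ball_subset_closedBall hx)).trans ?_
    refine ENNReal.lintegral_mul_norm_pow_le ?_ ?_ (by positivity) (by positivity) ?_
    · exact (integrable_muB ha).aestronglyMeasurable.aemeasurable.ennreal_ofReal
    · exact (integrable_muB hb).aestronglyMeasurable.aemeasurable.ennreal_ofReal
    · rw [← add_div, div_eq_one_iff_eq hn0]
      exact_mod_cast hn
  have A0 := integral_muB_nonneg a0
  have B0 := integral_muB_nonneg b0
  rw [ENNReal.ofReal_rpow_of_nonneg A0 (by positivity),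
      ENNReal.ofReal_rpow_of_nonneg B0 (by positivity), ← ENNReal.ofReal_mul (by positivity),
      ENNReal.ofReal_le_ofReal_iff (by positivity)] at main
  have := pow_le_pow_left₀ (integral_muB_nonneg P0) main n
  rwa [mul_pow, rpow_div_pow A0 _ hn0', rpow_div_pow B0 _ hn0'] at this

lemma norm_fderiv_sq_le (f : E3 → ℝ) (x : E3) : ‖fderiv ℝ f x‖ ^ 2 ≤ grad2 f x := by
  have h0 := grad2_nonneg f x
  have : ‖fderiv ℝ f x‖ ≤ √(grad2 f x) := by
    refine ContinuousLinearMap.opNorm_le_bound _ (Real.sqrt_nonneg _) fun v => ?_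
    rw [Real.norm_eq_abs]
    refine abs_le_of_sq_le_sq ?_ (by positivity)
    rw [mul_pow, Real.sq_sqrt h0, mul_comm]
    exact fderiv_sq_le f x v
  calc _ ≤ (√(grad2 f x)) ^ 2 := pow_le_pow_left₀ (norm_nonneg _) this 2
    _ = _ := Real.sq_sqrt h0

lemma hasCompactSupport_of_cB {β : Type*} [Zero β] {W : E3 → β} (hz : ∀ x, 1 ≤ ‖x‖ → W x = 0) :
    HasCompactSupport W :=
  HasCompactSupport.intro (isCompact_closedBall (0:E3) 1) fun x hx => hz x (by
    have : 1 < ‖x‖ := by simpa using hx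
    exact this.le)

/-- Sobolev's inequality for nonnegative functions supported in the unit ball. -/
lemma sobolev : ∃ S : ℝ, 0 < S ∧ ∀ W : E3 → ℝ, ContDiff ℝ 1 W → (∀ x, 0 ≤ W x) →
    (∀ x, 1 ≤ ‖x‖ → W x = 0) →
    ∫ x, W x ^ 6 ∂μB ≤ (S * ∫ x, grad2 W x ∂μB) ^ 3 := by
  set S0 : NNReal := SNormLESNormFDerivOfEqConst ℝ (volume : Measure E3) ((2 : NNReal) : ℝ) with hS0
  refine ⟨(S0:ℝ) ^ 2 + 1, by positivity, fun W hW hW0 hz => ?_⟩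
  have hcs : HasCompactSupport W := hasCompactSupport_of_cB hz
  have hfz : ∀ x, 1 ≤ ‖x‖ → fderiv ℝ W x = 0 := fun x hx =>
    IsLocalMin.fderiv_eq_zero (Eventually.of_forall fun y => by rw [hz x hx]; exact hW0 y)
  have hfc : Continuous (fderiv ℝ W) := hW.continuous_fderiv (by simp)
  have hfcs : HasCompactSupport (fderiv ℝ W) := hasCompactSupport_of_cB hfz
  have key := eLpNorm_le_eLpNorm_fderiv_of_eq (μ := (volume : Measure E3)) hW hcs (p := 2) (p' := 6)
    (by norm_num) (by simp) (by simp; norm_num)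
  have m1 : MemLp W ((6 : NNReal) : ℝ≥0∞) volume := hW.continuous.memLp_of_hasCompactSupport hcs
  have m2 : MemLp (fderiv ℝ W) ((2 : NNReal) : ℝ≥0∞) volume := hfc.memLp_of_hasCompactSupport hfcs
  rw [m1.eLpNorm_eq_integral_rpow_norm (by simp) (by simp),
    m2.eLpNorm_eq_integral_rpow_norm (by simp) (by simp)] at key
  have i1 : ∫ x, ‖W x‖ ^ (((6 : NNReal) : ℝ≥0∞).toReal) = ∫ x, W x ^ 6 ∂μB := by
    rw [setIntegral_eq_integral_of_forall_compl_eq_zero]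
    · refine integral_congr_ae (Eventually.of_forall fun x => ?_)
      have : (((6 : NNReal) : ℝ≥0∞).toReal) = ((6:ℕ):ℝ) := by simp
      simp only [this, Real.rpow_natCast, Real.norm_of_nonneg (hW0 x)]
    · intro x hx
      rw [hz x (by simpa using hx)]; norm_num
  have i2 : ∫ x, ‖fderiv ℝ W x‖ ^ (((2 : NNReal) : ℝ≥0∞).toReal) =
      ∫ x, ‖fderiv ℝ W x‖ ^ 2 ∂μB := by
    rw [setIntegral_eq_integral_of_forall_compl_eq_zero]
    · refine integral_congr_ae (Eventually.of_forall fun x => ?_)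
      have : (((2 : NNReal) : ℝ≥0∞).toReal) = ((2:ℕ):ℝ) := by simp
      simp only [this, Real.rpow_natCast]
    · intro x hx
      rw [hfz x (by simpa using hx)]; norm_num
  rw [i1, i2] at key
  set X := ∫ x, W x ^ 6 ∂μB
  set Y := ∫ x, ‖fderiv ℝ W x‖ ^ 2 ∂μB
  have X0 : 0 ≤ X := integral_muB_nonneg fun x _ => by positivity
  have Y0 : 0 ≤ Y := integral_muB_nonneg fun x _ => by positivity
  have hYD : Y ≤ ∫ x, grad2 W x ∂μB :=
    integral_muB_mono (by fun_prop) (continuousOn_grad2 fun x _ => hW.contDiffAt)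
      fun x _ => norm_fderiv_sq_le W x
  rw [← ENNReal.ofReal_coe_nnreal (p := S0), ← ENNReal.ofReal_mul (by positivity),
    ENNReal.ofReal_le_ofReal_iff (by positivity)] at key
  have k6 := pow_le_pow_left₀ (by positivity) key 6
  rw [mul_pow] at k6
  have r1 : (X ^ (((6 : NNReal) : ℝ≥0∞).toReal)⁻¹) ^ 6 = X := by
    rw [← Real.rpow_natCast, ← Real.rpow_mul X0]; norm_num
  have r2 : (Y ^ (((2 : NNReal) : ℝ≥0∞).toReal)⁻¹) ^ 6 = Y ^ 3 := by
    rw [← Real.rpow_natCast, ← Real.rpow_mul Y0, ← Real.rpow_natCast]; norm_num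
  rw [r1, r2] at k6
  calc X ≤ (S0:ℝ) ^ 6 * Y ^ 3 := k6
    _ = ((S0:ℝ) ^ 2 * Y) ^ 3 := by ring
    _ ≤ (((S0:ℝ) ^ 2 + 1) * ∫ x, grad2 W x ∂μB) ^ 3 := by
      gcongr
      linarith

lemma young_poly {x B N J e : ℝ} {n k m : ℕ} (hn : n ≠ 0) (hmn : k + m = n)
    (x0 : 0 ≤ x) (N0 : 0 ≤ N) (J0 : 0 ≤ J) (he : 0 < e) (hB : e ≤ B) (l : ℕ) (hl : n ≤ l * m)
    (h : x ^ n ≤ B ^ n * N ^ k * J ^ m) :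
    x ≤ e * N + e * (B / e) ^ l * J := by
  have q1 : 1 ≤ B / e := by rwa [one_le_div he]
  set M := max N ((B / e) ^ l * J) with hM
  have M0 : 0 ≤ M := le_max_of_le_left N0
  have hx : x ≤ e * M := by
    rw [← pow_le_pow_iff_left₀ x0 (by positivity) hn]
    calc x ^ n ≤ B ^ n * N ^ k * J ^ m := h
      _ = e ^ n * (N ^ k * ((B / e) ^ n * J ^ m)) := by rw [div_pow]; field_simp
      _ ≤ e ^ n * (N ^ k * ((B / e) ^ (l * m) * J ^ m)) := by gcongr
      _ = e ^ n * (N ^ k * ((B / e) ^ l * J) ^ m) := by rw [mul_pow, pow_mul]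
      _ ≤ e ^ n * (M ^ k * M ^ m) := by
          gcongr
          · exact le_max_left _ _
          · exact le_max_right _ _
      _ = (e * M) ^ n := by rw [mul_pow, ← pow_add, hmn]
  have hJ : 0 ≤ (B / e) ^ l * J := by positivity
  have : M ≤ N + (B / e) ^ l * J := max_le (by linarith) (by linarith)
  nlinarith

/-! ### Profiles -/

def prof1 (y : ℝ) : ℝ := max (1 - 2 * y) 0 ^ 3
def prof1' (y : ℝ) : ℝ := -6 * max (1 - 2 * y) 0 ^ 2
def prof1'' (y : ℝ) : ℝ := 24 * max (1 - 2 * y) 0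

lemma prof1_spec : Prof prof1 prof1' prof1'' where
  d1 y _ := by
    have a : HasDerivAt (fun y : ℝ => 1 - 2 * y) (-2) y := by
      simpa using ((hasDerivAt_id y).const_mul (2:ℝ)).const_sub 1
    have b := (hasDerivAt_max_zero_pow (n := 3) (by norm_num) (1 - 2 * y)).comp y a
    refine b.congr_deriv ?_
    simp only [prof1']; push_cast; ring
  d2 y _ := by
    have a : HasDerivAt (fun y : ℝ => 1 - 2 * y) (-2) y := by
      simpa using ((hasDerivAt_id y).const_mul (2:ℝ)).const_sub 1
    have b := ((hasDerivAt_max_zero_pow (n := 2) (by norm_num) (1 - 2 * y)).comp y a).const_mul (-6)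
    refine b.congr_deriv ?_
    simp only [prof1'']; push_cast; ring
  c2 := by unfold prof1''; fun_prop
  van y hy := by
    have : max (1 - 2 * y) 0 = 0 := max_eq_right (by linarith)
    simp [prof1, this]

lemma prof1_nonneg (y : ℝ) : 0 ≤ prof1 y := by unfold prof1; positivity

lemma prof1''_nonneg (y : ℝ) : 0 ≤ prof1'' y := by unfold prof1''; positivity

lemma prof1_lt_one {y : ℝ} (hy : 0 < y) : prof1 y < 1 :=
  pow_lt_one₀ (le_max_right _ _) (max_lt (by linarith) one_pos) (by norm_num)

lemma one_sub_prof1_le {y : ℝ} (hy : 0 < y) : 1 - prof1 y ≤ 6 * y := by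
  unfold prof1
  rcases le_total (1 - 2 * y) 0 with h | h
  · rw [max_eq_right h]; norm_num; linarith
  · rw [max_eq_left h]
    nlinarith [mul_nonneg (sq_nonneg y) (show 0 ≤ 12 - 8 * y by linarith)]

/-- the logarithmic profile. -/
def profL (y : ℝ) : ℝ := -Real.log (1 - prof1 y)
def profL' (y : ℝ) : ℝ := prof1' y / (1 - prof1 y)
def profL'' (y : ℝ) : ℝ := prof1'' y / (1 - prof1 y) + profL' y ^ 2

lemma profL_nonneg {y : ℝ} (hy : 0 < y) : 0 ≤ profL y := by
  have := Real.log_nonpos (by linarith [prof1_lt_one hy]) (by linarith [prof1_nonneg y] : 1 - prof1 y ≤ 1)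
  unfold profL; linarith

lemma exp_neg_profL {y : ℝ} (hy : 0 < y) : Real.exp (-profL y) = 1 - prof1 y := by
  rw [profL, neg_neg, Real.exp_log (by linarith [prof1_lt_one hy])]

lemma sq_le_profL'' {y : ℝ} (hy : 0 < y) : profL' y ^ 2 ≤ profL'' y := by
  have : 0 ≤ prof1'' y / (1 - prof1 y) :=
    div_nonneg (prof1''_nonneg y) (by linarith [prof1_lt_one hy])
  unfold profL''; linarith

lemma hasDerivAt_profL {y : ℝ} (hy : 0 < y) : HasDerivAt profL (profL' y) y := by
  have h := prof1_lt_one hy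
  refine (((prof1_spec.d1 y hy).const_sub 1).log (by linarith)).neg.congr_deriv ?_
  unfold profL'; rw [neg_div, neg_neg]

lemma hasDerivAt_profL' {y : ℝ} (hy : 0 < y) : HasDerivAt profL' (profL'' y) y := by
  have h : 1 - prof1 y ≠ 0 := by linarith [prof1_lt_one hy]
  refine ((prof1_spec.d2 y hy).div ((prof1_spec.d1 y hy).const_sub 1) h).congr_deriv ?_
  unfold profL'' profL'
  field_simp
  ring

lemma continuousOn_profL'' : ContinuousOn profL'' (Ioi 0) := by
  have h : ∀ y ∈ Ioi (0:ℝ), 1 - prof1 y ≠ 0 := fun y hy => by linarith [prof1_lt_one hy]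
  unfold profL'' profL'
  have c0 := prof1_spec.c0
  have c1 := prof1_spec.c1
  have c2 := prof1_spec.c2
  exact (c2.div (continuousOn_const.sub c0) h).add ((c1.div (continuousOn_const.sub c0) h).pow 2)

lemma profL_eq_zero {y : ℝ} (hy : 1 / 2 < y) : profL y = 0 := by
  rw [profL, prof1_spec.van y hy]; simp

lemma profL_spec : Prof profL profL' profL'' where
  d1 _ hy := hasDerivAt_profL hy
  d2 _ hy := hasDerivAt_profL' hy
  c2 := continuousOn_profL''
  van _ hy := profL_eq_zero hy

lemma profL_pow_spec (k : ℕ) : Prof (fun y => profL y ^ (k + 1))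
    (fun y => (k + 1) * profL y ^ k * profL' y)
    (fun y => (k + 1) * (k * profL y ^ (k - 1) * profL' y ^ 2 + profL y ^ k * profL'' y)) where
  d1 y hy := ((hasDerivAt_profL hy).pow (k + 1)).congr_deriv (by simp)
  d2 y hy := by
    refine ((((hasDerivAt_profL hy).pow k).const_mul ((k:ℝ) + 1)).mul
      (hasDerivAt_profL' hy)).congr_deriv ?_
    simp only [Pi.pow_apply]
    ring
  c2 := by
    have c0 := profL_spec.c0
    have c1 := profL_spec.c1
    have c2 := profL_spec.c2
    fun_prop
  van y hy := by simp [profL_eq_zero hy]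

/-- the zeroth moment of `psi ^ 3`. -/
def m3 : ℝ := ∫ x, psi x ^ 3 ∂μB

lemma m3_pos : 0 < m3 := by
  have : m4 ≤ m3 := integral_muB_mono (by have := psi_continuous; fun_prop)
    (by have := psi_continuous; fun_prop) fun x _ =>
      pow_le_pow_of_le_one (psi_nonneg x) (psi_le_one x) (by norm_num)
  exact m4_pos.trans_le this

/-- the volume of the unit ball. -/
def vB : ℝ := ∫ _, (1:ℝ) ∂μB

lemma vB_nonneg : 0 ≤ vB := integral_muB_nonneg fun _ _ => zero_le_one

lemma spatial_theta : ∃ c C : ℝ, 0 < c ∧ 0 < C ∧ ∀ (A : ℝ) (f j q e : E3 → ℝ), 1 ≤ A →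
    ContinuousOn f cB → ContinuousOn j cB → ContinuousOn q cB → ContinuousOn e cB →
    (∀ x ∈ cB, 0 ≤ f x ∧ f x ≤ 1) → (∀ x ∈ cB, 0 ≤ j x) → (∀ x ∈ cB, q x ^ 2 ≤ e x) →
    ∫ x, e x ∂μB ≤ A →
    ∫ x, (48 * ‖x‖ ^ 2 * psi x ^ 2 - 24 * psi x ^ 3 - 8 * psi x ^ 3 * q x) ∂μB = 0 →
    ∫ x, (f x * (48 * ‖x‖ ^ 2 * psi x ^ 2 - 40 * psi x ^ 3 - 8 * psi x ^ 3 * q x)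
      - j x * psi x ^ 4) ∂μB ≤ C * A * (m4 - ∫ x, f x * psi x ^ 4 ∂μB) - c := by
  have hm := m3_pos
  have hv := vB_nonneg
  have hpc := psi_continuous
  set δ := 8 * m3 / (vB + 1) with hδ
  have δ0 : 0 < δ := by positivity
  refine ⟨8 * m3, 416 / δ, by positivity, by positivity, fun A f j q e hA cf cj cq ce hf hj hq he hw => ?_⟩
  have A0 : 0 < A := by linarith
  have i0 : Integrable (fun x => 48 * ‖x‖ ^ 2 * psi x ^ 2 - 24 * psi x ^ 3 - 8 * psi x ^ 3 * q x) μB :=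
    integrable_muB (by fun_prop)
  have i1 : Integrable (fun x => psi x ^ 3) μB := integrable_muB (by fun_prop)
  have i2 : Integrable (fun _ : E3 => (1:ℝ)) μB := integrable_muB (by fun_prop)
  have i3 : Integrable e μB := integrable_muB ce
  have i4 : Integrable (fun x => psi x ^ 4) μB := integrable_muB (by fun_prop)
  have i5 : Integrable (fun x => f x * psi x ^ 4) μB := integrable_muB (by fun_prop)
  calc _ ≤ ∫ x, ((48 * ‖x‖ ^ 2 * psi x ^ 2 - 24 * psi x ^ 3 - 8 * psi x ^ 3 * q x)
        + (-16) * psi x ^ 3 + δ * 1 + (δ / A) * e x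
        + (416 / δ * A) * (psi x ^ 4 - f x * psi x ^ 4)) ∂μB := by
        refine integral_muB_mono (by fun_prop) (by fun_prop) fun x hx => ?_
        obtain ⟨f0, f1⟩ := hf x hx
        have p0 := psi_nonneg x
        have p1 := psi_le_one x
        set s := (1 - f x) * psi x ^ 3 with hs
        have s0 : 0 ≤ s := by have : 0 ≤ 1 - f x := by linarith
                              positivity
        have ss : s ^ 2 ≤ psi x ^ 4 - f x * psi x ^ 4 := by
          have e1 : s ^ 2 = (1 - f x) * psi x ^ 4 * ((1 - f x) * psi x ^ 2) := by rw [hs]; ring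
          have e2 : (1 - f x) * psi x ^ 2 ≤ 1 :=
            mul_le_one₀ (by linarith) (by positivity) (pow_le_one₀ p0 p1)
          have e3 : 0 ≤ (1 - f x) * psi x ^ 4 := mul_nonneg (by linarith) (by positivity)
          nlinarith
        have y1 : 40 * s ≤ δ + 400 / δ * s ^ 2 := by
          have : 0 ≤ δ * (1 - 20 * s / δ) ^ 2 := by positivity
          have e1 : δ * (1 - 20 * s / δ) ^ 2 = δ - 40 * s + 400 / δ * s ^ 2 := by field_simp; ring
          linarith
        have y2 : 8 * s * q x ≤ δ / A * e x + 16 / δ * A * s ^ 2 := by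
          have : 0 ≤ (δ / A) * (q x - 4 * A * s / δ) ^ 2 := by positivity
          have e1 : (δ / A) * (q x - 4 * A * s / δ) ^ 2 =
            δ / A * q x ^ 2 - 8 * s * q x + 16 / δ * A * s ^ 2 := by field_simp; ring
          have e2 : δ / A * q x ^ 2 ≤ δ / A * e x :=
            mul_le_mul_of_nonneg_left (hq x hx) (by positivity)
          linarith
        have y3 : 400 / δ * s ^ 2 ≤ 400 / δ * A * s ^ 2 := by
          rw [mul_assoc]
          refine mul_le_mul_of_nonneg_left ?_ (by positivity)
          nlinarith [sq_nonneg s]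
        have y4 : 416 / δ * A * s ^ 2 ≤ 416 / δ * A * (psi x ^ 4 - f x * psi x ^ 4) :=
          mul_le_mul_of_nonneg_left ss (by positivity)
        have y5 : 416 / δ * A * s ^ 2 = 400 / δ * A * s ^ 2 + 16 / δ * A * s ^ 2 := by ring
        have y6 : 0 ≤ j x * psi x ^ 4 := mul_nonneg (hj x hx) (by positivity)
        have y7 : 0 ≤ (1 - f x) * (48 * ‖x‖ ^ 2 * psi x ^ 2) :=
          mul_nonneg (by linarith) (by positivity)
        have y8 : s = psi x ^ 3 - f x * psi x ^ 3 := by rw [hs]; ring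
        have y9 : 8 * s * q x = 8 * psi x ^ 3 * q x - f x * (8 * psi x ^ 3 * q x) := by rw [hs]; ring
        nlinarith
    _ = 0 + (-16) * m3 + δ * vB + (δ / A) * ∫ x, e x ∂μB
        + (416 / δ * A) * (m4 - ∫ x, f x * psi x ^ 4 ∂μB) := by
        rw [integral_add, integral_add, integral_add, integral_add, hw, integral_const_mul,
          integral_const_mul, integral_const_mul, integral_const_mul, integral_sub i4 i5]
        · rfl
        all_goals exact integrable_muB (by fun_prop)
    _ ≤ _ := by
        have e1 : (δ / A) * ∫ x, e x ∂μB ≤ (δ / A) * A := mul_le_mul_of_nonneg_left he (by positivity)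
        have e2 : (δ / A) * A = δ := by field_simp
        have e3 : δ * (vB + 1) = 8 * m3 := by rw [hδ]; field_simp
        linarith

/-- a linear differential inequality. -/
lemma ode_lower {Y Y' : ℝ → ℝ} {a b c k : ℝ} (hk : 0 < k)
    (hd : ∀ t ∈ Icc a b, HasDerivAt Y (Y' t) t) (h : ∀ t ∈ Icc a b, c - k * Y t ≤ Y' t)
    (hY : 0 ≤ Y a) (hab : a ≤ b) : c / k * (1 - Real.exp (-k * (b - a))) ≤ Y b := by
  have hG : ∀ t ∈ Icc a b, HasDerivAt (fun t => (Y t - c / k) * Real.exp (k * t))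
      ((Y' t) * Real.exp (k * t) + (Y t - c / k) * (Real.exp (k * t) * k)) t := fun t ht => by
    have e : HasDerivAt (fun t : ℝ => k * t) k t := by simpa using (hasDerivAt_id t).const_mul k
    exact ((hd t ht).sub_const _).mul e.exp
  have hm : MonotoneOn (fun t => (Y t - c / k) * Real.exp (k * t)) (Icc a b) := by
    refine monotoneOn_of_deriv_nonneg (convex_Icc a b)
      (fun t ht => (hG t ht).continuousAt.continuousWithinAt)
      (fun t ht => (hG t (interior_subset ht)).differentiableAt.differentiableWithinAt)
      fun t ht => ?_
    have ht := interior_subset ht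
    rw [(hG t ht).deriv]
    have e : (Y' t) * Real.exp (k * t) + (Y t - c / k) * (Real.exp (k * t) * k) =
      (Y' t - (c - k * Y t)) * Real.exp (k * t) := by field_simp; ring
    rw [e]
    exact mul_nonneg (by linarith [h t ht]) (Real.exp_pos _).le
  have := hm (left_mem_Icc.2 hab) (right_mem_Icc.2 hab) hab
  simp only at this
  have e1 : Real.exp (k * a) = Real.exp (-k * (b - a)) * Real.exp (k * b) := by
    rw [← Real.exp_add]; ring_nf
  rw [e1, ← mul_assoc] at this
  have := le_of_mul_le_mul_right this (Real.exp_pos _)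
  have e2 : 0 ≤ Y a * Real.exp (-k * (b - a)) := by positivity
  nlinarith

namespace Sys
variable {A : ℝ} {h ht g : E3 → ℝ → ℝ} {dh ddh u du : Fin 3 → E3 → ℝ → ℝ}
variable {F F' F'' : ℝ → ℝ}

lemma cont_ux (S : Sys A h ht g dh ddh u du) {t : ℝ} (t0 : t ∈ Ioo (-1:ℝ) 0) :
    ContinuousOn (fun x => ∑ i, u i x t * x i) cB := by
  have s0 := S.cont_u 0 t t0
  have s1 := S.cont_u 1 t t0
  have s2 := S.cont_u 2 t t0
  simp only [Fin.sum_univ_three]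
  fun_prop

lemma cont_uu (S : Sys A h ht g dh ddh u du) {t : ℝ} (t0 : t ∈ Ioo (-1:ℝ) 0) :
    ContinuousOn (fun x => ∑ i, u i x t ^ 2) cB := by
  have s0 := S.cont_u 0 t t0
  have s1 := S.cont_u 1 t t0
  have s2 := S.cont_u 2 t t0
  simp only [Fin.sum_univ_three]
  fun_prop

lemma cont_grad (S : Sys A h ht g dh ddh u du) {t : ℝ} (t0 : t ∈ Ioo (-1:ℝ) 0) :
    ContinuousOn (fun x => ∑ i, dh i x t ^ 2) cB := by
  have s0 := S.cont_dh 0 t t0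
  have s1 := S.cont_dh 1 t t0
  have s2 := S.cont_dh 2 t t0
  simp only [Fin.sum_univ_three]
  fun_prop

lemma ux_sq_le (u : Fin 3 → E3 → ℝ → ℝ) {x : E3} (hx : x ∈ cB) (t : ℝ) :
    (∑ i, u i x t * x i) ^ 2 ≤ ∑ i, u i x t ^ 2 := by
  have h1 : ‖x‖ ≤ 1 := by simpa [cB] using hx
  have h2 : ∑ i, x i ^ 2 ≤ 1 := by
    rw [Fin.sum_univ_three, ← sum_sq_eq]; exact pow_le_one₀ (norm_nonneg _) h1
  calc _ ≤ (∑ i, u i x t ^ 2) * ∑ i, x i ^ 2 := Finset.sum_mul_sq_le_sq_mul_sq _ _ _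
    _ ≤ _ := mul_le_of_le_one_right (Finset.sum_nonneg fun i _ => sq_nonneg _) h2

lemma weight_mean_four (S : Sys A h ht g dh ddh u du) {t : ℝ} (t0 : t ∈ Ioo (-1:ℝ) 0) :
    ∫ x, (48 * ‖x‖ ^ 2 * psi x ^ 2 - 24 * psi x ^ 3
      - 8 * psi x ^ 3 * ∑ i, u i x t * x i) ∂μB = 0 := by
  rw [← S.weight_mean (n := 4) (by norm_num) t0]
  exact integral_muB_congr fun x _ => by push_cast; ring

lemma deriv_energy_four (S : Sys A h ht g dh ddh u du) (P : Prof F F' F'')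
    {t : ℝ} (t0 : t ∈ Ioo (-1:ℝ) 0) :
    HasDerivAt (fun t => ∫ x, F (h x t) * psi x ^ 4 ∂μB)
      (∫ x, (F (h x t) * (48 * ‖x‖ ^ 2 * psi x ^ 2 - 40 * psi x ^ 3
          - 8 * psi x ^ 3 * ∑ i, u i x t * x i)
        - F'' (h x t) * (∑ i, dh i x t ^ 2) * psi x ^ 4) ∂μB) t := by
  refine (S.deriv_energy P (n := 4) (by norm_num) t0).congr_deriv ?_
  exact integral_muB_congr fun x _ => by push_cast; ring

lemma grad2_comp (S : Sys A h ht g dh ddh u du) (P : Prof F F' F'') {t : ℝ}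
    (t0 : t ∈ Ioo (-1:ℝ) 0) {x : E3} (hx : x ∈ cB) :
    grad2 (fun y => F (h y t)) x = F' (h x t) ^ 2 * ∑ i, dh i x t ^ 2 := by
  have hd : DifferentiableAt ℝ (fun y => F (h y t)) x :=
    ((P.contDiffAt (S.pos x hx t t0)).comp x (S.smooth x hx t t0)).differentiableAt (by simp)
  unfold grad2 pd
  rw [Finset.mul_sum]
  refine Finset.sum_congr rfl fun i _ => ?_
  have e1 := hd.hasFDerivAt.hasLineDerivAt (ee i)
  have e2 := S.der_comp P t0 i x hx
  rw [← mul_pow, ← HasDerivAt.unique e1 e2]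

end Sys

/-- positivity of the mean of `θ = 1 - prof1 h`. -/
lemma theta_lower : ∃ κ : ℝ, 0 < κ ∧ ∀ {A : ℝ} {h ht g : E3 → ℝ → ℝ}
    {dh ddh u du : Fin 3 → E3 → ℝ → ℝ}, Sys A h ht g dh ddh u du → ∀ t ∈ Ico (-3/4:ℝ) 0,
    κ / A ≤ ∫ x, (1 - prof1 (h x t)) * psi x ^ 4 ∂μB := by
  obtain ⟨c, C, c0, C0, key⟩ := spatial_theta
  have hpc := psi_continuous
  refine ⟨c / C * (1 - Real.exp (-C * (1 / 8))), mul_pos (by positivity) ?_, ?_⟩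
  · have : Real.exp (-C * (1 / 8)) < 1 := Real.exp_lt_one_iff.2 (by linarith)
    linarith
  intro A h ht g dh ddh u du S t hst
  have hA := S.one_le
  have A0 : 0 < A := by linarith
  have sub : ∀ s ∈ Icc (-7/8:ℝ) t, s ∈ Ioo (-1:ℝ) 0 := fun s hs =>
    ⟨by linarith [hs.1], by linarith [hs.2, hst.2]⟩
  have eqY : ∀ s ∈ Icc (-7/8:ℝ) t, ∫ x, (1 - prof1 (h x s)) * psi x ^ 4 ∂μB =
      m4 - ∫ x, prof1 (h x s) * psi x ^ 4 ∂μB := fun s hs => by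
    have c1 := S.cont_comp prof1_spec.c0 (sub s hs)
    have i1 : Integrable (fun x => prof1 (h x s) * psi x ^ 4) μB :=
      integrable_muB (c1.mul (by fun_prop))
    rw [m4, ← integral_sub (integrable_muB (by fun_prop))
      i1]
    exact integral_muB_congr fun x _ => by ring
  have ht' : t ∈ Icc (-7/8:ℝ) t := ⟨by linarith [hst.1], le_rfl⟩
  have := ode_lower (Y := fun s => m4 - ∫ x, prof1 (h x s) * psi x ^ 4 ∂μB)
    (a := -7/8) (b := t) (k := C * A) (c := c) (by positivity)
    (fun s hs => (S.deriv_energy_four prof1_spec (sub s hs)).const_sub m4) (fun s hs => ?_) ?_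
    (by linarith [hst.1])
  · rw [eqY t ht']
    refine le_trans ?_ this
    have e1 : c / C * (1 - Real.exp (-C * (1 / 8))) / A = c / (C * A) * (1 - Real.exp (-C * (1 / 8))) := by
      field_simp
    rw [e1]
    have : Real.exp (-(C * A) * (t - -7 / 8)) ≤ Real.exp (-C * (1 / 8)) := by
      rw [Real.exp_le_exp]
      have : C * (1/8) ≤ C * A * (t - -7/8) :=
        mul_le_mul (by nlinarith) (by linarith [hst.1]) (by norm_num) (by positivity)
      linarith
    gcongr
  · have s0 := sub s hs
    have := key A (fun x => prof1 (h x s)) (fun x => prof1'' (h x s) * ∑ i, dh i x s ^ 2)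
      (fun x => ∑ i, u i x s * x i) (fun x => ∑ i, u i x s ^ 2) hA
      (S.cont_comp prof1_spec.c0 s0) ((S.cont_comp prof1_spec.c2 s0).mul (S.cont_grad s0))
      (S.cont_ux s0) (S.cont_uu s0)
      (fun x hx => ⟨prof1_nonneg _, (prof1_lt_one (S.pos x hx s s0)).le⟩)
      (fun x hx => mul_nonneg (prof1''_nonneg _) (Finset.sum_nonneg fun i _ => sq_nonneg _))
      (fun x hx => Sys.ux_sq_le u hx s) (S.energy s s0) (S.weight_mean_four s0)
    linarith
  · have hs : (-7/8:ℝ) ∈ Icc (-7/8:ℝ) t := ⟨le_rfl, by linarith [hst.1]⟩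
    simp only [← eqY _ hs]
    refine integral_muB_nonneg fun x hx => mul_nonneg ?_ (pow_nonneg (psi_nonneg x) 4)
    linarith [prof1_lt_one (S.pos x hx _ (sub _ hs))]

lemma exp_neg_le_of_gap {v V : ℝ} (hv : 0 ≤ v) (hV : 0 ≤ V) :
    V ^ 2 * Real.exp (-v) ≤ 2 * V + 4 * (v - V) ^ 2 := by
  rcases le_total (V / 2) v with h | h
  · have h1 : Real.exp (-v) * (1 + v) ≤ 1 := by
      have := Real.add_one_le_exp v
      calc Real.exp (-v) * (1 + v) ≤ Real.exp (-v) * Real.exp v := by gcongr; linarith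
        _ = 1 := by rw [← Real.exp_add]; simp
    have h2 := Real.exp_pos (-v)
    nlinarith [mul_nonneg hV (sub_nonneg.2 h1), mul_nonneg (mul_nonneg hV h2.le) (sub_nonneg.2 h),
      mul_nonneg hV h2.le]
  · have h1 : Real.exp (-v) ≤ 1 := Real.exp_le_one_iff.2 (by linarith)
    nlinarith [mul_nonneg (sq_nonneg V) (sub_nonneg.2 h1)]

lemma integral_comb {μ : Measure E3} {a b c d e : E3 → ℝ} (ha : Integrable a μ)
    (hb : Integrable b μ) (hc : Integrable c μ) (hd : Integrable d μ) (he : Integrable e μ) :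
    ∫ x, (a x + b x + c x + d x - e x) ∂μ =
      ∫ x, a x ∂μ + ∫ x, b x ∂μ + ∫ x, c x ∂μ + ∫ x, d x ∂μ - ∫ x, e x ∂μ := by
  have e1 := integral_sub (f := fun x => a x + b x + c x + d x) (((ha.add hb).add hc).add hd) he
  have e2 := integral_add (f := fun x => a x + b x + c x) ((ha.add hb).add hc) hd
  have e3 := integral_add (f := fun x => a x + b x) (ha.add hb) hc
  have e4 := integral_add ha hb
  linarith

set_option maxHeartbeats 1000000 in
lemma spatial_log {κ : ℝ} (hκ : 0 < κ) : ∃ c C : ℝ, 0 < c ∧ 0 < C ∧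
    ∀ (A : ℝ) (v j q e : E3 → ℝ), 1 ≤ A →
    ContinuousOn j cB → ContinuousOn q cB → ContinuousOn e cB →
    (∀ x ∈ cB, ContDiffAt ℝ 1 v x) → (∀ x ∈ cB, 0 ≤ v x) → (∀ x ∈ cB, grad2 v x ≤ j x) →
    (∀ x ∈ cB, q x ^ 2 ≤ e x) → ∫ x, e x ∂μB ≤ A →
    ∫ x, (48 * ‖x‖ ^ 2 * psi x ^ 2 - 24 * psi x ^ 3 - 8 * psi x ^ 3 * q x) ∂μB = 0 →
    κ / A ≤ ∫ x, Real.exp (-v x) * psi x ^ 4 ∂μB →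
    ∫ x, (v x * (48 * ‖x‖ ^ 2 * psi x ^ 2 - 40 * psi x ^ 3 - 8 * psi x ^ 3 * q x)
      - j x * psi x ^ 4) ∂μB ≤ -(c / A) * (∫ x, v x * psi x ^ 4 ∂μB) ^ 2 + C * A := by
  obtain ⟨CP, CP0, poin⟩ := poincare
  have hm := m4_pos
  have hv := vB_nonneg
  have hpc := psi_continuous
  refine ⟨κ / (16 * CP * m4 ^ 2), m4 ^ 2 / (4 * κ * CP) + CP / 2 * (4608 * vB + 128),
    by positivity, by positivity, fun A v j q e hA cj cq ce dv hv0 hj hq he hw hθ => ?_⟩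
  have A0 : 0 < A := by linarith
  have cv : ContinuousOn v cB := fun x hx => (dv x hx).continuousAt.continuousWithinAt
  have cgr := continuousOn_grad2 dv
  set V := (∫ x, v x * psi x ^ 4 ∂μB) / m4 with hVdef
  have hVm : V * m4 = ∫ x, v x * psi x ^ 4 ∂μB := by rw [hVdef]; field_simp
  have V0 : 0 ≤ V := div_nonneg (integral_muB_nonneg fun x hx =>
    mul_nonneg (hv0 x hx) (pow_nonneg (psi_nonneg x) 4)) hm.le
  set D := ∫ x, (v x - V) ^ 2 * psi x ^ 4 ∂μB with hD
  set G := ∫ x, grad2 v x * psi x ^ 4 ∂μB with hG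
  have hP : D ≤ CP * G := poin v dv V hVm
  have i0 : Integrable (fun x => 48 * ‖x‖ ^ 2 * psi x ^ 2 - 24 * psi x ^ 3 - 8 * psi x ^ 3 * q x) μB :=
    integrable_muB (by fun_prop)
  have i1 : Integrable (fun x => psi x ^ 4) μB := integrable_muB (by fun_prop)
  have i2 : Integrable (fun _ : E3 => (1:ℝ)) μB := integrable_muB (by fun_prop)
  have i3 : Integrable e μB := integrable_muB ce
  have i4 : Integrable (fun x => (v x - V) ^ 2 * psi x ^ 4) μB := integrable_muB (by fun_prop)
  have i5 : Integrable (fun x => grad2 v x * psi x ^ 4) μB := integrable_muB (by fun_prop)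
  have j0 := i0.const_mul V
  have j1 := i4.const_mul (1 / (2 * CP))
  have j2 := i2.const_mul (CP / 2 * 4608)
  have j3 := i3.const_mul (CP / 2 * 128)
  clear_value V
  have a : ∫ x, (v x * (48 * ‖x‖ ^ 2 * psi x ^ 2 - 40 * psi x ^ 3 - 8 * psi x ^ 3 * q x)
      - j x * psi x ^ 4) ∂μB ≤
      1 / (2 * CP) * D + CP / 2 * (4608 * vB + 128 * A) - G := by
    calc _ ≤ ∫ x, (V * (48 * ‖x‖ ^ 2 * psi x ^ 2 - 24 * psi x ^ 3 - 8 * psi x ^ 3 * q x)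
        + 1 / (2 * CP) * ((v x - V) ^ 2 * psi x ^ 4) + CP / 2 * 4608 * 1 + CP / 2 * 128 * e x
        - grad2 v x * psi x ^ 4) ∂μB := by
          refine integral_muB_mono (by fun_prop) (by fun_prop) fun x hx => ?_
          have p0 := psi_nonneg x
          have p1 := psi_le_one x
          have x1 : ‖x‖ ≤ 1 := by simpa [cB] using hx
          have x2 : ‖x‖ ^ 2 ≤ 1 := pow_le_one₀ (norm_nonneg _) x1
          set p := 48 * ‖x‖ ^ 2 - 24 * psi x - 8 * psi x * q x with hp
          have y1 : (v x - V) * psi x ^ 2 * p ≤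
              1 / (2 * CP) * ((v x - V) ^ 2 * psi x ^ 4) + CP / 2 * p ^ 2 := by
            have : 0 ≤ CP / 2 * (p - (v x - V) * psi x ^ 2 / CP) ^ 2 := by positivity
            have e1 : CP / 2 * (p - (v x - V) * psi x ^ 2 / CP) ^ 2 =
              1 / (2 * CP) * ((v x - V) ^ 2 * psi x ^ 4) + CP / 2 * p ^ 2
                - (v x - V) * psi x ^ 2 * p := by field_simp; ring
            linarith
          have y2 : p ^ 2 ≤ 4608 + 128 * e x := by
            have z1 : p ^ 2 ≤ 2 * (48 * ‖x‖ ^ 2 - 24 * psi x) ^ 2 + 2 * (8 * psi x * q x) ^ 2 := by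
              rw [hp]; nlinarith [sq_nonneg (48 * ‖x‖ ^ 2 - 24 * psi x + 8 * psi x * q x)]
            have z2 : (48 * ‖x‖ ^ 2 - 24 * psi x) ^ 2 ≤ 48 ^ 2 := by
              apply sq_le_sq'
              · nlinarith [sq_nonneg ‖x‖]
              · linarith
            have z3 : (8 * psi x * q x) ^ 2 ≤ 64 * e x := by
              have : psi x ^ 2 ≤ 1 := pow_le_one₀ p0 p1
              have : psi x ^ 2 * q x ^ 2 ≤ q x ^ 2 := mul_le_of_le_one_left (sq_nonneg _) this
              nlinarith [hq x hx]
            linarith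
          have y3 := mul_le_mul_of_nonneg_left y2 (show 0 ≤ CP / 2 by positivity)
          have y4 : grad2 v x * psi x ^ 4 ≤ j x * psi x ^ 4 :=
            mul_le_mul_of_nonneg_right (hj x hx) (by positivity)
          have y5 : 0 ≤ 16 * (v x * psi x ^ 3) := by have := hv0 x hx; positivity
          have y6 : v x * (48 * ‖x‖ ^ 2 * psi x ^ 2 - 40 * psi x ^ 3 - 8 * psi x ^ 3 * q x) =
            V * (48 * ‖x‖ ^ 2 * psi x ^ 2 - 24 * psi x ^ 3 - 8 * psi x ^ 3 * q x)
            + (v x - V) * psi x ^ 2 * p - 16 * (v x * psi x ^ 3) := by rw [hp]; ring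
          linarith
      _ = V * 0 + 1 / (2 * CP) * D + CP / 2 * 4608 * vB + CP / 2 * 128 * ∫ x, e x ∂μB - G := by
          rw [integral_comb j0 j1 j2 j3 i5, integral_const_mul,
            integral_const_mul, integral_const_mul, integral_const_mul, hw, vB]
      _ ≤ _ := by
          have := mul_le_mul_of_nonneg_left he (show 0 ≤ CP / 2 * 128 by positivity)
          linarith
  have b : κ / A * V ^ 2 ≤ 2 * V * m4 + 4 * D := by
    calc κ / A * V ^ 2 ≤ (∫ x, Real.exp (-v x) * psi x ^ 4 ∂μB) * V ^ 2 := by gcongr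
      _ = ∫ x, V ^ 2 * (Real.exp (-v x) * psi x ^ 4) ∂μB := by rw [integral_const_mul, mul_comm]
      _ ≤ ∫ x, (2 * V * psi x ^ 4 + 4 * ((v x - V) ^ 2 * psi x ^ 4)) ∂μB := by
          refine integral_muB_mono (by fun_prop) (by fun_prop) fun x hx => ?_
          have := mul_le_mul_of_nonneg_right (exp_neg_le_of_gap (hv0 x hx) V0)
            (pow_nonneg (psi_nonneg x) 4)
          linarith
      _ = _ := by
          rw [integral_add (i1.const_mul _) (i4.const_mul _), integral_const_mul,
            integral_const_mul, m4]
  have c1 : 2 * V * m4 ≤ κ / A * V ^ 2 / 2 + 2 * m4 ^ 2 * A / κ := by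
    have : 0 ≤ κ / A / 2 * (V - 2 * m4 * A / κ) ^ 2 := by positivity
    have e1 : κ / A / 2 * (V - 2 * m4 * A / κ) ^ 2 =
      κ / A * V ^ 2 / 2 + 2 * m4 ^ 2 * A / κ - 2 * V * m4 := by field_simp; ring
    linarith
  rw [← hVm]
  have d1 : κ / A * V ^ 2 / 8 - m4 ^ 2 * A / (2 * κ) ≤ D := by
    have : 2 * m4 ^ 2 * A / κ = 4 * (m4 ^ 2 * A / (2 * κ)) := by field_simp; ring
    linarith
  have d2 : D / (2 * CP) + D / (2 * CP) ≤ G := by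
    have : D / (2 * CP) + D / (2 * CP) = D / CP := by field_simp; ring
    rw [this, div_le_iff₀ CP0]; linarith
  have d3 : (κ / A * V ^ 2 / 8 - m4 ^ 2 * A / (2 * κ)) / (2 * CP) ≤ D / (2 * CP) := by gcongr
  have d4 : 1 / (2 * CP) * D = D / (2 * CP) := by ring
  have d5 : -(κ / (16 * CP * m4 ^ 2) / A) * (V * m4) ^ 2 +
      (m4 ^ 2 / (4 * κ * CP) + CP / 2 * (4608 * vB + 128)) * A =
      -((κ / A * V ^ 2 / 8 - m4 ^ 2 * A / (2 * κ)) / (2 * CP)) + CP / 2 * (4608 * vB + 128) * A := by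
    field_simp; ring
  have d6 : CP / 2 * (4608 * vB + 128 * A) ≤ CP / 2 * (4608 * vB + 128) * A := by
    rw [mul_assoc]
    refine mul_le_mul_of_nonneg_left ?_ (by positivity)
    nlinarith
  linarith

/-- a Riccati differential inequality. -/
lemma ode_riccati {I I' : ℝ → ℝ} {a b α B : ℝ} (hα : 0 < α)
    (hd : ∀ t ∈ Icc a b, HasDerivAt I (I' t) t) (h : ∀ t ∈ Icc a b, I' t ≤ -α * I t ^ 2 + B)
    (hB : 0 ≤ B) (hab : a < b) (hb : b ≤ a + 1) : (b - a) * I b ≤ 1 / α + B := by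
  have hG : ∀ t ∈ Icc a b, HasDerivAt (fun t => (t - a) ^ 2 * I t - (1 / α + B) * t)
      ((2 * (t - a)) * I t + (t - a) ^ 2 * I' t - (1 / α + B)) t := fun t ht => by
    have e : HasDerivAt (fun t : ℝ => (t - a) ^ 2) (2 * (t - a)) t := by
      exact (((hasDerivAt_id t).sub_const a).pow 2).congr_deriv (by simp)
    have e2 : HasDerivAt (fun t : ℝ => (1 / α + B) * t) (1 / α + B) t := by
      simpa using (hasDerivAt_id t).const_mul (1 / α + B)
    exact (e.mul (hd t ht)).sub e2
  have hm : AntitoneOn (fun t => (t - a) ^ 2 * I t - (1 / α + B) * t) (Icc a b) := by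
    refine antitoneOn_of_deriv_nonpos (convex_Icc a b)
      (fun t ht => (hG t ht).continuousAt.continuousWithinAt)
      (fun t ht => (hG t (interior_subset ht)).differentiableAt.differentiableWithinAt)
      fun t ht => ?_
    have ht := interior_subset ht
    rw [(hG t ht).deriv]
    set s := t - a with hs
    have s0 : 0 ≤ s := by linarith [ht.1]
    have s1 : s ≤ 1 := by linarith [ht.2]
    have z1 : s ^ 2 * I' t ≤ s ^ 2 * (-α * I t ^ 2 + B) :=
      mul_le_mul_of_nonneg_left (h t ht) (sq_nonneg s)
    have z2 : s ^ 2 * B ≤ B := mul_le_of_le_one_left hB (pow_le_one₀ s0 s1)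
    have z3 : 0 ≤ α * (s * I t - 1 / α) ^ 2 := by positivity
    have e1 : α * (s * I t - 1 / α) ^ 2 = α * s ^ 2 * I t ^ 2 - 2 * s * I t + 1 / α := by
      field_simp; ring
    nlinarith
  have := hm (left_mem_Icc.2 hab.le) (right_mem_Icc.2 hab.le) hab.le
  simp only [sub_self, ne_eq, OfNat.ofNat_ne_zero, not_false_eq_true, zero_pow, zero_mul] at this
  have h2 : (b - a) * ((b - a) * I b) ≤ (b - a) * (1 / α + B) := by nlinarith
  exact le_of_mul_le_mul_left h2 (by linarith)

/-- the `L¹` bound on the logarithm. -/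
lemma log_mean_upper : ∃ C : ℝ, 0 < C ∧ ∀ {A : ℝ} {h ht g : E3 → ℝ → ℝ}
    {dh ddh u du : Fin 3 → E3 → ℝ → ℝ}, Sys A h ht g dh ddh u du → ∀ t ∈ Ico (-1/2:ℝ) 0,
    ∫ x, profL (h x t) * psi x ^ 4 ∂μB ≤ C * A := by
  obtain ⟨κ, κ0, hκ⟩ := theta_lower
  obtain ⟨c, C, c0, C0, key⟩ := spatial_log κ0
  refine ⟨4 * (1 / c + C), by positivity, ?_⟩
  intro A h ht g dh ddh u du S t hst
  have hA := S.one_le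
  have A0 : 0 < A := by linarith
  have sub : ∀ s ∈ Icc (-3/4:ℝ) t, s ∈ Ioo (-1:ℝ) 0 := fun s hs =>
    ⟨by linarith [hs.1], by linarith [hs.2, hst.2]⟩
  have := ode_riccati (I := fun s => ∫ x, profL (h x s) * psi x ^ 4 ∂μB)
    (a := -3/4) (b := t) (α := c / A) (B := C * A) (by positivity)
    (fun s hs => S.deriv_energy_four profL_spec (sub s hs)) (fun s hs => ?_) (by positivity)
    (by linarith [hst.1]) (by linarith [hst.2])
  · have I0 : 0 ≤ ∫ x, profL (h x t) * psi x ^ 4 ∂μB :=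
      integral_muB_nonneg fun x hx => mul_nonneg
        (profL_nonneg (S.pos x hx t (sub t ⟨by linarith [hst.1], le_rfl⟩)))
        (pow_nonneg (psi_nonneg x) 4)
    have e1 : 1 / (c / A) = 1 / c * A := by field_simp
    rw [e1] at this
    have e2 : (1/4) * ∫ x, profL (h x t) * psi x ^ 4 ∂μB ≤
        (t - -3/4) * ∫ x, profL (h x t) * psi x ^ 4 ∂μB :=
      mul_le_mul_of_nonneg_right (by linarith [hst.1]) I0
    nlinarith
  · have s0 := sub s hs
    refine key A (fun x => profL (h x s)) (fun x => profL'' (h x s) * ∑ i, dh i x s ^ 2)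
      (fun x => ∑ i, u i x s * x i) (fun x => ∑ i, u i x s ^ 2) hA
      ((S.cont_comp profL_spec.c2 s0).mul (S.cont_grad s0))
      (S.cont_ux s0) (S.cont_uu s0)
      (fun x hx => ContDiffAt.comp (g := profL) (f := fun y => h y s) x
        (profL_spec.contDiffAt (S.pos x hx s s0)) (S.smooth x hx s s0))
      (fun x hx => profL_nonneg (S.pos x hx s s0))
      (fun x hx => ?_)
      (fun x hx => Sys.ux_sq_le u hx s) (S.energy s s0) (S.weight_mean_four s0) ?_
    · rw [S.grad2_comp profL_spec s0 hx]
      exact mul_le_mul_of_nonneg_right (sq_le_profL'' (S.pos x hx s s0))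
        (Finset.sum_nonneg fun i _ => sq_nonneg _)
    · refine (hκ S s ⟨hs.1, s0.2⟩).trans_eq (integral_muB_congr fun x hx => ?_)
      simp only [exp_neg_profL (S.pos x hx s s0)]

lemma contDiff_mul_psi {w : E3 → ℝ} (dw : ∀ x ∈ cB, ContDiffAt ℝ 1 w x) {c : ℕ} (hc : 2 ≤ c)
    (k : ℝ) : ContDiff ℝ 1 fun x => w x * (k * psi x ^ c) := by
  rw [contDiff_iff_contDiffAt]
  intro x
  by_cases hx : x ∈ cB
  · exact (dw x hx).mul (contDiffAt_const.mul (contDiff_psi_pow hc).contDiffAt)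
  · have hU : IsOpen (cBᶜ) := (Metric.isClosed_closedBall).isOpen_compl
    refine (contDiffAt_const (c := (0:ℝ))).congr_of_eventuallyEq ?_
    filter_upwards [hU.mem_nhds hx] with y hy
    have : 1 < ‖y‖ := by simpa [cB] using hy
    rw [psi_eq_zero this.le, zero_pow (by omega)]; ring

lemma grad2_mul_psi_le {w : E3 → ℝ} {x : E3} (hx : x ∈ cB) (dw : ContDiffAt ℝ 1 w x) {c : ℕ}
    (hc : 2 ≤ c) (k : ℝ) : grad2 (fun x => w x * (k * psi x ^ c)) x ≤
      8 * c ^ 2 * w x ^ 2 * k ^ 2 * psi x ^ (2 * (c - 1)) + 2 * k ^ 2 * psi x ^ (2 * c) * grad2 w x := by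
  have x1 : ‖x‖ ≤ 1 := by simpa [cB] using hx
  have x2 : ∑ i, x i ^ 2 ≤ 1 := by
    rw [Fin.sum_univ_three, ← sum_sq_eq]; exact pow_le_one₀ (norm_nonneg _) x1
  have hp : ∀ i, pd (fun x => w x * (k * psi x ^ c)) i x =
      k * psi x ^ c * pd w i x + w x * (k * -(2 * c * x i * psi x ^ (c - 1))) := by
    intro i
    have h1 := (dw.differentiableAt (by simp)).hasFDerivAt.hasLineDerivAt (ee i)
    have h2 := hasLineDerivAt_psi_pow hc x i
    have h3 := ((contDiffAt_const (c := k)).mul (contDiff_psi_pow hc).contDiffAt :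
      ContDiffAt ℝ 1 (fun x => k * psi x ^ c) x)
    have h4 := ((dw.mul h3).differentiableAt (by simp)).hasFDerivAt.hasLineDerivAt (ee i)
    refine HasDerivAt.unique h4 ?_
    unfold HasLineDerivAt at h1 h2
    have := h1.mul (h2.const_mul k)
    refine this.congr_deriv ?_
    simp [pd]; ring
  unfold grad2
  simp only [hp]
  calc _ ≤ ∑ i, (8 * c ^ 2 * w x ^ 2 * k ^ 2 * psi x ^ (2 * (c - 1)) * x i ^ 2 +
        2 * k ^ 2 * psi x ^ (2 * c) * pd w i x ^ 2) := by
        refine Finset.sum_le_sum fun i _ => ?_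
        rw [mul_comm 2 (c - 1), mul_comm 2 c, pow_mul, pow_mul]
        nlinarith [sq_nonneg (k * psi x ^ c * pd w i x - w x * (k * -(2 * c * x i * psi x ^ (c - 1))))]
    _ = 8 * c ^ 2 * w x ^ 2 * k ^ 2 * psi x ^ (2 * (c - 1)) * ∑ i, x i ^ 2 +
        2 * k ^ 2 * psi x ^ (2 * c) * ∑ i, pd w i x ^ 2 := by
        rw [Finset.sum_add_distrib, Finset.mul_sum, Finset.mul_sum]
    _ ≤ _ := by
        have : 0 ≤ 8 * c ^ 2 * w x ^ 2 * k ^ 2 * psi x ^ (2 * (c - 1)) := by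
          have := psi_nonneg x; positivity
        have := mul_le_of_le_one_right this x2
        linarith

lemma moser_pointwise {a n : ℕ} (hn : n = 2 * (a + 5)) {w q j G χ P X : ℝ}
    (hP0 : 0 ≤ P) (hP1 : P ≤ 1) (hχ0 : 0 ≤ χ) (hχ1 : χ ≤ 1) (hX1 : X ≤ 1)
    (hG : G ≤ 8 * ((a + 5 : ℕ) : ℝ) ^ 2 * w ^ 2 * (χ ^ (a + 5)) ^ 2 * P ^ (2 * (a + 5 - 1))
      + (χ ^ (a + 5)) ^ 2 * P ^ (2 * (a + 5)) * j) :
    2 * n * χ ^ (n - 1) * (w ^ 2 * P ^ n) + χ ^ n * (w ^ 2 * (4 * n * (n - 1) * X * P ^ (n - 2)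
      - 10 * n * P ^ (n - 1) - 2 * n * P ^ (n - 1) * q) - j * P ^ n) ≤
    28 * (a + 5) ^ 2 * (w ^ 2 * (χ * P) ^ (2 * a + 6))
      + 4 * (a + 5) * (w ^ 2 * (χ * P) ^ (2 * a + 9) * |q|) - G := by
  have e0 : n - 1 = 2 * a + 9 := by omega
  have e1 : n - 2 = 2 * a + 8 := by omega
  have e2 : 2 * (a + 5 - 1) = 2 * a + 8 := by omega
  have e3 : n = 2 * a + 10 := by omega
  have e4 : (n:ℝ) = 2 * (a + 5) := by rw [hn]; push_cast; ring
  rw [e2] at hG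
  have e5 : (χ ^ (a + 5)) ^ 2 = χ ^ (2 * a + 10) := by rw [← pow_mul]; ring_nf
  have e6 : 2 * (a + 5) = 2 * a + 10 := by ring
  rw [e5, e6] at hG
  push_cast at hG
  rw [e4, e0, e1, e3]
  set c : ℝ := (a:ℝ) + 5 with hc
  have c5 : 5 ≤ c := by rw [hc]; linarith [(Nat.cast_nonneg a : (0:ℝ) ≤ a)]
  set z := w ^ 2 * (χ * P) ^ (2 * a + 6) with hz
  have z0 : 0 ≤ z := by positivity
  have b1 : 0 ≤ z * (χ ^ 3 * P ^ 4) ∧ z * (χ ^ 3 * P ^ 4) ≤ z :=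
    ⟨by positivity, mul_le_of_le_one_right z0 (mul_le_one₀ (pow_le_one₀ hχ0 hχ1) (by positivity)
      (pow_le_one₀ hP0 hP1))⟩
  have b2 : 0 ≤ z * (χ ^ 4 * P ^ 2) ∧ z * (χ ^ 4 * P ^ 2) ≤ z :=
    ⟨by positivity, mul_le_of_le_one_right z0 (mul_le_one₀ (pow_le_one₀ hχ0 hχ1) (by positivity)
      (pow_le_one₀ hP0 hP1))⟩
  have b3 : z * (χ ^ 4 * P ^ 2) * X ≤ z :=
    (mul_le_of_le_one_right b2.1 hX1).trans b2.2
  have t1 : 2 * (2 * c) * χ ^ (2 * a + 9) * (w ^ 2 * P ^ (2 * a + 10)) =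
      4 * c * (z * (χ ^ 3 * P ^ 4)) := by rw [hz, mul_pow]; ring
  have t2 : χ ^ (2 * a + 10) * (w ^ 2 * (4 * (2 * c) * (2 * c - 1) * X * P ^ (2 * a + 8))) =
      8 * c * (2 * c - 1) * (z * (χ ^ 4 * P ^ 2) * X) := by rw [hz, mul_pow]; ring
  have t3 : 0 ≤ χ ^ (2 * a + 10) * (w ^ 2 * (10 * (2 * c) * P ^ (2 * a + 9))) := by positivity
  have t4 : -(χ ^ (2 * a + 10) * (w ^ 2 * (2 * (2 * c) * P ^ (2 * a + 9) * q))) ≤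
      4 * c * (w ^ 2 * (χ * P) ^ (2 * a + 9) * |q|) := by
    have y0 : 0 ≤ w ^ 2 * (χ * P) ^ (2 * a + 9) := by positivity
    have y1 : -(χ * q) ≤ |q| := by
      calc -(χ * q) ≤ |χ * q| := neg_le_abs _
        _ = χ * |q| := by rw [abs_mul, abs_of_nonneg hχ0]
        _ ≤ |q| := mul_le_of_le_one_left (abs_nonneg _) hχ1
    have y2 := mul_le_mul_of_nonneg_left y1 (mul_nonneg (show 0 ≤ 4 * c by positivity) y0)
    calc _ = 4 * c * (w ^ 2 * (χ * P) ^ (2 * a + 9)) * -(χ * q) := by rw [mul_pow]; ring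
      _ ≤ _ := y2
      _ = _ := by ring
  have t5 : 8 * c ^ 2 * w ^ 2 * χ ^ (2 * a + 10) * P ^ (2 * a + 8) =
      8 * c ^ 2 * (z * (χ ^ 4 * P ^ 2)) := by rw [hz, mul_pow]; ring
  have s1 : 4 * c * (z * (χ ^ 3 * P ^ 4)) ≤ 4 * c * z :=
    mul_le_mul_of_nonneg_left b1.2 (by positivity)
  have s2 : 8 * c * (2 * c - 1) * (z * (χ ^ 4 * P ^ 2) * X) ≤ 8 * c * (2 * c - 1) * z :=
    mul_le_mul_of_nonneg_left b3 (mul_nonneg (by positivity) (by linarith))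
  have s3 : 8 * c ^ 2 * (z * (χ ^ 4 * P ^ 2)) ≤ 8 * c ^ 2 * z :=
    mul_le_mul_of_nonneg_left b2.2 (by positivity)
  have s4 : 0 ≤ c * z := by positivity
  have s5 : 0 ≤ (c - 5) * (c * z) := mul_nonneg (by linarith) s4
  nlinarith

set_option maxHeartbeats 1000000 in
lemma spatial_moser : ∃ C : ℝ, 0 < C ∧ ∀ (a n : ℕ) (A χ M : ℝ) (w j q e : E3 → ℝ),
    n = 2 * (a + 5) → 1 ≤ A → 0 ≤ χ → χ ≤ 1 →
    ContinuousOn j cB → ContinuousOn q cB → ContinuousOn e cB →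
    (∀ x ∈ cB, ContDiffAt ℝ 1 w x) → (∀ x ∈ cB, 0 ≤ w x) → (∀ x ∈ cB, 2 * grad2 w x ≤ j x) →
    (∀ x ∈ cB, q x ^ 2 ≤ e x) → ∫ x, e x ∂μB ≤ A →
    χ ^ a * ∫ x, w x * psi x ^ a ∂μB ≤ M →
    2 * n * χ ^ (n - 1) * ∫ x, w x ^ 2 * psi x ^ n ∂μB +
      χ ^ n * ∫ x, (w x ^ 2 * (4 * n * (n - 1) * ‖x‖ ^ 2 * psi x ^ (n - 2)
        - 10 * n * psi x ^ (n - 1) - 2 * n * psi x ^ (n - 1) * q x) - j x * psi x ^ n) ∂μB ≤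
      C * (a + 5) ^ 10 * A ^ 5 * M ^ 2 := by
  obtain ⟨S, S0, sob⟩ := sobolev
  have hpc := psi_continuous
  set ε := 1 / (2 * (S + 1)) with hε
  have ε0 : 0 < ε := by positivity
  have ε1 : ε ≤ 1 := by rw [hε, div_le_one (by positivity)]; linarith
  refine ⟨ε * (28 / ε) ^ 3 + ε * (4 / ε) ^ 10, by positivity, ?_⟩
  intro a n A χ M w j q e hn hA χ0 χ1 cj cq ce dw w0 hj hq he hM
  have A0 : 0 < A := by linarith
  have cw : ContinuousOn w cB := fun x hx => (dw x hx).continuousAt.continuousWithinAt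
  set c : ℝ := (a:ℝ) + 5 with hc
  have c5 : 5 ≤ c := by rw [hc]; linarith [(Nat.cast_nonneg a : (0:ℝ) ≤ a)]
  set W : E3 → ℝ := fun x => w x * (χ ^ (a + 5) * psi x ^ (a + 5)) with hW
  have dW : ContDiff ℝ 1 W := contDiff_mul_psi dw (by omega) _
  have zW : ∀ x, 1 ≤ ‖x‖ → W x = 0 := fun x hx => by
    simp only [hW, psi_eq_zero hx]; rw [zero_pow (by omega)]; ring
  have W0' : ∀ x ∈ cB, 0 ≤ W x := fun x hx => by
    have := w0 x hx; have := psi_nonneg x; simp only [hW]; positivity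
  have W0 : ∀ x, 0 ≤ W x := fun x => by
    by_cases hx : x ∈ cB
    · exact W0' x hx
    · have : 1 < ‖x‖ := by simpa [cB] using hx
      rw [zW x this.le]
  have cW : Continuous W := dW.continuous
  have cG : ContinuousOn (grad2 W) cB := continuousOn_grad2 fun x _ => dW.contDiffAt
  set N0 := ∫ x, grad2 W x ∂μB with hN0
  have N00 : 0 ≤ N0 := integral_muB_nonneg fun x _ => grad2_nonneg W x
  set N := S * N0 with hN
  have hN' : 0 ≤ N := by positivity
  have hX : ∫ x, W x ^ 6 ∂μB ≤ N ^ 3 := sob W dW W0 zW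
  have hX0 : 0 ≤ ∫ x, W x ^ 6 ∂μB := integral_muB_nonneg fun x _ => pow_nonneg (W0 x) 6
  have M' : ∫ x, w x * (χ * psi x) ^ a ∂μB ≤ M := by
    refine le_trans (le_of_eq ?_) hM
    rw [← integral_const_mul]
    exact integral_muB_congr fun x _ => by ring
  have g0 : ∀ x ∈ cB, 0 ≤ w x * (χ * psi x) ^ a := fun x hx => by
    have := w0 x hx; have := psi_nonneg x; positivity
  have I0 : 0 ≤ ∫ x, w x * (χ * psi x) ^ a ∂μB := integral_muB_nonneg g0
  have M0 : 0 ≤ M := I0.trans M'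
  set P : E3 → ℝ := fun x => w x ^ 2 * (χ * psi x) ^ (2 * a + 6) with hP
  set Q : E3 → ℝ := fun x => w x ^ 2 * (χ * psi x) ^ (2 * a + 9) with hQ
  have cP : ContinuousOn P cB := by fun_prop
  have cQ : ContinuousOn Q cB := by fun_prop
  have cg : ContinuousOn (fun x => w x * (χ * psi x) ^ a) cB := by fun_prop
  have P0 : ∀ x ∈ cB, 0 ≤ P x := fun x hx => by have := psi_nonneg x; positivity
  have Q0 : ∀ x ∈ cB, 0 ≤ Q x := fun x hx => by have := psi_nonneg x; positivity
  have hpI : (∫ x, P x ∂μB) ^ 5 ≤ (∫ x, W x ^ 6 ∂μB) ^ 1 * (∫ x, w x * (χ * psi x) ^ a ∂μB) ^ 4 :=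
    holder_poly (by norm_num) (by norm_num) (by norm_num) cP (by fun_prop) cg P0
      (fun x _ => pow_nonneg (W0 x) 6) g0 fun x _ => le_of_eq (by simp only [hP, hW]; ring)
  have hqI : (∫ x, Q x ^ 2 ∂μB) ^ 5 ≤ (∫ x, W x ^ 6 ∂μB) ^ 3 *
      (∫ x, w x * (χ * psi x) ^ a ∂μB) ^ 2 :=
    holder_poly (by norm_num) (by norm_num) (by norm_num) (by fun_prop) (by fun_prop) cg
      (fun x _ => sq_nonneg _)
      (fun x _ => pow_nonneg (W0 x) 6) g0 fun x _ => le_of_eq (by simp only [hQ, hW]; ring)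
  have hqq : (∫ x, Q x * |q x| ∂μB) ^ 2 ≤ (∫ x, Q x ^ 2 ∂μB) ^ 1 * (∫ x, e x ∂μB) ^ 1 :=
    holder_poly (by norm_num) (by norm_num) (by norm_num) (cQ.mul cq.abs) (by fun_prop) ce
      (fun x hx => mul_nonneg (Q0 x hx) (abs_nonneg _))
      (fun x _ => sq_nonneg _) (fun x hx => (sq_nonneg _).trans (hq x hx)) fun x hx => by
        rw [mul_pow, sq_abs, pow_one, pow_one]
        exact mul_le_mul_of_nonneg_left (hq x hx) (sq_nonneg _)
  set p := ∫ x, P x ∂μB with hp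
  set r := ∫ x, Q x * |q x| ∂μB with hr
  set s := ∫ x, Q x ^ 2 ∂μB with hs
  have p0 : 0 ≤ p := integral_muB_nonneg P0
  have r0 : 0 ≤ r := integral_muB_nonneg fun x hx => mul_nonneg (Q0 x hx) (abs_nonneg _)
  have s0 : 0 ≤ s := integral_muB_nonneg fun x hx => sq_nonneg _
  have Y1 : 28 * c ^ 2 * p ≤ ε * N + ε * (28 * c ^ 2 / ε) ^ 3 * M ^ 2 := by
    refine young_poly (n := 5) (k := 3) (m := 2) (by norm_num) (by norm_num) (by positivity) hN'
      (by positivity) ε0 (by nlinarith) 3 (by norm_num) ?_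
    calc (28 * c ^ 2 * p) ^ 5 = (28 * c ^ 2) ^ 5 * p ^ 5 := by ring
      _ ≤ (28 * c ^ 2) ^ 5 * ((N ^ 3) ^ 1 * M ^ 4) := by
          refine mul_le_mul_of_nonneg_left (hpI.trans ?_) (by positivity)
          gcongr
      _ = _ := by ring
  have sA0 : 0 ≤ √A := Real.sqrt_nonneg A
  have sA1 : 1 ≤ √A := Real.one_le_sqrt.2 hA
  have sA2 : √A ^ 2 = A := Real.sq_sqrt A0.le
  have Y2 : 4 * c * r ≤ ε * N + ε * (4 * c * √A / ε) ^ 10 * M ^ 2 := by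
    refine young_poly (n := 10) (k := 9) (m := 1) (by norm_num) (by norm_num) (by positivity) hN'
      (by positivity) ε0 (by nlinarith) 10 (by norm_num) ?_
    calc (4 * c * r) ^ 10 = (4 * c) ^ 10 * (r ^ 2) ^ 5 := by ring
      _ ≤ (4 * c) ^ 10 * (s * A) ^ 5 := by
          gcongr
          refine hqq.trans ?_
          rw [pow_one, pow_one]; gcongr
      _ = (4 * c) ^ 10 * A ^ 5 * s ^ 5 := by ring
      _ ≤ (4 * c) ^ 10 * A ^ 5 * ((N ^ 3) ^ 3 * M ^ 2) := by
          refine mul_le_mul_of_nonneg_left (hqI.trans ?_) (by positivity)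
          gcongr
      _ = (4 * c) ^ 10 * (√A ^ 2) ^ 5 * ((N ^ 3) ^ 3 * M ^ 2) := by rw [sA2]
      _ = _ := by ring
  have absorb : ε * N + ε * N ≤ N0 := by
    have : ε * N + ε * N = S / (S + 1) * N0 := by rw [hε, hN]; field_simp; ring
    rw [this]
    exact mul_le_of_le_one_left N00 (by rw [div_le_one (by positivity)]; linarith)
  have i1 : Integrable (fun x => w x ^ 2 * psi x ^ n) μB := integrable_muB (by fun_prop)
  have i2 : Integrable (fun x => w x ^ 2 * (4 * n * (n - 1) * ‖x‖ ^ 2 * psi x ^ (n - 2)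
        - 10 * n * psi x ^ (n - 1) - 2 * n * psi x ^ (n - 1) * q x) - j x * psi x ^ n) μB :=
    integrable_muB (by fun_prop)
  have i3 := (integrable_muB cP).const_mul (28 * c ^ 2)
  have i4 := (integrable_muB (cQ.mul cq.abs)).const_mul (4 * c)
  have main : 2 * n * χ ^ (n - 1) * ∫ x, w x ^ 2 * psi x ^ n ∂μB +
      χ ^ n * ∫ x, (w x ^ 2 * (4 * n * (n - 1) * ‖x‖ ^ 2 * psi x ^ (n - 2)
        - 10 * n * psi x ^ (n - 1) - 2 * n * psi x ^ (n - 1) * q x) - j x * psi x ^ n) ∂μB ≤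
      28 * c ^ 2 * p + 4 * c * r - N0 := by
    rw [hp, hr, hN0, ← integral_const_mul, ← integral_const_mul, ← integral_const_mul,
      ← integral_const_mul, ← integral_add (i1.const_mul _) (i2.const_mul _)]
    have E : ∫ x, 28 * c ^ 2 * P x ∂μB + ∫ x, 4 * c * (Q x * |q x|) ∂μB - ∫ x, grad2 W x ∂μB =
      ∫ x, (28 * c ^ 2 * P x + 4 * c * (Q x * |q x|) - grad2 W x) ∂μB := by
      have e1 := integral_sub (f := fun x => 28 * c ^ 2 * P x + 4 * c * (Q x * |q x|))
        (i3.add i4) (integrable_muB cG)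
      have e2 := integral_add (f := fun x => 28 * c ^ 2 * P x) i3 i4
      simp only [Pi.mul_apply] at e2
      linarith
    rw [E]
    have cqa := cq.abs
    refine integral_muB_mono ?_ ?_ fun x hx => ?_
    · fun_prop
    · exact ((continuousOn_const.mul cP).add (continuousOn_const.mul (cQ.mul cq.abs))).sub cG
    have x1 : ‖x‖ ≤ 1 := by simpa [cB] using hx
    have := moser_pointwise hn (w := w x) (q := q x) (j := j x) (G := grad2 W x) (χ := χ)
      (P := psi x) (X := ‖x‖ ^ 2) (psi_nonneg x) (psi_le_one x) χ0 χ1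
      (pow_le_one₀ (norm_nonneg _) x1) ?_
    · exact this
    · refine (grad2_mul_psi_le hx (dw x hx) (by omega) _).trans ?_
      have y0 : 0 ≤ (χ ^ (a + 5)) ^ 2 * psi x ^ (2 * (a + 5)) := by
        have := psi_nonneg x; positivity
      have := mul_le_mul_of_nonneg_left (hj x hx) y0
      linarith
  have f1 : ε * (28 * c ^ 2 / ε) ^ 3 ≤ ε * (28 / ε) ^ 3 * c ^ 10 * A ^ 5 := by
    have e1 : ε * (28 * c ^ 2 / ε) ^ 3 = ε * (28 / ε) ^ 3 * c ^ 6 * 1 := by ring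
    rw [e1]
    gcongr
    · linarith
    · norm_num
    · exact one_le_pow₀ hA
  have f2 : ε * (4 * c * √A / ε) ^ 10 = ε * (4 / ε) ^ 10 * c ^ 10 * A ^ 5 := by
    rw [show ε * (4 * c * √A / ε) ^ 10 = ε * (4 / ε) ^ 10 * c ^ 10 * (√A ^ 2) ^ 5 by ring, sA2]
  have f3 := mul_le_mul_of_nonneg_right f1 (sq_nonneg M)
  rw [f2] at Y2
  linarith

lemma moser_step : ∃ C : ℝ, 0 < C ∧ ∀ {A : ℝ} {h ht g : E3 → ℝ → ℝ}
    {dh ddh u du : Fin 3 → E3 → ℝ → ℝ}, Sys A h ht g dh ddh u du → ∀ (k a : ℕ) (M : ℝ),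
    (∀ t ∈ Ico (-1/2:ℝ) 0, (1 + 2 * t) ^ a * ∫ x, profL (h x t) ^ (k + 1) * psi x ^ a ∂μB ≤ M) →
    ∀ t ∈ Ico (-1/2:ℝ) 0, (1 + 2 * t) ^ (2 * (a + 5)) *
      ∫ x, profL (h x t) ^ (2 * k + 1 + 1) * psi x ^ (2 * (a + 5)) ∂μB ≤
      C * (a + 5) ^ 10 * A ^ 5 * M ^ 2 := by
  obtain ⟨C, C0, key⟩ := spatial_moser
  refine ⟨C, C0, ?_⟩
  intro A h ht g dh ddh u du S k a M hM t hst
  have hA := S.one_le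
  set n := 2 * (a + 5) with hn
  have P := profL_pow_spec (2 * k + 1)
  have P1 := profL_pow_spec k
  set B := C * (a + 5) ^ 10 * A ^ 5 * M ^ 2 with hB
  have B0 : 0 ≤ B := by positivity
  have sub : ∀ s ∈ Icc (-1/2:ℝ) t, s ∈ Ioo (-1:ℝ) 0 := fun s hs =>
    ⟨by linarith [hs.1], by linarith [hs.2, hst.2]⟩
  set I : ℝ → ℝ := fun s => ∫ x, profL (h x s) ^ (2 * k + 1 + 1) * psi x ^ n ∂μB with hI
  have dY : ∀ s ∈ Icc (-1/2:ℝ) t, HasDerivAt (fun s => (1 + 2 * s) ^ n * I s) _ s := fun s hs =>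
    ((((hasDerivAt_id s).const_mul (2:ℝ)).const_add 1).pow n).mul
      (S.deriv_energy P (n := n) (by omega) (sub s hs))
  have mv := (convex_Icc (-1/2:ℝ) t).image_sub_le_mul_sub_of_deriv_le
    (f := fun s => (1 + 2 * s) ^ n * I s) (C := B)
    (fun s hs => (dY s hs).continuousAt.continuousWithinAt)
    (fun s hs => (dY s (interior_subset hs)).differentiableAt.differentiableWithinAt)
    (fun s hs => ?_) (-1/2) ⟨le_rfl, hst.1⟩ t ⟨hst.1, le_rfl⟩ hst.1
  · have e0 : (1 + 2 * (-1/2:ℝ)) ^ n = 0 := by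
      rw [show (1 + 2 * (-1/2:ℝ)) = 0 by norm_num]; exact zero_pow (by omega)
    simp only [e0, zero_mul, sub_zero] at mv
    refine mv.trans ?_
    have : t - -1/2 ≤ 1 := by linarith [hst.2]
    nlinarith
  · have hs' := interior_subset hs
    have s0 := sub s hs'
    rw [(dY s hs').deriv]
    have χ0 : 0 ≤ 1 + 2 * s := by linarith [hs'.1]
    have χ1 : 1 + 2 * s ≤ 1 := by linarith [s0.2]
    refine le_trans (le_of_eq ?_) (key a n A (1 + 2 * s) M
      (fun x => profL (h x s) ^ (k + 1)) (fun x => ((2 * k + 1 : ℕ) + 1) *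
        ((2 * k + 1 : ℕ) * profL (h x s) ^ (2 * k + 1 - 1) * profL' (h x s) ^ 2 +
          profL (h x s) ^ (2 * k + 1) * profL'' (h x s)) * ∑ i, dh i x s ^ 2)
      (fun x => ∑ i, u i x s * x i) (fun x => ∑ i, u i x s ^ 2) hn hA χ0 χ1
      ((S.cont_comp P.c2 s0).mul (S.cont_grad s0))
      (S.cont_ux s0) (S.cont_uu s0)
      (fun x hx => ContDiffAt.comp (g := fun y => profL y ^ (k + 1)) (f := fun y => h y s) x
        (P1.contDiffAt (S.pos x hx s s0)) (S.smooth x hx s s0))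
      (fun x hx => pow_nonneg (profL_nonneg (S.pos x hx s s0)) _)
      (fun x hx => ?_)
      (fun x hx => Sys.ux_sq_le u hx s) (S.energy s s0) (hM s ⟨hs'.1, s0.2⟩))
    · have e : ∀ x, (profL (h x s) ^ (k + 1)) ^ 2 = profL (h x s) ^ (2 * k + 1 + 1) := fun x => by
        rw [← pow_mul]; congr 1; ring
      simp only [e, id, hI, Pi.pow_apply]
      ring
    · rw [S.grad2_comp P1 s0 hx, ← mul_assoc]
      refine mul_le_mul_of_nonneg_right ?_ (Finset.sum_nonneg fun i _ => sq_nonneg _)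
      have hp := S.pos x hx s s0
      have l0 := profL_nonneg hp
      have l2 := sq_le_profL'' hp
      have q : 0 ≤ profL (h x s) ^ (2 * k + 1) * profL'' (h x s) :=
        mul_nonneg (pow_nonneg l0 _) ((sq_nonneg _).trans l2)
      have r : 0 ≤ profL (h x s) ^ (2 * k) * profL' (h x s) ^ 2 :=
        mul_nonneg (pow_nonneg l0 _) (sq_nonneg _)
      have e : 2 * k + 1 - 1 = 2 * k := by omega
      rw [e]
      push_cast
      have e2 : 2 * ((k + 1) * profL (h x s) ^ k * profL' (h x s)) ^ 2 =
        2 * ((k:ℝ) + 1) ^ 2 * (profL (h x s) ^ (2 * k) * profL' (h x s) ^ 2) := by ring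
      rw [e2]
      have k0 : (0:ℝ) ≤ k := k.cast_nonneg
      nlinarith [mul_nonneg k0 r, mul_nonneg (mul_nonneg k0 k0) r, mul_nonneg k0 q]

/-- a continuous function whose `L^{2^k}` norms are bounded by `T` is bounded by `T`. -/
lemma le_of_integral_pow_le {f : E3 → ℝ} {T : ℝ} (hf : ContinuousOn f cB)
    (f0 : ∀ x ∈ cB, 0 ≤ f x) (hT : 0 ≤ T) (H : ∀ k : ℕ, ∫ x, f x ^ 2 ^ k ∂μB ≤ T ^ 2 ^ k)
    {x : E3} (hx : x ∈ Metric.ball (0:E3) 1) : f x ≤ T := by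
  by_contra! hlt
  obtain ⟨s, hTs, hsf⟩ := exists_between hlt
  have s0 : 0 < s := hT.trans_lt hTs
  have hc : ContinuousAt f x := hf.continuousAt
    (Filter.mem_of_superset (Metric.isOpen_ball.mem_nhds hx) Metric.ball_subset_closedBall)
  obtain ⟨W, hW, Wo, xW⟩ := eventually_nhds_iff.1
    ((hc.eventually_const_lt hsf).and (Metric.isOpen_ball.mem_nhds hx))
  have : IsFiniteMeasure μB := ⟨by
    rw [Measure.restrict_apply_univ]; exact measure_ball_lt_top⟩
  have V0 : 0 < μB.real W := by
    have e : μB W = volume W := Measure.restrict_eq_self _ fun y hy => (hW y hy).2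
    refine ENNReal.toReal_pos (by rw [e]; exact (Wo.measure_pos volume ⟨x, xW⟩).ne') ?_
    exact measure_ne_top μB W
  have key : ∀ k : ℕ, μB.real W ≤ (T / s) ^ 2 ^ k := by
    intro k
    have i := integrable_muB (f := fun x => f x ^ 2 ^ k) (hf.pow _)
    have m := mul_meas_ge_le_integral_of_nonneg (μ := μB) (f := fun x => f x ^ 2 ^ k)
      ((ae_restrict_mem Metric.isOpen_ball.measurableSet).mono fun y hy =>
        pow_nonneg (f0 y (Metric.ball_subset_closedBall hy)) _) i (s ^ 2 ^ k)
    have m2 : μB.real W ≤ μB.real {y | s ^ 2 ^ k ≤ f y ^ 2 ^ k} :=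
      measureReal_mono fun y hy => pow_le_pow_left₀ s0.le (hW y hy).1.le _
    rw [div_pow, le_div_iff₀ (by positivity), mul_comm]
    exact (mul_le_mul_of_nonneg_left m2 (by positivity)).trans (m.trans (H k))
  have r1 : T / s < 1 := (div_lt_one s0).2 hTs
  have lim : Tendsto (fun k : ℕ => (T / s) ^ 2 ^ k) atTop (𝓝 0) :=
    (tendsto_pow_atTop_nhds_zero_of_lt_one (by positivity) r1).comp
      (tendsto_pow_atTop_atTop_of_one_lt one_lt_two)
  have := ge_of_tendsto' lim key
  linarith

lemma moser_iterate : ∃ C : ℝ, 0 < C ∧ ∀ {A : ℝ} {h ht g : E3 → ℝ → ℝ}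
    {dh ddh u du : Fin 3 → E3 → ℝ → ℝ}, Sys A h ht g dh ddh u du → ∀ t ∈ Ico (-1/2:ℝ) 0,
    ∀ x ∈ Metric.ball (0:E3) 1, profL (h x t) * (psi x * (1 + 2 * t)) ^ 14 ≤ C * A ^ 6 := by
  obtain ⟨C₁, C10, step⟩ := moser_step
  obtain ⟨C₂, C20, start⟩ := log_mean_upper
  refine ⟨(C₁ + 1) * 14 ^ 10 * 1024 * C₂, by positivity, ?_⟩
  intro A h ht g dh ddh u du S t hst
  have hA := S.one_le
  have A0 : 0 < A := by linarith
  set E := (C₁ + 1) * 14 ^ 10 * A ^ 5 with hE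
  have A5 : 1 ≤ A ^ 5 := one_le_pow₀ hA
  have E1 : 1 ≤ E := by
    have : 1 ≤ (C₁ + 1) * 14 ^ 10 := by linarith
    exact one_le_mul_of_one_le_of_one_le this A5
  set T := (C₁ + 1) * 14 ^ 10 * 1024 * C₂ * A ^ 6 with hT
  have T0 : 0 < T := by positivity
  have main : ∀ k : ℕ, ∃ a p : ℕ, a + 10 = 14 * 2 ^ k ∧ p + 1 = 2 ^ k ∧ ∀ t ∈ Ico (-1/2:ℝ) 0,
      (1 + 2 * t) ^ a * ∫ x, profL (h x t) ^ (p + 1) * psi x ^ a ∂μB ≤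
        T ^ 2 ^ k / (E * 1024 ^ (k + 1)) := by
    intro k
    induction k with
    | zero =>
      refine ⟨4, 0, by norm_num, by norm_num, fun s hs => ?_⟩
      have e : T ^ 2 ^ 0 / (E * 1024 ^ (0 + 1)) = C₂ * A := by
        rw [hT, hE]; field_simp; ring
      rw [e]
      have s0 : 0 ≤ 1 + 2 * s := by linarith [hs.1]
      have s1 : (1 + 2 * s) ^ 4 ≤ 1 := pow_le_one₀ s0 (by linarith [hs.2])
      have := start S s hs
      simp only [zero_add, pow_one]
      nlinarith [pow_nonneg s0 4, mul_pos C20 A0]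
    | succ k ih =>
      obtain ⟨a, p, ha, hp, H⟩ := ih
      refine ⟨2 * (a + 5), 2 * p + 1, by rw [pow_succ]; omega, by rw [pow_succ]; omega,
        fun s hs => ?_⟩
      refine (step S p a _ H s hs).trans ?_
      have a5 : ((a:ℝ) + 5) ^ 10 ≤ 14 ^ 10 * 1024 ^ k := by
        have : (a:ℝ) + 5 ≤ 14 * 2 ^ k := by
          have : a + 5 ≤ 14 * 2 ^ k := by omega
          exact_mod_cast this
        calc ((a:ℝ) + 5) ^ 10 ≤ (14 * 2 ^ k) ^ 10 := pow_le_pow_left₀ (by positivity) this _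
          _ = _ := by rw [mul_pow, ← pow_mul, mul_comm k, pow_mul]; norm_num
      set M := T ^ 2 ^ k / (E * 1024 ^ (k + 1)) with hM
      calc C₁ * (a + 5) ^ 10 * A ^ 5 * M ^ 2 ≤ (C₁ + 1) * (14 ^ 10 * 1024 ^ k) * A ^ 5 * M ^ 2 := by
            gcongr; linarith
        _ = E * 1024 ^ k * M ^ 2 := by rw [hE]; ring
        _ = T ^ 2 ^ (k + 1) / (E * 1024 ^ (k + 1 + 1)) := by
            rw [hM, div_pow, pow_succ 2 k, pow_mul, mul_pow]
            have : E ≠ 0 := by positivity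
            field_simp
            ring
  have hpc := psi_continuous
  have t0 : t ∈ Ioo (-1:ℝ) 0 := ⟨by linarith [hst.1], hst.2⟩
  have χ0 : 0 ≤ 1 + 2 * t := by linarith [hst.1]
  have χ1 : 1 + 2 * t ≤ 1 := by linarith [hst.2]
  have cv := S.cont_comp profL_spec.c0 t0
  have L0 : ∀ x ∈ cB, 0 ≤ profL (h x t) := fun x hx => profL_nonneg (S.pos x hx t t0)
  have y0 : ∀ x, 0 ≤ psi x * (1 + 2 * t) := fun x => mul_nonneg (psi_nonneg x) χ0
  intro x hx
  refine le_of_integral_pow_le (f := fun x => profL (h x t) * (psi x * (1 + 2 * t)) ^ 14)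
    (cv.mul (by fun_prop)) (fun x hx => mul_nonneg (L0 x hx) (pow_nonneg (y0 x) _)) T0.le ?_ hx
  intro k
  obtain ⟨a, p, ha, hp, H⟩ := main k
  have den : 1 ≤ E * 1024 ^ (k + 1) :=
    one_le_mul_of_one_le_of_one_le E1 (one_le_pow₀ (by norm_num))
  refine le_trans ?_ ((H t hst).trans (div_le_self (by positivity) den))
  rw [← integral_const_mul]
  have cL : ContinuousOn (fun x => profL (h x t) ^ (p + 1)) cB := cv.pow _
  refine integral_muB_mono (by fun_prop) (by fun_prop) fun x hx => ?_
  rw [mul_pow, ← pow_mul, ← ha, ← hp]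
  have : (psi x * (1 + 2 * t)) ^ (a + 10) ≤ (psi x * (1 + 2 * t)) ^ a :=
    pow_le_pow_of_le_one (y0 x) (mul_le_one₀ (psi_le_one x) χ0 χ1) (by omega)
  calc _ ≤ profL (h x t) ^ (p + 1) * (psi x * (1 + 2 * t)) ^ a :=
        mul_le_mul_of_nonneg_left this (pow_nonneg (L0 x hx) _)
    _ = _ := by rw [mul_pow]; ring

/-- quantitative strong positivity for `Sys`. -/
lemma lower_bound : ∃ C : ℝ, 0 < C ∧ ∀ {A : ℝ} {h ht g : E3 → ℝ → ℝ}
    {dh ddh u du : Fin 3 → E3 → ℝ → ℝ}, Sys A h ht g dh ddh u du → ∀ t ∈ Ico (-1/4:ℝ) 0,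
    ∀ x ∈ Metric.ball (0:E3) (1/2), Real.exp (-(C * A ^ 6)) / 6 ≤ h x t := by
  obtain ⟨C, C0, key⟩ := moser_iterate
  refine ⟨3 ^ 14 * C, by positivity, ?_⟩
  intro A h ht g dh ddh u du S t hst x hx
  have t0 : t ∈ Ioo (-1:ℝ) 0 := ⟨by linarith [hst.1], hst.2⟩
  have hx1 : x ∈ Metric.ball (0:E3) 1 := Metric.ball_subset_ball (by norm_num) hx
  have hxc : x ∈ cB := Metric.ball_subset_closedBall hx1
  have h0 := S.pos x hxc t t0
  have L0 := profL_nonneg h0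
  have k := key S t ⟨by linarith [hst.1], hst.2⟩ x hx1
  have hn : ‖x‖ < 1 / 2 := by simpa using hx
  have hψ : 1 / 3 ≤ psi x * (1 + 2 * t) := by
    rw [psi_eq hxc]
    have : 3 / 4 ≤ 1 - ‖x‖ ^ 2 := by nlinarith [norm_nonneg x]
    have : 1 / 2 ≤ 1 + 2 * t := by linarith [hst.1]
    nlinarith
  have hp : (1 / 3 : ℝ) ^ 14 ≤ (psi x * (1 + 2 * t)) ^ 14 := pow_le_pow_left₀ (by norm_num) hψ _
  have : profL (h x t) * (1 / 3 : ℝ) ^ 14 ≤ C * A ^ 6 :=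
    (mul_le_mul_of_nonneg_left hp L0).trans k
  have hL : profL (h x t) ≤ 3 ^ 14 * C * A ^ 6 := by
    have e : profL (h x t) = 3 ^ 14 * (profL (h x t) * (1 / 3 : ℝ) ^ 14) := by ring
    rw [e, mul_assoc]
    exact mul_le_mul_of_nonneg_left this (by positivity)
  have := one_sub_prof1_le h0
  rw [← exp_neg_profL h0] at this
  have e := Real.exp_le_exp.2 (neg_le_neg hL)
  rw [div_le_iff₀ (by norm_num)]
  linarith

/-- spatial partial derivative of a function on space-time. -/
def dX (i : Fin 3) (f : E3 × ℝ → ℝ) (z : E3 × ℝ) : ℝ := fderiv ℝ f z (ee i, 0)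

/-- time derivative of a function on space-time. -/
def dT (f : E3 × ℝ → ℝ) (z : E3 × ℝ) : ℝ := fderiv ℝ f z (0, 1)

section spacetime
variable {U : Set (E3 × ℝ)} {f f₁ f₂ : E3 × ℝ → ℝ} {z : E3 × ℝ}

lemma contDiffOn_dX (hU : IsOpen U) (hf : ContDiffOn ℝ (⊤ : ℕ∞) f U) (i : Fin 3) :
    ContDiffOn ℝ (⊤ : ℕ∞) (dX i f) U :=
  (hf.fderiv_of_isOpen hU (m := (⊤ : ℕ∞)) (by simp)).clm_apply contDiffOn_const

lemma contDiffOn_dT (hU : IsOpen U) (hf : ContDiffOn ℝ (⊤ : ℕ∞) f U) :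
    ContDiffOn ℝ (⊤ : ℕ∞) (dT f) U :=
  (hf.fderiv_of_isOpen hU (m := (⊤ : ℕ∞)) (by simp)).clm_apply contDiffOn_const

lemma differentiableAt_of_smooth (hU : IsOpen U) (hf : ContDiffOn ℝ (⊤ : ℕ∞) f U) (hz : z ∈ U) :
    DifferentiableAt ℝ f z :=
  (hf.contDiffAt (hU.mem_nhds hz)).differentiableAt (by simp)

lemma pd_slice {x : E3} {t : ℝ} (hf : DifferentiableAt ℝ f (x, t)) (i : Fin 3) :
    pd (fun y => f (y, t)) i x = dX i f (x, t) := by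
  have h1 : HasFDerivAt (fun y : E3 => (y, t)) (ContinuousLinearMap.inl ℝ E3 ℝ) x :=
    hasFDerivAt_prodMk_left x t
  have := (hf.hasFDerivAt.comp x h1).fderiv
  unfold pd dX
  rw [show (fun y => f (y, t)) = f ∘ fun y => (y, t) from rfl, this]
  simp

lemma deriv_slice {x : E3} {t : ℝ} (hf : DifferentiableAt ℝ f (x, t)) :
    deriv (fun s => f (x, s)) t = dT f (x, t) := by
  have h1 : HasFDerivAt (fun s : ℝ => (x, s)) (ContinuousLinearMap.inr ℝ E3 ℝ) t :=
    hasFDerivAt_prodMk_right x t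
  have := (hf.hasFDerivAt.comp t h1).hasDerivAt.deriv
  unfold dT
  rw [show (fun y => f (x, y)) = f ∘ fun y => (x, y) from rfl, this]
  simp

lemma dX_congr (hU : IsOpen U) (hz : z ∈ U) (h : ∀ y ∈ U, f₁ y = f₂ y) (i : Fin 3) :
    dX i f₁ z = dX i f₂ z := by
  unfold dX
  rw [Filter.EventuallyEq.fderiv_eq (Filter.mem_of_superset (hU.mem_nhds hz) h)]

lemma lap_slice (hU : IsOpen U) (hf : ContDiffOn ℝ (⊤ : ℕ∞) f U) {x : E3} {t : ℝ}
    (hz : (x, t) ∈ U) : lap (fun y => f (y, t)) x = ∑ i, dX i (dX i f) (x, t) := by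
  unfold lap
  refine Finset.sum_congr rfl fun i _ => ?_
  rw [← pd_slice (differentiableAt_of_smooth hU (contDiffOn_dX hU hf i) hz) i]
  have : (fun y => pd (fun y => f (y, t)) i y) =ᶠ[𝓝 x] fun y => dX i f (y, t) := by
    have c : ContinuousAt (fun y : E3 => (y, t)) x := by fun_prop
    filter_upwards [c (hU.mem_nhds hz)] with y hy
    exact pd_slice (differentiableAt_of_smooth hU hf hy) i
  unfold pd at this ⊢
  rw [this.fderiv_eq]

lemma dX_add (h1 : DifferentiableAt ℝ f₁ z) (h2 : DifferentiableAt ℝ f₂ z) (i : Fin 3) :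
    dX i (fun y => f₁ y + f₂ y) z = dX i f₁ z + dX i f₂ z := by
  unfold dX; rw [fderiv_fun_add h1 h2]; simp

lemma dX_sub (h1 : DifferentiableAt ℝ f₁ z) (h2 : DifferentiableAt ℝ f₂ z) (i : Fin 3) :
    dX i (fun y => f₁ y - f₂ y) z = dX i f₁ z - dX i f₂ z := by
  unfold dX; rw [fderiv_fun_sub h1 h2]; simp

lemma dX_const_mul (h1 : DifferentiableAt ℝ f z) (c : ℝ) (i : Fin 3) :
    dX i (fun y => c * f y) z = c * dX i f z := by
  unfold dX; rw [fderiv_const_mul h1]; simp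

lemma dX_coord_mul (h1 : DifferentiableAt ℝ f z) (i j : Fin 3) :
    dX i (fun y => y.1 j * f y) z = (if i = j then 1 else 0) * f z + z.1 j * dX i f z := by
  have hc : HasFDerivAt (fun y : E3 × ℝ => y.1 j)
      ((EuclideanSpace.proj j : E3 →L[ℝ] ℝ).comp (ContinuousLinearMap.fst ℝ E3 ℝ)) z :=
    ((EuclideanSpace.proj j : E3 →L[ℝ] ℝ).comp (ContinuousLinearMap.fst ℝ E3 ℝ)).hasFDerivAt
  unfold dX
  rw [fderiv_fun_mul hc.differentiableAt h1, hc.fderiv]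
  simp [ee, eq_comm]
  ring

lemma dT_sub (h1 : DifferentiableAt ℝ f₁ z) (h2 : DifferentiableAt ℝ f₂ z) :
    dT (fun y => f₁ y - f₂ y) z = dT f₁ z - dT f₂ z := by
  unfold dT; rw [fderiv_fun_sub h1 h2]; simp

lemma dT_coord_mul (h1 : DifferentiableAt ℝ f z) (j : Fin 3) :
    dT (fun y => y.1 j * f y) z = z.1 j * dT f z := by
  have hc : HasFDerivAt (fun y : E3 × ℝ => y.1 j)
      ((EuclideanSpace.proj j : E3 →L[ℝ] ℝ).comp (ContinuousLinearMap.fst ℝ E3 ℝ)) z :=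
    ((EuclideanSpace.proj j : E3 →L[ℝ] ℝ).comp (ContinuousLinearMap.fst ℝ E3 ℝ)).hasFDerivAt
  unfold dT
  rw [fderiv_fun_mul hc.differentiableAt h1, hc.fderiv]
  simp

/-- rotation by the angle `a` about the vertical axis. -/
def rot (a : ℝ) (x : E3) : E3 :=
  (Real.cos a * x 0 - Real.sin a * x 1) • ee 0 + (Real.sin a * x 0 + Real.cos a * x 1) • ee 1
    + x 2 • ee 2

lemma rot_apply_zero (a : ℝ) (x : E3) : rot a x 0 = Real.cos a * x 0 - Real.sin a * x 1 := by
  simp [rot, ee]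

lemma rot_apply_one (a : ℝ) (x : E3) : rot a x 1 = Real.sin a * x 0 + Real.cos a * x 1 := by
  simp [rot, ee]

lemma rot_apply_two (a : ℝ) (x : E3) : rot a x 2 = x 2 := by
  simp [rot, ee]

lemma rot_zero (x : E3) : rot 0 x = x := by
  ext i; fin_cases i <;> simp [rot, ee]

lemma hasDerivAt_rot (x : E3) : HasDerivAt (fun a => rot a x) (x 0 • ee 1 - x 1 • ee 0) 0 := by
  have hs := Real.hasDerivAt_sin 0
  have hc := Real.hasDerivAt_cos 0
  have h := ((((hc.mul_const (x 0)).sub (hs.mul_const (x 1))).smul_const (ee 0)).add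
    (((hs.mul_const (x 0)).add (hc.mul_const (x 1))).smul_const (ee 1))).add_const (x 2 • ee 2)
  refine (h.congr_deriv ?_).congr_of_eventuallyEq (Eventually.of_forall fun a => rfl)
  simp [sub_eq_neg_add]

lemma angular_deriv {x : E3} {t p q : ℝ} (hf : DifferentiableAt ℝ f (x, t))
    (h : ∀ᶠ a in 𝓝 (0:ℝ), f (rot a x, t) = Real.cos a * p + Real.sin a * q) :
    x 0 * dX 1 f (x, t) - x 1 * dX 0 f (x, t) = q := by
  have h1 : HasDerivAt (fun a => (rot a x, t)) (x 0 • ee 1 - x 1 • ee 0, (0:ℝ)) 0 :=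
    (hasDerivAt_rot x).prodMk (hasDerivAt_const _ _)
  have hf' : HasFDerivAt f (fderiv ℝ f (x, t)) (rot 0 x, t) := by
    rw [rot_zero]; exact hf.hasFDerivAt
  have h2 := hf'.comp_hasDerivAt (0:ℝ) h1
  have h3 : HasDerivAt (fun a => Real.cos a * p + Real.sin a * q) q 0 := by
    exact (((Real.hasDerivAt_cos 0).mul_const p).add
      ((Real.hasDerivAt_sin 0).mul_const q)).congr_deriv (by simp)
  have h4 := h2.unique (h3.congr_of_eventuallyEq h)
  rw [← h4]
  have e : (x 0 • ee 1 - x 1 • ee 0, (0:ℝ)) = x 0 • (ee 1, (0:ℝ)) - x 1 • (ee 0, (0:ℝ)) := by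
    simp
  rw [e, map_sub, map_smul, map_smul]
  rfl

lemma eventually_rot_mem (hU : IsOpen U) {x : E3} {t : ℝ} (hz : (x, t) ∈ U) :
    ∀ᶠ a in 𝓝 (0:ℝ), (rot a x, t) ∈ U := by
  have h1 : ContinuousAt (fun a => (rot a x, t)) 0 :=
    ((hasDerivAt_rot x).prodMk (hasDerivAt_const _ _)).continuousAt
  exact h1 (hU.mem_nhds (by simpa [rot_zero] using hz))

end spacetime

/-- components of the velocity as functions on space-time. -/
def vel (u : E3 → ℝ → E3) (i : Fin 3) (z : E3 × ℝ) : ℝ := u z.1 z.2 i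

/-- the swirl `Γ` as a function on space-time. -/
def swirl (u : E3 → ℝ → E3) (z : E3 × ℝ) : ℝ := z.1 0 * vel u 1 z - z.1 1 * vel u 0 z

/-- vertical component of the vorticity. -/
def vort (u : E3 → ℝ → E3) (z : E3 × ℝ) : ℝ := dX 0 (vel u 1) z - dX 1 (vel u 0) z

section flow
variable {u : E3 → ℝ → E3} {P : E3 → ℝ → ℝ} {U : Set (E3 × ℝ)}

lemma eq_zero_of_off_axis {F : E3 × ℝ → ℝ} (hU : IsOpen U) (hF : ContinuousOn F U)
    (h : ∀ z ∈ U, z.1 0 ^ 2 + z.1 1 ^ 2 ≠ 0 → F z = 0) {z : E3 × ℝ} (hz : z ∈ U) : F z = 0 := by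
  by_cases hr : z.1 0 ^ 2 + z.1 1 ^ 2 = 0
  swap
  · exact h z hz hr
  have h0 : z.1 0 = 0 := by nlinarith [sq_nonneg (z.1 0), sq_nonneg (z.1 1)]
  have h1 : z.1 1 = 0 := by nlinarith [sq_nonneg (z.1 0), sq_nonneg (z.1 1)]
  have c1 : Continuous (fun a : ℝ => (z.1 + a • ee 0, z.2)) := by fun_prop
  have e0 : (z.1 + (0:ℝ) • ee 0, z.2) = z := by simp
  have c2 : Tendsto (fun a : ℝ => F (z.1 + a • ee 0, z.2)) (𝓝[≠] 0) (𝓝 (F z)) := by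
    have : ContinuousAt F (z.1 + (0:ℝ) • ee 0, z.2) := by
      rw [e0]; exact hF.continuousAt (hU.mem_nhds hz)
    have := this.comp (f := fun a : ℝ => (z.1 + a • ee 0, z.2)) c1.continuousAt
    have t := this.tendsto
    simp only [Function.comp_def, e0] at t
    exact t.mono_left nhdsWithin_le_nhds
  refine tendsto_nhds_unique c2 (tendsto_const_nhds.congr' ?_)
  have ev : ∀ᶠ a in 𝓝 (0:ℝ), (z.1 + a • ee 0, z.2) ∈ U :=
    c1.continuousAt (hU.mem_nhds (by rw [e0]; exact hz))
  filter_upwards [ev.filter_mono nhdsWithin_le_nhds, self_mem_nhdsWithin] with a ha hne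
  refine (h _ ha ?_).symm
  have : (a:ℝ) ≠ 0 := hne
  simp [ee, h0, h1, this]

namespace IsNSQ1

lemma smooth_vel (N : IsNSQ1 u P U) (i : Fin 3) : ContDiffOn ℝ (⊤ : ℕ∞) (vel u i) U :=
  (EuclideanSpace.proj i : E3 →L[ℝ] ℝ).contDiff.comp_contDiffOn N.smooth_u

lemma diff_vel (N : IsNSQ1 u P U) (i : Fin 3) {z : E3 × ℝ} (hz : z ∈ U) :
    DifferentiableAt ℝ (vel u i) z := differentiableAt_of_smooth N.open_U (N.smooth_vel i) hz

lemma smooth_dX_vel (N : IsNSQ1 u P U) (j i : Fin 3) :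
    ContDiffOn ℝ (⊤ : ℕ∞) (dX j (vel u i)) U := contDiffOn_dX N.open_U (N.smooth_vel i) j

lemma diff_dX_vel (N : IsNSQ1 u P U) (j i : Fin 3) {z : E3 × ℝ} (hz : z ∈ U) :
    DifferentiableAt ℝ (dX j (vel u i)) z :=
  differentiableAt_of_smooth N.open_U (N.smooth_dX_vel j i) hz

lemma momentum_vel (N : IsNSQ1 u P U) (j : Fin 3) {z : E3 × ℝ} (hz : z ∈ U) :
    dT (vel u j) z + ∑ i, vel u i z * dX i (vel u j) z - ∑ i, dX i (dX i (vel u j)) z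
      + dX j (fun z => P z.1 z.2) z = 0 := by
  obtain ⟨x, t⟩ := z
  have := N.momentum x t hz j
  have e1 := deriv_slice (N.diff_vel j hz)
  have e2 := fun i => pd_slice (N.diff_vel j hz) i
  have e3 := lap_slice N.open_U (N.smooth_vel j) hz
  have e4 := pd_slice (differentiableAt_of_smooth N.open_U N.smooth_P hz) j
  simp only [vel] at e1 e2 e3
  simp only at e4
  rw [e1, e3, e4] at this
  simp only [e2] at this
  exact this

lemma div_vel (N : IsNSQ1 u P U) {z : E3 × ℝ} (hz : z ∈ U) : ∑ i, dX i (vel u i) z = 0 := by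
  obtain ⟨x, t⟩ := z
  rw [← N.divfree x t hz]
  exact Finset.sum_congr rfl fun i _ => (pd_slice (N.diff_vel i hz) i).symm

lemma smooth_swirl (N : IsNSQ1 u P U) : ContDiffOn ℝ (⊤ : ℕ∞) (swirl u) U := by
  have hc : ∀ j : Fin 3, ContDiff ℝ (⊤ : ℕ∞) (fun y : E3 × ℝ => y.1 j) := fun j =>
    ((EuclideanSpace.proj j : E3 →L[ℝ] ℝ).comp (ContinuousLinearMap.fst ℝ E3 ℝ)).contDiff
  exact ((hc 0).contDiffOn.mul (N.smooth_vel 1)).sub ((hc 1).contDiffOn.mul (N.smooth_vel 0))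

lemma dX_swirl (N : IsNSQ1 u P U) (i : Fin 3) {z : E3 × ℝ} (hz : z ∈ U) :
    dX i (swirl u) z = ((if i = 0 then 1 else 0) * vel u 1 z + z.1 0 * dX i (vel u 1) z)
      - ((if i = 1 then 1 else 0) * vel u 0 z + z.1 1 * dX i (vel u 0) z) := by
  have d1 := N.diff_vel 1 hz
  have d0 := N.diff_vel 0 hz
  have e1 := dX_sub (f₁ := fun y => y.1 0 * vel u 1 y) (f₂ := fun y => y.1 1 * vel u 0 y)
    (z := z) (by fun_prop) (by fun_prop) i
  rw [dX_coord_mul d1, dX_coord_mul d0] at e1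
  exact e1

lemma dXX_swirl (N : IsNSQ1 u P U) (i : Fin 3) {z : E3 × ℝ} (hz : z ∈ U) :
    dX i (dX i (swirl u)) z = (2 * (if i = 0 then 1 else 0) * dX i (vel u 1) z
        + z.1 0 * dX i (dX i (vel u 1)) z)
      - (2 * (if i = 1 then 1 else 0) * dX i (vel u 0) z + z.1 1 * dX i (dX i (vel u 0)) z) := by
  have d1 := N.diff_vel 1 hz
  have d0 := N.diff_vel 0 hz
  have d11 := N.diff_dX_vel i 1 hz
  have d00 := N.diff_dX_vel i 0 hz
  rw [dX_congr N.open_U hz (fun y hy => N.dX_swirl i hy) i,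
    dX_sub (by fun_prop) (by fun_prop), dX_add (by fun_prop) (by fun_prop),
    dX_add (by fun_prop) (by fun_prop), dX_const_mul d1, dX_const_mul d0, dX_coord_mul d11,
    dX_coord_mul d00]
  ring

lemma angular_vel (N : IsNSQ1 u P U) (X : IsAxisym u P U) {z : E3 × ℝ} (hz : z ∈ U) :
    z.1 0 * dX 1 (vel u 0) z - z.1 1 * dX 0 (vel u 0) z + vel u 1 z = 0 ∧
    z.1 0 * dX 1 (vel u 1) z - z.1 1 * dX 0 (vel u 1) z - vel u 0 z = 0 := by
  obtain ⟨ur, uθ, u3, pp, H⟩ := X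
  have cc : ∀ j : Fin 3, ContinuousOn (fun y : E3 × ℝ => y.1 j) U := fun j => by fun_prop
  have c := fun i => (N.smooth_vel i).continuousOn
  have cd := fun j i => (N.smooth_dX_vel j i).continuousOn
  have key : ∀ z ∈ U, z.1 0 ^ 2 + z.1 1 ^ 2 ≠ 0 → ∀ᶠ a in 𝓝 (0:ℝ),
      vel u 0 (rot a z.1, z.2) = Real.cos a * vel u 0 z + Real.sin a * (- vel u 1 z) ∧
      vel u 1 (rot a z.1, z.2) = Real.cos a * vel u 1 z + Real.sin a * vel u 0 z := by
    rintro ⟨x, t⟩ hz hr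
    simp only at hr
    filter_upwards [eventually_rot_mem N.open_U hz] with a ha
    have er : (rot a x 0) ^ 2 + (rot a x 1) ^ 2 = x 0 ^ 2 + x 1 ^ 2 := by
      rw [rot_apply_zero, rot_apply_one]
      linear_combination (x 0 ^ 2 + x 1 ^ 2) * Real.sin_sq_add_cos_sq a
    obtain ⟨a0, a1, -, -⟩ := H x t hz hr
    obtain ⟨b0, b1, -, -⟩ := H (rot a x) t ha (by rw [er]; exact hr)
    rw [er, rot_apply_two] at b0 b1
    rw [rot_apply_zero, rot_apply_one] at b0 b1
    simp only [vel]
    rw [a0, a1, b0, b1]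
    constructor <;> ring
  constructor
  · refine eq_zero_of_off_axis (F := fun z => z.1 0 * dX 1 (vel u 0) z - z.1 1 * dX 0 (vel u 0) z
      + vel u 1 z) N.open_U ((((cc 0).mul (cd 1 0)).sub ((cc 1).mul (cd 0 0))).add (c 1)) ?_ hz
    intro z hz hr
    have := angular_deriv (N.diff_vel 0 hz) ((key z hz hr).mono fun a h => h.1)
    simp only at this ⊢
    linarith
  · refine eq_zero_of_off_axis (F := fun z => z.1 0 * dX 1 (vel u 1) z - z.1 1 * dX 0 (vel u 1) z
      - vel u 0 z) N.open_U ((((cc 0).mul (cd 1 1)).sub ((cc 1).mul (cd 0 1))).sub (c 0)) ?_ hz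
    intro z hz hr
    have := angular_deriv (N.diff_vel 1 hz) ((key z hz hr).mono fun a h => h.2)
    simp only at this ⊢
    linarith

lemma angular_pressure (N : IsNSQ1 u P U) (X : IsAxisym u P U) {z : E3 × ℝ} (hz : z ∈ U) :
    z.1 0 * dX 1 (fun z => P z.1 z.2) z - z.1 1 * dX 0 (fun z => P z.1 z.2) z = 0 := by
  obtain ⟨ur, uθ, u3, pp, H⟩ := X
  by_cases hr : z.1 0 ^ 2 + z.1 1 ^ 2 = 0
  · have h0 : z.1 0 = 0 := by nlinarith [sq_nonneg (z.1 0), sq_nonneg (z.1 1)]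
    have h1 : z.1 1 = 0 := by nlinarith [sq_nonneg (z.1 0), sq_nonneg (z.1 1)]
    rw [h0, h1]; ring
  obtain ⟨x, t⟩ := z
  simp only at hr ⊢
  have d := differentiableAt_of_smooth N.open_U N.smooth_P hz
  have dd : DifferentiableAt ℝ (fun z : E3 × ℝ => P z.1 z.2 - P x t) (x, t) := d.sub_const _
  have := angular_deriv (p := 0) (q := 0) dd ?_
  · unfold dX at this ⊢
    rwa [fderiv_sub_const] at this
  filter_upwards [eventually_rot_mem N.open_U hz] with a ha
  have er : (rot a x 0) ^ 2 + (rot a x 1) ^ 2 = x 0 ^ 2 + x 1 ^ 2 := by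
    rw [rot_apply_zero, rot_apply_one]
    linear_combination (x 0 ^ 2 + x 1 ^ 2) * Real.sin_sq_add_cos_sq a
  obtain ⟨-, -, -, a0⟩ := H x t hz hr
  obtain ⟨-, -, -, b0⟩ := H (rot a x) t ha (by rw [er]; exact hr)
  rw [er, rot_apply_two] at b0
  simp only [a0, b0]
  ring

lemma swirl_eqn (N : IsNSQ1 u P U) (X : IsAxisym u P U) {z : E3 × ℝ} (hz : z ∈ U) :
    dT (swirl u) z + ∑ i, vel u i z * dX i (swirl u) z - ∑ i, dX i (dX i (swirl u)) z
      + 2 * vort u z = 0 := by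
  have d1 := N.diff_vel 1 hz
  have d0 := N.diff_vel 0 hz
  have et : dT (swirl u) z = z.1 0 * dT (vel u 1) z - z.1 1 * dT (vel u 0) z := by
    have e1 := dT_sub (f₁ := fun y => y.1 0 * vel u 1 y) (f₂ := fun y => y.1 1 * vel u 0 y)
      (z := z) (by fun_prop) (by fun_prop)
    rw [dT_coord_mul d1, dT_coord_mul d0] at e1
    exact e1
  have m0 := N.momentum_vel 0 hz
  have m1 := N.momentum_vel 1 hz
  have p := N.angular_pressure X hz
  rw [et]
  simp only [N.dX_swirl _ hz, N.dXX_swirl _ hz, Fin.sum_univ_three, vort] at m0 m1 ⊢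
  simp
  linear_combination z.1 0 * m1 - z.1 1 * m0 - p

lemma swirl_axis0 (N : IsNSQ1 u P U) (X : IsAxisym u P U) {z : E3 × ℝ} (hz : z ∈ U) :
    dX 0 (swirl u) z = z.1 0 * vort u z := by
  rw [N.dX_swirl 0 hz, vort]
  simp
  linear_combination (N.angular_vel X hz).1

lemma swirl_axis1 (N : IsNSQ1 u P U) (X : IsAxisym u P U) {z : E3 × ℝ} (hz : z ∈ U) :
    dX 1 (swirl u) z = z.1 1 * vort u z := by
  rw [N.dX_swirl 1 hz, vort]
  simp
  linear_combination (N.angular_vel X hz).2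

end IsNSQ1
end flow

/-- parabolic rescaling of the unit cylinder to the cylinder of radius `R` at `(x₀, t₀)`. -/
def scl (x₀ : E3) (t₀ R : ℝ) (x : E3) (t : ℝ) : E3 × ℝ := (x₀ + R • x, t₀ + R ^ 2 * t)

section scaling
variable {x₀ : E3} {t₀ R : ℝ}

lemma continuous_scl : Continuous fun z : E3 × ℝ => scl x₀ t₀ R z.1 z.2 := by
  unfold scl; fun_prop

lemma scl_mem (hR : 0 < R) {x : E3} (hx : x ∈ cB) {t : ℝ} (ht : t ∈ Ioo (-1:ℝ) 0) :
    scl x₀ t₀ R x t ∈ Metric.closedBall x₀ R ×ˢ Ioo (t₀ - R ^ 2) t₀ := by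
  have hx' : ‖x‖ ≤ 1 := by simpa using hx
  have R2 : 0 < R ^ 2 := by positivity
  refine ⟨?_, ?_, ?_⟩
  · simp only [scl, mem_closedBall_iff_norm, add_sub_cancel_left, norm_smul, Real.norm_eq_abs,
      abs_of_pos hR]
    nlinarith
  · simp only [scl]; nlinarith [ht.1]
  · simp only [scl]; nlinarith [ht.2]

lemma hasLineDerivAt_scl {f : E3 × ℝ → ℝ} {x : E3} {t : ℝ}
    (hf : DifferentiableAt ℝ f (scl x₀ t₀ R x t)) (i : Fin 3) :
    HasLineDerivAt ℝ (fun y => f (scl x₀ t₀ R y t)) (R * dX i f (scl x₀ t₀ R x t)) x (ee i) := by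
  unfold HasLineDerivAt
  have h1 : HasDerivAt (fun s : ℝ => scl x₀ t₀ R (x + s • ee i) t) (R • (ee i, (0:ℝ))) 0 := by
    have a : HasDerivAt (fun s : ℝ => x₀ + R • (x + s • ee i)) (R • ee i) 0 := by
      have := ((((hasDerivAt_id (0:ℝ)).smul_const (ee i)).const_add x).const_smul R).const_add x₀
      exact this.congr_deriv (by simp)
    have := a.prodMk (hasDerivAt_const (0:ℝ) (t₀ + R ^ 2 * t))
    exact this.congr_deriv (by simp)
  have h2 : HasFDerivAt f (fderiv ℝ f (scl x₀ t₀ R x t))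
      (scl x₀ t₀ R (x + (0:ℝ) • ee i) t) := by simpa using hf.hasFDerivAt
  refine (h2.comp_hasDerivAt (0:ℝ) h1).congr_deriv ?_
  rw [map_smul]; rfl

lemma hasDerivAt_scl {f : E3 × ℝ → ℝ} {x : E3} {t : ℝ}
    (hf : DifferentiableAt ℝ f (scl x₀ t₀ R x t)) :
    HasDerivAt (fun s => f (scl x₀ t₀ R x s)) (R ^ 2 * dT f (scl x₀ t₀ R x t)) t := by
  have h1 : HasDerivAt (fun s : ℝ => scl x₀ t₀ R x s) (R ^ 2 • ((0 : E3), (1:ℝ))) t := by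
    have := (hasDerivAt_const t (x₀ + R • x)).prodMk
      (((hasDerivAt_id t).const_mul (R ^ 2)).const_add t₀)
    exact this.congr_deriv (by simp)
  refine (hf.hasFDerivAt.comp_hasDerivAt t h1).congr_deriv ?_
  rw [map_smul]; rfl

open scoped Pointwise in
lemma integral_scl (hR : 0 < R) (f : E3 → ℝ) :
    ∫ x, f (x₀ + R • x) ∂μB = (R ^ 3)⁻¹ * ∫ x in Metric.ball x₀ R, f x := by
  have e1 := Measure.setIntegral_comp_smul_of_pos (volume : Measure E3) (fun y => f (x₀ + y))
    (Metric.ball (0:E3) 1) hR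
  have e2 := (measurePreserving_add_left (volume : Measure E3) x₀).setIntegral_preimage_emb
    (measurableEmbedding_addLeft x₀) f (Metric.ball x₀ R)
  rw [e1, ← e2]
  have e3 : R • Metric.ball (0:E3) 1 = (fun y => x₀ + y) ⁻¹' Metric.ball x₀ R := by
    rw [smul_unitBall_of_pos hR]; ext y; simp
  rw [e3]
  simp

end scaling

lemma sys_of_flow {u : E3 → ℝ → E3} {P : E3 → ℝ → ℝ} {U : Set (E3 × ℝ)} (N : IsNSQ1 u P U)
    (X : IsAxisym u P U) {x₀ : E3} {t₀ R A κ l : ℝ} (hR : 0 < R) (h0 : x₀ 0 = 0) (h1 : x₀ 1 = 0)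
    (hU : Metric.closedBall x₀ R ×ˢ Ioo (t₀ - R ^ 2) t₀ ⊆ U) (hA : 1 ≤ A)
    (hE : ∀ t ∈ Ioo (t₀ - R ^ 2) t₀, R⁻¹ * ∫ x in Metric.ball x₀ R, ‖u x t‖ ^ 2 ≤ A)
    (hκ : 1 / 2 < κ)
    (hpos : ∀ z ∈ Metric.closedBall x₀ R ×ˢ Ioo (t₀ - R ^ 2) t₀, 0 < κ + l * swirl u z) :
    Sys A (fun x t => κ + l * swirl u (scl x₀ t₀ R x t))
      (fun x t => l * (R ^ 2 * dT (swirl u) (scl x₀ t₀ R x t)))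
      (fun x t => l * (R ^ 2 * vort u (scl x₀ t₀ R x t)))
      (fun i x t => l * (R * dX i (swirl u) (scl x₀ t₀ R x t)))
      (fun i x t => l * (R * (R * dX i (dX i (swirl u)) (scl x₀ t₀ R x t))))
      (fun i x t => R * vel u i (scl x₀ t₀ R x t))
      (fun i x t => R * (R * dX i (vel u i) (scl x₀ t₀ R x t))) := by
  have mem : ∀ x ∈ cB, ∀ t ∈ Ioo (-1:ℝ) 0, scl x₀ t₀ R x t ∈ U := fun x hx t ht =>
    hU (scl_mem hR hx ht)
  have sS := N.smooth_swirl
  have O := N.open_U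
  have dS : ∀ {z}, z ∈ U → DifferentiableAt ℝ (swirl u) z := fun hz =>
    differentiableAt_of_smooth O sS hz
  have ddS : ∀ i {z}, z ∈ U → DifferentiableAt ℝ (dX i (swirl u)) z := fun i z hz =>
    differentiableAt_of_smooth O (contDiffOn_dX O sS i) hz
  have cont : ∀ {f : E3 × ℝ → ℝ}, ContDiffOn ℝ (⊤ : ℕ∞) f U →
      ContinuousOn (fun z : E3 × ℝ => f (scl x₀ t₀ R z.1 z.2)) (cB ×ˢ Ioo (-1:ℝ) 0) :=
    fun hf => hf.continuousOn.comp continuous_scl.continuousOn fun z hz => mem _ hz.1 _ hz.2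
  have cont' : ∀ {f : E3 × ℝ → ℝ}, ContDiffOn ℝ (⊤ : ℕ∞) f U → ∀ t ∈ Ioo (-1:ℝ) 0,
      ContinuousOn (fun x => f (scl x₀ t₀ R x t)) cB :=
    fun hf t ht => (cont hf).comp (f := fun x : E3 => (x, t)) (by fun_prop) fun x hx => ⟨hx, ht⟩
  constructor
  · exact hA
  · intro x hx t ht
    exact ((hasDerivAt_scl (dS (mem x hx t ht))).const_mul l).const_add κ
  · intro i x hx t ht
    have := hasLineDerivAt_scl (dS (mem x hx t ht)) i
    unfold HasLineDerivAt at *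
    exact (this.const_mul l).const_add κ
  · intro i x hx t ht
    have := hasLineDerivAt_scl (ddS i (mem x hx t ht)) i
    unfold HasLineDerivAt at *
    exact (this.const_mul R).const_mul l
  · intro i x hx t ht
    have := hasLineDerivAt_scl (N.diff_vel i (mem x hx t ht)) i
    unfold HasLineDerivAt at *
    exact this.const_mul R
  · intro x hx t ht
    have a : ContDiffAt ℝ 1 (swirl u) (scl x₀ t₀ R x t) :=
      (sS.contDiffAt (O.mem_nhds (mem x hx t ht))).of_le (by exact_mod_cast le_top)
    have b : ContDiffAt ℝ 1 (fun y : E3 => scl x₀ t₀ R y t) x := by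
      unfold scl; fun_prop
    exact contDiffAt_const.add (contDiffAt_const.mul
      (ContDiffAt.comp (g := swirl u) (f := fun y => scl x₀ t₀ R y t) x a b))
  · exact continuousOn_const.add (continuousOn_const.mul (cont sS))
  · exact continuousOn_const.mul (continuousOn_const.mul (cont (contDiffOn_dT O sS)))
  · exact fun i t ht => continuousOn_const.mul (continuousOn_const.mul
      (cont' (contDiffOn_dX O sS i) t ht))
  · exact fun i t ht => continuousOn_const.mul (continuousOn_const.mul (continuousOn_const.mul
      (cont' (contDiffOn_dX O (contDiffOn_dX O sS i) i) t ht)))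
  · exact fun i t ht => continuousOn_const.mul (cont' (N.smooth_vel i) t ht)
  · exact fun i t ht => continuousOn_const.mul (continuousOn_const.mul
      (cont' (N.smooth_dX_vel i i) t ht))
  · intro x hx t ht
    have := N.swirl_eqn X (mem x hx t ht)
    simp only [Fin.sum_univ_three] at this ⊢
    linear_combination l * R ^ 2 * this
  · intro x hx t ht
    rw [N.swirl_axis0 X (mem x hx t ht)]
    simp only [scl, PiLp.add_apply, PiLp.smul_apply, h0, smul_eq_mul]
    ring
  · intro x hx t ht
    rw [N.swirl_axis1 X (mem x hx t ht)]
    simp only [scl, PiLp.add_apply, PiLp.smul_apply, h1, smul_eq_mul]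
    ring
  · intro x hx t ht
    have := N.div_vel (mem x hx t ht)
    simp only [Fin.sum_univ_three] at this ⊢
    linear_combination R ^ 2 * this
  · exact fun x hx t ht => hpos _ (scl_mem hR hx ht)
  · intro x hx t ht hx0 hx1
    have : swirl u (scl x₀ t₀ R x t) = 0 := by
      simp [swirl, scl, h0, h1, hx0, hx1]
    rw [this]; linarith
  · intro t ht
    have hs : t₀ + R ^ 2 * t ∈ Ioo (t₀ - R ^ 2) t₀ :=
      (scl_mem (x₀ := x₀) hR (Metric.mem_closedBall_self zero_le_one) ht).2
    refine le_trans (le_of_eq ?_) (hE _ hs)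
    have e : ∀ x : E3, ∑ i, (R * vel u i (scl x₀ t₀ R x t)) ^ 2 =
        R ^ 2 * (fun y => ‖u y (t₀ + R ^ 2 * t)‖ ^ 2) (x₀ + R • x) := fun x => by
      simp only [EuclideanSpace.norm_sq_eq, Real.norm_eq_abs, sq_abs, mul_pow, Finset.mul_sum]
      rfl
    simp only [e]
    rw [integral_const_mul, integral_scl hR (fun y => ‖u y (t₀ + R ^ 2 * t)‖ ^ 2)]
    field_simp

section osc
variable {u : E3 → ℝ → E3} {P : E3 → ℝ → ℝ} {U : Set (E3 × ℝ)} {x₀ : E3} {t₀ R : ℝ}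

lemma IsNSQ1.cylinder_subset (N : IsNSQ1 u P U) (hz : (x₀, t₀) ∈ Qyl (0, 0) (1/8)) (hR : 0 < R)
    (hR4 : R ≤ 1/4) : Metric.closedBall x₀ R ×ˢ Icc (t₀ - R ^ 2) t₀ ⊆ U := by
  refine Subset.trans ?_ N.subset_U
  rw [Qyl, closure_prod_eq, closure_ball _ (by norm_num), closure_Ioo (by norm_num)]
  obtain ⟨hx, ht1, ht2⟩ := hz
  have hx' : ‖x₀‖ < 1 / 8 := by simpa using hx
  simp only at ht1 ht2
  refine prod_mono (fun y hy => ?_) (Icc_subset_Icc ?_ ht2.le)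
  · rw [mem_closedBall_iff_norm] at hy ⊢
    rw [sub_zero]
    linarith [norm_le_norm_add_norm_sub' y x₀]
  · simp only; nlinarith

lemma qyl_mono {z : E3 × ℝ} {ρ R : ℝ} (hρ : 0 ≤ ρ) (h : ρ ≤ R) : Qyl z ρ ⊆ Qyl z R :=
  prod_mono (Metric.ball_subset_ball h) (Ioo_subset_Ioo_left (by nlinarith))

lemma qyl_nonempty {z : E3 × ℝ} (hR : 0 < R) : (Qyl z R).Nonempty :=
  ⟨(z.1, z.2 - R ^ 2 / 2), Metric.mem_ball_self hR,
    by simp only; nlinarith [pow_pos hR 2], by simp only; nlinarith [pow_pos hR 2]⟩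

lemma qyl_subset_compact {z : E3 × ℝ} :
    Qyl z R ⊆ Metric.closedBall z.1 R ×ˢ Icc (z.2 - R ^ 2) z.2 :=
  prod_mono Metric.ball_subset_closedBall Ioo_subset_Icc_self

/-- `Γ` takes values in `[m, M]` on the cylinder, with `oscΓ = M - m`. -/
lemma IsNSQ1.swirl_range (N : IsNSQ1 u P U) (hz : (x₀, t₀) ∈ Qyl (0, 0) (1/8)) (hR : 0 < R)
    (hR4 : R ≤ 1/4) : ∃ m M, oscΓ u (x₀, t₀) R = M - m ∧
      ∀ z ∈ Metric.closedBall x₀ R ×ˢ Ioo (t₀ - R ^ 2) t₀, m ≤ swirl u z ∧ swirl u z ≤ M := by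
  have hU := N.cylinder_subset hz hR hR4
  have hc : ContinuousOn (swirl u) U := N.smooth_swirl.continuousOn
  have K : IsCompact (Metric.closedBall x₀ R ×ˢ Icc (t₀ - R ^ 2) t₀) :=
    (isCompact_closedBall _ _).prod isCompact_Icc
  have b := K.image_of_continuousOn (hc.mono hU)
  have sub := image_mono (f := swirl u) (qyl_subset_compact (z := (x₀, t₀)) (R := R))
  have ba := b.bddAbove.mono sub
  have bb := b.bddBelow.mono sub
  refine ⟨_, _, rfl, fun z hzz => ?_⟩
  have hzQ : z ∈ closure (Qyl (x₀, t₀) R) := by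
    rw [Qyl, closure_prod_eq, closure_ball _ hR.ne']
    exact ⟨hzz.1, subset_closure hzz.2⟩
  have hzU : z ∈ U := hU ⟨hzz.1, Ioo_subset_Icc_self hzz.2⟩
  have cz := (hc.continuousAt (N.open_U.mem_nhds hzU)).continuousWithinAt (s := Qyl (x₀, t₀) R)
  have := mem_closure_iff_nhdsWithin_neBot.1 hzQ
  refine ⟨ge_of_tendsto cz.tendsto ?_, le_of_tendsto cz.tendsto ?_⟩
  · filter_upwards [self_mem_nhdsWithin] with y hy using csInf_le bb (mem_image_of_mem _ hy)
  · filter_upwards [self_mem_nhdsWithin] with y hy using le_csSup ba (mem_image_of_mem _ hy)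

lemma oscΓ_le {z : E3 × ℝ} (hR : 0 < R) {a b : ℝ}
    (h : ∀ y ∈ Qyl z R, a ≤ swirl u y ∧ swirl u y ≤ b) : oscΓ u z R ≤ b - a := by
  have ne := (qyl_nonempty (z := z) hR).image (swirl u)
  refine sub_le_sub (csSup_le ne ?_) (le_csInf ne ?_)
  · rintro _ ⟨y, hy, rfl⟩; exact (h y hy).2
  · rintro _ ⟨y, hy, rfl⟩; exact (h y hy).1

lemma qyl_subset_mixed {z : E3 × ℝ} :
    Qyl z R ⊆ Metric.closedBall z.1 R ×ˢ Ioo (z.2 - R ^ 2) z.2 :=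
  prod_mono Metric.ball_subset_closedBall Subset.rfl

lemma IsNSQ1.oscΓ_mono (N : IsNSQ1 u P U) (hz : (x₀, t₀) ∈ Qyl (0, 0) (1/8)) {ρ : ℝ}
    (hρ : 0 < ρ) (hρR : ρ ≤ R) (hR4 : R ≤ 1/4) : oscΓ u (x₀, t₀) ρ ≤ oscΓ u (x₀, t₀) R := by
  obtain ⟨m, M, e, H⟩ := N.swirl_range hz (hρ.trans_le hρR) hR4
  rw [e]
  have sub : Qyl (x₀, t₀) ρ ⊆ Metric.closedBall x₀ R ×ˢ Ioo (t₀ - R ^ 2) t₀ :=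
    (qyl_mono hρ.le hρR).trans (qyl_subset_mixed (z := (x₀, t₀)))
  exact oscΓ_le (u := u) (z := (x₀, t₀)) hρ fun y hy => H y (sub hy)

lemma IsNSQ1.oscΓ_nonneg (N : IsNSQ1 u P U) (hz : (x₀, t₀) ∈ Qyl (0, 0) (1/8)) (hR : 0 < R)
    (hR4 : R ≤ 1/4) : 0 ≤ oscΓ u (x₀, t₀) R := by
  obtain ⟨m, M, e, H⟩ := N.swirl_range hz hR hR4
  obtain ⟨y, hy⟩ := qyl_nonempty (z := (x₀, t₀)) hR
  have sub : Qyl (x₀, t₀) R ⊆ Metric.closedBall x₀ R ×ˢ Ioo (t₀ - R ^ 2) t₀ :=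
    qyl_subset_mixed (z := (x₀, t₀))
  have := H y (sub hy)
  rw [e]
  linarith

lemma IsNSQ1.le_AA (N : IsNSQ1 u P U) (hz : (x₀, t₀) ∈ Qyl (0, 0) (1/8)) (hR : 0 < R)
    (hR4 : R ≤ 1/4) {t : ℝ} (ht : t ∈ Ioo (t₀ - R ^ 2) t₀) :
    R⁻¹ * ∫ x in Metric.ball x₀ R, ‖u x t‖ ^ 2 ≤ AA u (x₀, t₀) R := by
  have hU := N.cylinder_subset hz hR hR4
  have K : IsCompact (Metric.closedBall x₀ R ×ˢ Icc (t₀ - R ^ 2) t₀) :=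
    (isCompact_closedBall _ _).prod isCompact_Icc
  obtain ⟨B, hB⟩ := K.exists_bound_of_continuousOn (N.smooth_u.continuousOn.mono hU)
  have bound : ∀ s ∈ Ioo (t₀ - R ^ 2) t₀, R⁻¹ * ∫ x in Metric.ball x₀ R, ‖u x s‖ ^ 2 ≤
      R⁻¹ * (B ^ 2 * volume.real (Metric.ball x₀ R)) := by
    intro s hs
    refine mul_le_mul_of_nonneg_left ?_ (by positivity)
    refine (Real.le_norm_self _).trans (norm_setIntegral_le_of_norm_le_const
      (μ := volume) measure_ball_lt_top fun x hx => ?_)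
    rw [norm_pow, norm_norm]
    exact pow_le_pow_left₀ (norm_nonneg _)
      (hB (x, s) ⟨Metric.ball_subset_closedBall hx, Ioo_subset_Icc_self hs⟩) 2
  unfold AA
  have h := le_ciSup (f := fun s : ℝ => ⨆ _ : s ∈ Ioo (t₀ - R ^ 2) t₀,
    R⁻¹ * ∫ x in Metric.ball x₀ R, ‖u x s‖ ^ 2)
    ⟨R⁻¹ * (B ^ 2 * volume.real (Metric.ball x₀ R)), ?_⟩ t
  · simpa only [ciSup_pos ht] using h
  · rintro _ ⟨s, rfl⟩
    by_cases hs : s ∈ Ioo (t₀ - R ^ 2) t₀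
    · simpa only [ciSup_pos hs] using bound s hs
    · simp only
      have : IsEmpty (s ∈ Ioo (t₀ - R ^ 2) t₀) := ⟨hs⟩
      rw [Real.iSup_of_isEmpty]
      positivity

end osc

lemma osc_step : ∃ C : ℝ, 0 < C ∧ ∀ {u : E3 → ℝ → E3} {P : E3 → ℝ → ℝ} {U : Set (E3 × ℝ)},
    IsNSQ1 u P U → IsAxisym u P U → ∀ {x₀ : E3} {t₀ R A : ℝ}, x₀ 0 = 0 → x₀ 1 = 0 →
    (x₀, t₀) ∈ Qyl (0, 0) (1/8) → 0 < R → R ≤ 1/4 → 1 ≤ A → AA u (x₀, t₀) R ≤ A →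
    oscΓ u (x₀, t₀) (R / 2) ≤ (1 - Real.exp (-(C * A ^ 6)) / 12) * oscΓ u (x₀, t₀) R := by
  obtain ⟨C, C0, key⟩ := lower_bound
  refine ⟨C, C0, ?_⟩
  intro u P U N X x₀ t₀ R A h0 h1 hz hR hR4 hA hAA
  have hR2 : 0 < R / 2 := by positivity
  obtain ⟨m, M, hJ, H⟩ := N.swirl_range hz hR hR4
  have hE : ∀ t ∈ Ioo (t₀ - R ^ 2) t₀, R⁻¹ * ∫ x in Metric.ball x₀ R, ‖u x t‖ ^ 2 ≤ A :=
    fun t ht => (N.le_AA hz hR hR4 ht).trans hAA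
  have hU : Metric.closedBall x₀ R ×ˢ Ioo (t₀ - R ^ 2) t₀ ⊆ U :=
    (prod_mono_right Ioo_subset_Icc_self).trans (N.cylinder_subset hz hR hR4)
  set ε := Real.exp (-(C * A ^ 6)) / 6 with hε
  have eε : 1 - Real.exp (-(C * A ^ 6)) / 12 = 1 - ε / 2 := by rw [hε]; ring
  -- the positivity estimate for an affine function of the swirl
  have pos : ∀ κ l : ℝ, 1 / 2 < κ →
      (∀ z ∈ Metric.closedBall x₀ R ×ˢ Ioo (t₀ - R ^ 2) t₀, 0 < κ + l * swirl u z) →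
      ∀ z ∈ Qyl (x₀, t₀) (R / 2), ε ≤ κ + l * swirl u z := by
    rintro κ l hκ hp ⟨x, t⟩ ⟨hx, ht1, ht2⟩
    have S := sys_of_flow N X hR h0 h1 hU hA hE hκ hp
    have R2 : 0 < R ^ 2 := by positivity
    simp only at hx ht1 ht2
    rw [mem_ball_iff_norm] at hx
    have := key S ((t - t₀) / R ^ 2)
      ⟨by rw [le_div_iff₀ R2]; linarith, div_neg_of_neg_of_pos (by linarith) R2⟩
      (R⁻¹ • (x - x₀)) (by
        rw [mem_ball_zero_iff, norm_smul, Real.norm_eq_abs, abs_of_pos (inv_pos.2 hR),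
          inv_mul_lt_iff₀ hR]
        linarith)
    have es : scl x₀ t₀ R (R⁻¹ • (x - x₀)) ((t - t₀) / R ^ 2) = (x, t) := by
      unfold scl
      rw [smul_inv_smul₀ hR.ne', mul_div_cancel₀ _ R2.ne']
      simp
    simpa only [es] using this
  have axis : swirl u (x₀, t₀ - R ^ 2 / 2) = 0 := by simp [swirl, h0, h1]
  have Rp : 0 < R ^ 2 := by positivity
  have h00 := H (x₀, t₀ - R ^ 2 / 2) ⟨Metric.mem_closedBall_self hR.le,
    by simp only; linarith, by simp only; linarith⟩
  rw [axis] at h00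
  have sub : Qyl (x₀, t₀) (R / 2) ⊆ Metric.closedBall x₀ R ×ˢ Ioo (t₀ - R ^ 2) t₀ :=
    (qyl_mono hR2.le (by linarith)).trans (qyl_subset_mixed (z := (x₀, t₀)))
  rw [eε, hJ]
  rcases (by linarith [h00.1, h00.2] : m ≤ M).eq_or_lt with hmM | hmM
  · have := oscΓ_le (u := u) (z := (x₀, t₀)) hR2 fun y hy => H y (sub hy)
    rw [hmM] at this ⊢
    linarith
  have J0 : 0 < M - m := by linarith
  rcases le_total (-m) M with hc | hc
  · have up : ∀ y ∈ Qyl (x₀, t₀) (R / 2), swirl u y ≤ M - ε / 2 * (M - m) := by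
      intro y hy
      refine le_of_forall_pos_le_add fun s s0 => ?_
      have := pos (2 * (M + s) / (M - m)) (-2 / (M - m))
        (by rw [lt_div_iff₀ J0]; linarith)
        (fun z hz => by
          have := (H z hz).2
          have e : 2 * (M + s) / (M - m) + -2 / (M - m) * swirl u z =
            2 * (M + s - swirl u z) / (M - m) := by ring
          rw [e]
          exact div_pos (by linarith) J0) y hy
      have e : 2 * (M + s) / (M - m) + -2 / (M - m) * swirl u y =
        2 * (M + s - swirl u y) / (M - m) := by ring
      rw [e, le_div_iff₀ J0] at this
      linarith
    have := oscΓ_le (u := u) (z := (x₀, t₀)) hR2 fun y hy => ⟨(H y (sub hy)).1, up y hy⟩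
    linarith
  · have lo : ∀ y ∈ Qyl (x₀, t₀) (R / 2), m + ε / 2 * (M - m) ≤ swirl u y := by
      intro y hy
      refine le_of_forall_pos_le_add fun s s0 => ?_
      have := pos (2 * (s - m) / (M - m)) (2 / (M - m))
        (by rw [lt_div_iff₀ J0]; linarith)
        (fun z hz => by
          have := (H z hz).1
          have e : 2 * (s - m) / (M - m) + 2 / (M - m) * swirl u z =
            2 * (swirl u z + s - m) / (M - m) := by ring
          rw [e]
          exact div_pos (by linarith) J0) y hy
      have e : 2 * (s - m) / (M - m) + 2 / (M - m) * swirl u y =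
        2 * (swirl u y + s - m) / (M - m) := by ring
      rw [e, le_div_iff₀ J0] at this
      linarith
    have := oscΓ_le (u := u) (z := (x₀, t₀)) hR2 fun y hy => ⟨lo y hy, (H y (sub hy)).2⟩
    linarith

/-- A sublinear power is dominated by any linear function, up to a constant. -/
lemma exists_mul_rpow_le {a L η : ℝ} (ha : 0 < a) (ha1 : a < 1) (hL : 0 ≤ L) (hη : 0 < η) :
    ∃ B, 0 ≤ B ∧ ∀ y, 0 ≤ y → L * y ^ a ≤ B + η * y := by
  have b0 : 0 < 1 - a := by linarith
  have hq : 0 ≤ L / η ^ a := by positivity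
  refine ⟨(L / η ^ a) ^ (1 / (1 - a)), by positivity, fun y hy => ?_⟩
  set B := (L / η ^ a) ^ (1 / (1 - a)) with hB
  have B0 : 0 ≤ B := by positivity
  have h := Real.geom_mean_le_arith_mean2_weighted ha.le b0.le (mul_nonneg hη.le hy) B0 (by ring)
  have e : B ^ (1 - a) = L / η ^ a := by
    rw [hB, ← Real.rpow_mul hq, one_div_mul_cancel b0.ne', Real.rpow_one]
  have n : η ^ a ≠ 0 := (Real.rpow_pos_of_pos hη a).ne'
  rw [e, Real.mul_rpow hη.le hy,
    show η ^ a * y ^ a * (L / η ^ a) = L * y ^ a by field_simp] at h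
  have h1 : a * (η * y) ≤ η * y := mul_le_of_le_one_left (mul_nonneg hη.le hy) ha1.le
  have h2 : (1 - a) * B ≤ B := mul_le_of_le_one_left B0 (by linarith)
  linarith

lemma exists_rate_le {C β K τ : ℝ} (hC : 0 < C) (hβ : 0 < β) (hβ' : β < 1/8) (hK : 0 < K)
    (hτ' : τ < 1) : ∃ c, 0 < c ∧ ∀ s, 1 < s →
      c * s ^ (τ - 1) ≤ Real.exp (-(C * max 1 (K * Real.log s ^ β) ^ 6)) / 12 := by
  obtain ⟨B, -, hB⟩ := exists_mul_rpow_le (a := β * 6) (L := C * K ^ 6) (η := 1 - τ)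
    (by linarith) (by linarith) (by positivity) (by linarith)
  refine ⟨Real.exp (-(C + B)) / 12, by positivity, fun s hs => ?_⟩
  have hy : 0 < Real.log s := Real.log_pos hs
  have X0 : 0 ≤ K * Real.log s ^ β := by positivity
  have h6 : max 1 (K * Real.log s ^ β) ^ 6 ≤ 1 + (K * Real.log s ^ β) ^ 6 := by
    rcases max_cases 1 (K * Real.log s ^ β) with h | h <;> rw [h.1]
    · linarith [pow_nonneg X0 6]
    · linarith
  have e6 : (K * Real.log s ^ β) ^ 6 = K ^ 6 * Real.log s ^ (β * 6) := by
    rw [mul_pow, Real.rpow_mul hy.le]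
    norm_cast
  have hBy := hB _ hy.le
  rw [e6] at h6
  have := mul_le_mul_of_nonneg_left h6 hC.le
  rw [Real.rpow_def_of_pos (by linarith), div_mul_eq_mul_div, ← Real.exp_add]
  gcongr
  linarith

lemma rpow_add_log_two_le {s τ : ℝ} (hs : 0 < s) (hτ : 0 < τ) (hτ' : τ < 1) :
    (s + Real.log 2) ^ τ ≤ s ^ τ + s ^ (τ - 1) := by
  have l0 : 0 < Real.log 2 := Real.log_pos (by norm_num)
  have l1 : Real.log 2 ≤ 1 := by linarith [Real.log_two_lt_d9]
  have q0 : 0 < Real.log 2 / s := by positivity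
  have h := rpow_one_add_le_one_add_mul_self (by linarith : (-1 : ℝ) ≤ Real.log 2 / s)
    hτ.le hτ'.le
  have p : 0 < s ^ (τ - 1) := by positivity
  calc (s + Real.log 2) ^ τ = s ^ τ * (1 + Real.log 2 / s) ^ τ := by
        rw [← Real.mul_rpow hs.le (by linarith), mul_one_add, mul_div_cancel₀ _ hs.ne']
    _ ≤ s ^ τ * (1 + τ * (Real.log 2 / s)) := by gcongr
    _ = s ^ τ + τ * Real.log 2 * s ^ (τ - 1) := by
        rw [Real.rpow_sub_one hs.ne']; ring
    _ ≤ s ^ τ + s ^ (τ - 1) := by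
        nlinarith [mul_le_one₀ hτ'.le l0.le l1]

lemma one_lt_log_div {R : ℝ} (hR : 0 < R) (hR4 : R ≤ 1/4) : 1 < Real.log (100 / R) := by
  rw [Real.lt_log_iff_exp_lt (by positivity), lt_div_iff₀ hR]
  nlinarith [Real.exp_one_lt_d9, Real.exp_pos 1]

lemma log_div_half {R : ℝ} (hR : 0 < R) :
    Real.log (100 / (R / 2)) = Real.log (100 / R) + Real.log 2 := by
  rw [← Real.log_mul (by positivity) (by norm_num)]
  congr 1
  field_simp

/-- oscillation decay for `Γ` under the supercritical bound on `A`. -/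
theorem osc_decay (β K τ : ℝ) (hβ : 0 < β) (hβ' : β < 1/8) (hK : 0 < K)
    (hτ : 0 < τ) (hτ' : τ < 1) :
    ∃ c : ℝ, 0 < c ∧
      ∀ (u : E3 → ℝ → E3) (P : E3 → ℝ → ℝ) (U : Set (E3 × ℝ)),
        IsNSQ1 u P U → IsAxisym u P U →
        ∀ (x₀ : E3) (t₀ : ℝ), x₀ 0 = 0 → x₀ 1 = 0 → (x₀, t₀) ∈ Qyl (0, 0) (1/8) →
        (∀ R : ℝ, 0 < R → R ≤ 1/4 → AA u (x₀, t₀) R * omg R ^ β ≤ K) →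
        ∀ ρ R : ℝ, 0 < ρ → ρ < R → R ≤ 1/4 →
          oscΓ u (x₀, t₀) ρ ≤
            Real.exp (-c * ((Real.log (100/ρ)) ^ τ - (Real.log (100/R)) ^ τ - 2)) *
              oscΓ u (x₀, t₀) R := by
  obtain ⟨C, C0, step⟩ := osc_step
  obtain ⟨c, c0, rate⟩ := exists_rate_le C0 hβ hβ' hK hτ'
  refine ⟨c, c0, fun u P U N X x₀ t₀ h0 h1 hz hA ρ R hρ hρR hR4 => ?_⟩
  have half : ∀ r, 0 < r → r ≤ 1/4 → oscΓ u (x₀, t₀) (r / 2) ≤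
      Real.exp (-c * (Real.log (100 / (r / 2)) ^ τ - Real.log (100 / r) ^ τ)) *
        oscΓ u (x₀, t₀) r := by
    intro r hr hr4
    have s1 := one_lt_log_div hr hr4
    have hAr : AA u (x₀, t₀) r ≤ K * Real.log (Real.log (100 / r)) ^ β := by
      have y0 := Real.log_pos s1
      have := hA r hr hr4
      rwa [omg, Real.inv_rpow y0.le, ← div_eq_mul_inv, div_le_iff₀ (by positivity)] at this
    refine (step N X h0 h1 hz hr hr4 (le_max_left _ _) (hAr.trans (le_max_right _ _))).trans
      (mul_le_mul_of_nonneg_right ?_ (N.oscΓ_nonneg hz hr hr4))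
    refine (Real.one_sub_le_exp_neg _).trans (Real.exp_le_exp.2 ?_)
    rw [log_div_half hr, neg_mul]
    refine neg_le_neg ((mul_le_mul_of_nonneg_left ?_ c0.le).trans (rate _ s1))
    linarith [rpow_add_log_two_le (by linarith : 0 < Real.log (100 / r)) hτ hτ']
  have R0 := hρ.trans hρR
  have small : ∀ n : ℕ, R / 2 ^ n ≤ 1 / 4 := fun n =>
    (div_le_self R0.le (one_le_pow₀ (by norm_num))).trans hR4
  have iter : ∀ n : ℕ, oscΓ u (x₀, t₀) (R / 2 ^ n) ≤
      Real.exp (-c * (Real.log (100 / (R / 2 ^ n)) ^ τ - Real.log (100 / R) ^ τ)) *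
        oscΓ u (x₀, t₀) R := by
    intro n
    induction n with
    | zero => simp
    | succ n ih =>
      have h := (half (R / 2 ^ n) (by positivity) (small n)).trans
        (mul_le_mul_of_nonneg_left ih (Real.exp_pos _).le)
      rw [← mul_assoc, ← Real.exp_add, div_div, ← pow_succ, ← mul_add,
        sub_add_sub_cancel] at h
      exact h
  obtain ⟨n, hn, hn1⟩ := exists_nat_pow_near (one_le_div hρ |>.2 hρR.le) one_lt_two
  rw [le_div_iff₀ hρ, mul_comm, ← le_div_iff₀ (by positivity)] at hn
  rw [div_lt_iff₀ hρ, pow_succ, mul_assoc, ← div_lt_iff₀' (by positivity)] at hn1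
  have r0 : 0 < R / 2 ^ n := by positivity
  refine ((N.oscΓ_mono hz hρ hn (small n)).trans (iter n)).trans
    (mul_le_mul_of_nonneg_right (Real.exp_le_exp.2 ?_) (N.oscΓ_nonneg hz R0 hR4))
  have s1 := one_lt_log_div r0 (small n)
  have s0 := one_lt_log_div hρ (hn.trans (small n))
  have hlog : Real.log (100 / ρ) ≤ Real.log (100 / (R / 2 ^ n)) + Real.log 2 := by
    rw [← log_div_half r0]
    refine Real.log_le_log (by positivity) (div_le_div_of_nonneg_left (by norm_num)
      (by positivity) (by linarith))
  have h1 := Real.rpow_le_rpow (by linarith) hlog hτ.le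
  have h2 := rpow_add_log_two_le (by linarith : 0 < Real.log (100 / (R / 2 ^ n))) hτ hτ'
  have h3 := Real.rpow_le_one_of_one_le_of_nonpos s1.le (by linarith : τ - 1 ≤ 0)
  rw [neg_mul, neg_mul, neg_le_neg_iff]
  refine mul_le_mul_of_nonneg_left ?_ c0.le
  linarith
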